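/- arXiv:1007.1366 — 4 statements merged into one kernel-verified Lean document; each statement's English description precedes it below -/
import Mathlib

section
/- For each n ≥ 2 let U^{(n)} be Haar distributed on the unitary group U(n) and set T^{(n)}_{p,q} = Σ_{i≤p, j≤q} |U^{(n)}_{ij}|². Let p(n), q(n) be sequences in {1,…,n} with p(n)/n → s and q(n)/n → t for some s, t ∈ [0,1]. Then the third central moment E[(T^{(n)}_{p(n),q(n)} − E T^{(n)}_{p(n),q(n)})³] (the third classical cumulant of T^{(n)}_{p(n),q(n)}) converges to 0 as n → ∞. -/
open MeasureTheory Matrix Filter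

/-- The entrywise (Borel) measurable structure on matrices. -/
instance matrixMeasurableSpace {m n α : Type*} [MeasurableSpace α] :
    MeasurableSpace (Matrix m n α) :=
  inferInstanceAs (MeasurableSpace (m → n → α))

/-- `T_{p,q} = Σ_{1 ≤ i ≤ p, 1 ≤ j ≤ q} |U_{ij}|²`. -/
noncomputable def truncTraceU (n p q : ℕ) (U : Matrix.unitaryGroup (Fin n) ℂ) : ℝ :=
  ∑ i : Fin n, ∑ j : Fin n,
    if (i : ℕ) < p ∧ (j : ℕ) < q then ‖(U : Matrix (Fin n) (Fin n) ℂ) i j‖ ^ 2 else 0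

namespace TruncU

open scoped Matrix.Norms.L2Operator

variable {n : ℕ}

instance borelMat : BorelSpace (Matrix (Fin n) (Fin n) ℂ) :=
  inferInstanceAs (BorelSpace (Fin n → Fin n → ℂ))

instance secondCountMat : SecondCountableTopology (Matrix (Fin n) (Fin n) ℂ) :=
  inferInstanceAs (SecondCountableTopology (Fin n → Fin n → ℂ))

instance secondCountUni : SecondCountableTopology (Matrix.unitaryGroup (Fin n) ℂ) :=
  TopologicalSpace.Subtype.secondCountableTopology _

instance borelUni : BorelSpace (Matrix.unitaryGroup (Fin n) ℂ) :=
  Subtype.borelSpace _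

lemma norm_uni_le (U : Matrix (Fin n) (Fin n) ℂ) (hU : U ∈ Matrix.unitaryGroup (Fin n) ℂ) :
    ‖U‖ ≤ 1 := by
  rcases subsingleton_or_nontrivial (Matrix (Fin n) (Fin n) ℂ) with h | h
  · rw [Subsingleton.elim U 0]; simp
  · exact (CStarRing.norm_of_mem_unitary hU).le

instance compactUni : CompactSpace (Matrix.unitaryGroup (Fin n) ℂ) := by
  have : ProperSpace (Matrix (Fin n) (Fin n) ℂ) := FiniteDimensional.proper ℂ _
  have : IsCompact (Matrix.unitaryGroup (Fin n) ℂ : Set (Matrix (Fin n) (Fin n) ℂ)) := by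
    apply Metric.isCompact_of_isClosed_isBounded
    · exact isClosed_unitary
    · rw [isBounded_iff_forall_norm_le]
      exact ⟨1, fun U hU => norm_uni_le U hU⟩
  exact isCompact_iff_compactSpace.mp this

lemma integrable_cont (μ : Measure (Matrix.unitaryGroup (Fin n) ℂ)) [IsProbabilityMeasure μ]
    {E : Type*} [NormedAddCommGroup E]
    (f : Matrix.unitaryGroup (Fin n) ℂ → E) (hf : Continuous f) : Integrable f μ := by
  have := hf.continuousOn.integrableOn_compact (μ := μ) isCompact_univ
  simpa using this

/-- one parameter unitary group -/
noncomputable def R (A : Matrix (Fin n) (Fin n) ℂ)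
    (hA : A ∈ skewAdjoint (Matrix (Fin n) (Fin n) ℂ)) (e : ℝ) : Matrix.unitaryGroup (Fin n) ℂ :=
  ⟨NormedSpace.exp (e • A), by
    have hs := skewAdjoint.smul_mem e hA
    let _ : NormedAlgebra ℚ (Matrix (Fin n) (Fin n) ℂ) := .restrictScalars ℚ ℂ _
    exact NormedSpace.exp_mem_unitary_of_mem_skewAdjoint hs⟩

lemma R_add (A : Matrix (Fin n) (Fin n) ℂ) (hA) (e d : ℝ) :
    R A hA (e + d) = R A hA e * R A hA d := by
  apply Subtype.ext
  simp only [R, Submonoid.coe_mul]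
  rw [add_smul, Matrix.exp_add_of_commute]
  exact ((Commute.refl A).smul_left e).smul_right d

lemma R_zero (A : Matrix (Fin n) (Fin n) ℂ) (hA) : R A hA 0 = 1 := by
  apply Subtype.ext
  simp [R]

lemma R_deriv (A : Matrix (Fin n) (Fin n) ℂ) (hA) :
    HasDerivAt (fun e : ℝ => (R A hA e : Matrix (Fin n) (Fin n) ℂ)) A 0 := by
  have := hasDerivAt_exp_smul_const (𝕂 := ℝ) A (0 : ℝ)
  simpa [R] using this

lemma integral_deriv_zero (μ : Measure (Matrix.unitaryGroup (Fin n) ℂ)) [IsProbabilityMeasure μ]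
    [μ.IsMulLeftInvariant] (A : Matrix (Fin n) (Fin n) ℂ) (hA)
    (F F' : Matrix.unitaryGroup (Fin n) ℂ → ℂ) (hF : Continuous F) (hF' : Continuous F')
    (h : ∀ U, HasDerivAt (fun e : ℝ => F (R A hA e * U)) (F' U) 0) :
    ∫ U, F' U ∂μ = 0 := by
  obtain ⟨C, hC⟩ := (isCompact_univ (X := Matrix.unitaryGroup (Fin n) ℂ)).exists_bound_of_continuousOn
    hF'.continuousOn
  have key := hasDerivAt_integral_of_dominated_loc_of_deriv_le (μ := μ) (𝕜 := ℝ) (x₀ := 0)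
    (F := fun e U => F (R A hA e * U)) (F' := fun e U => F' (R A hA e * U)) (s := Set.univ)
    (bound := fun _ => C) Filter.univ_mem
    (Filter.Eventually.of_forall fun e =>
      (integrable_cont μ _ (hF.comp (continuous_const_mul _))).aestronglyMeasurable)
    (integrable_cont μ _ (hF.comp (continuous_const_mul _)))
    (integrable_cont μ _ (hF'.comp (continuous_const_mul _))).aestronglyMeasurable
    (Filter.Eventually.of_forall fun U e _ => hC _ (Set.mem_univ _))
    (integrable_const _)
    (Filter.Eventually.of_forall fun U e _ => by
      have h1 := h (R A hA e * U)
      have h2 : HasDerivAt (fun d : ℝ => d - e) 1 e := (hasDerivAt_id e).sub_const e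
      have h1' : HasDerivAt (fun e_1 : ℝ => F (R A hA e_1 * (R A hA e * U)))
        (F' (R A hA e * U)) (e - e) := by simpa using h1
      have h3 := HasDerivAt.scomp (h := fun d : ℝ => d - e) e h1' h2
      simp only [one_smul] at h3
      convert h3 using 1
      funext d
      simp only [Function.comp]
      rw [← mul_assoc, ← R_add, sub_add_cancel])
  have h2 := key.2
  simp only [integral_mul_left_eq_self F, R_zero, one_mul] at h2
  exact h2.unique (hasDerivAt_const _ _)

/-- The rotated projection. -/
noncomputable def X (Q : Matrix (Fin n) (Fin n) ℂ) (U : Matrix.unitaryGroup (Fin n) ℂ) :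
    Matrix (Fin n) (Fin n) ℂ := U.1 * Q * star U.1

lemma X_cont (Q : Matrix (Fin n) (Fin n) ℂ) : Continuous (X Q) := by
  unfold X
  exact (continuous_subtype_val.mul continuous_const).mul continuous_subtype_val.star

lemma X_deriv (Q : Matrix (Fin n) (Fin n) ℂ) (A : Matrix (Fin n) (Fin n) ℂ) (hA) (U) :
    HasDerivAt (fun e : ℝ => X Q (R A hA e * U)) (A * X Q U - X Q U * A) 0 := by
  have h1 := R_deriv A hA
  have h2 := h1.star
  have h3 := (h1.mul_const (X Q U)).mul h2
  have hA' : star A = -A := hA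
  rw [R_zero] at h3
  have e1 : (fun e : ℝ => X Q (R A hA e * U)) = ((fun y => (R A hA y).1 * X Q U) *
      fun x => star (R A hA x).1) := by
    funext e
    simp only [X, Submonoid.coe_mul, star_mul, Pi.mul_apply]
    noncomm_ring
  have e2 : A * X Q U - X Q U * A = A * X Q U * star (1 : Matrix.unitaryGroup (Fin n) ℂ).1
      + (1 : Matrix.unitaryGroup (Fin n) ℂ).1 * X Q U * star A := by
    simp [hA', sub_eq_add_neg]
  rw [e1, e2]
  exact h3

lemma X_sq (Q : Matrix (Fin n) (Fin n) ℂ) (hQ : Q * Q = Q) (U) : X Q U * X Q U = X Q U := by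
  have h : star U.1 * U.1 = 1 := Matrix.mem_unitaryGroup_iff'.mp U.2
  calc X Q U * X Q U = U.1 * Q * (star U.1 * U.1) * Q * star U.1 := by unfold X; noncomm_ring
    _ = U.1 * (Q * Q) * star U.1 := by rw [h]; noncomm_ring
    _ = _ := by rw [hQ]; rfl

lemma X_trace (Q : Matrix (Fin n) (Fin n) ℂ) (U) : (X Q U).trace = Q.trace := by
  have h : star U.1 * U.1 = 1 := Matrix.mem_unitaryGroup_iff'.mp U.2
  unfold X
  rw [Matrix.trace_mul_comm, ← mul_assoc, h, one_mul]

lemma trace_cont {f : Matrix.unitaryGroup (Fin n) ℂ → Matrix (Fin n) (Fin n) ℂ}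
    (hf : Continuous f) : Continuous fun U => (f U).trace := Continuous.matrix_trace hf

lemma trace_deriv {f : ℝ → Matrix (Fin n) (Fin n) ℂ} {f' : Matrix (Fin n) (Fin n) ℂ} {x : ℝ}
    (hf : HasDerivAt f f' x) : HasDerivAt (fun e => (f e).trace) f'.trace x := by
  let L : Matrix (Fin n) (Fin n) ℂ →L[ℝ] ℂ :=
    LinearMap.toContinuousLinearMap (Matrix.traceLinearMap (Fin n) ℝ ℂ)
  exact L.hasFDerivAt.comp_hasDerivAt x hf

lemma sum_single_two (M N : Matrix (Fin n) (Fin n) ℂ) :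
    ∑ i, ∑ j, (Matrix.single i j (1:ℂ) * M).trace * (Matrix.single j i (1:ℂ) * N).trace
      = (M * N).trace := by
  simp only [Matrix.trace_single_mul]
  simp [Matrix.trace, Matrix.mul_apply]
  rw [Finset.sum_comm]

lemma sum_single_one (M N : Matrix (Fin n) (Fin n) ℂ) :
    ∑ i, ∑ j, (Matrix.single i j (1:ℂ) * (M * (Matrix.single j i (1:ℂ) * N))).trace
      = M.trace * N.trace := by
  have : ∀ i j : Fin n, (Matrix.single i j (1:ℂ) * (M * (Matrix.single j i (1:ℂ) * N))).trace
    = M j j * N i i := by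
    intro i j
    rw [Matrix.trace_single_mul, ← mul_assoc]
    simp [Matrix.mul_apply, Matrix.single_apply, ite_and, Finset.sum_ite_eq]
  simp only [this]
  simp only [Matrix.trace, Matrix.diag]
  rw [Finset.sum_comm, Finset.sum_mul_sum]

lemma norm_trace_le (M : Matrix (Fin n) (Fin n) ℂ) (hM : ‖M‖ ≤ 1) : ‖M.trace‖ ≤ n := by
  have h : ∀ i, ‖M i i‖ ≤ 1 := by
    intro i
    have h1 := Matrix.l2_opNorm_mulVec M (EuclideanSpace.single i (1:ℂ))
    have h2 := PiLp.norm_apply_le (WithLp.toLp 2 (M.mulVec (EuclideanSpace.single i (1:ℂ)).ofLp)) i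
    simp at h1 h2
    exact (h2.trans h1).trans hM
  calc ‖M.trace‖ ≤ ∑ i, ‖M i i‖ := norm_sum_le _ _
    _ ≤ ∑ i : Fin n, (1:ℝ) := Finset.sum_le_sum fun i _ => h i
    _ = n := by simp

lemma X_norm (Q : Matrix (Fin n) (Fin n) ℂ) (hQ : ‖Q‖ ≤ 1) (U) : ‖X Q U‖ ≤ 1 := by
  have h1 := norm_uni_le U.1 U.2
  have h2 : ‖star U.1‖ ≤ 1 := by rw [norm_star]; exact h1
  unfold X
  exact (norm_mul_le_of_le (norm_mul_le_of_le h1 hQ) h2).trans (by norm_num)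

/-- the integrand of the loop equation -/
noncomputable def loopF (P Q A B : Matrix (Fin n) (Fin n) ℂ)
    (g : Matrix.unitaryGroup (Fin n) ℂ → ℂ)
    (G : Matrix.unitaryGroup (Fin n) ℂ → Matrix (Fin n) (Fin n) ℂ)
    (U : Matrix.unitaryGroup (Fin n) ℂ) : ℂ :=
  (P * (B * (A * X Q U - X Q U * A) - (A * X Q U - X Q U * A) * B)).trace * g U
    + (P * (B * X Q U - X Q U * B)).trace * (G U * (A * X Q U - X Q U * A)).trace

lemma loopF_cont (P Q A B : Matrix (Fin n) (Fin n) ℂ)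
    (g : Matrix.unitaryGroup (Fin n) ℂ → ℂ)
    (G : Matrix.unitaryGroup (Fin n) ℂ → Matrix (Fin n) (Fin n) ℂ)
    (hg : Continuous g) (hG : Continuous G) : Continuous (loopF P Q A B g G) := by
  have hX := X_cont Q
  unfold loopF
  refine ((trace_cont ?_).mul hg).add ((trace_cont ?_).mul (trace_cont ?_)) <;> fun_prop

/-- `G` is a gradient for `g`. -/
def IsGrad (Q : Matrix (Fin n) (Fin n) ℂ)
    (g : Matrix.unitaryGroup (Fin n) ℂ → ℂ)
    (G : Matrix.unitaryGroup (Fin n) ℂ → Matrix (Fin n) (Fin n) ℂ) : Prop :=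
  ∀ A (hA : A ∈ skewAdjoint (Matrix (Fin n) (Fin n) ℂ)) U,
    HasDerivAt (fun e : ℝ => g (R A hA e * U)) (G U * (A * X Q U - X Q U * A)).trace 0

lemma loop_skew (μ : Measure (Matrix.unitaryGroup (Fin n) ℂ)) [IsProbabilityMeasure μ]
    [μ.IsMulLeftInvariant] (P Q A B : Matrix (Fin n) (Fin n) ℂ)
    (hA : A ∈ skewAdjoint (Matrix (Fin n) (Fin n) ℂ))
    (g : Matrix.unitaryGroup (Fin n) ℂ → ℂ)
    (G : Matrix.unitaryGroup (Fin n) ℂ → Matrix (Fin n) (Fin n) ℂ)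
    (hg : Continuous g) (hG : Continuous G) (hgG : IsGrad Q g G) :
    ∫ U, loopF P Q A B g G U ∂μ = 0 := by
  have hX := X_cont Q
  have hc : Continuous (fun U => (P * (B * X Q U - X Q U * B)).trace * g U) :=
    (trace_cont (by fun_prop)).mul hg
  refine integral_deriv_zero μ A hA _ _ hc (loopF_cont P Q A B g G hg hG) ?_
  intro U
  unfold loopF
  have h1 := X_deriv Q A hA U
  have h2 := trace_deriv (((h1.const_mul B).sub (h1.mul_const B)).const_mul P)
  simp only [Pi.sub_apply] at h2
  have h3 := h2.mul (hgG A hA U)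
  rw [R_zero, one_mul] at h3
  exact h3

lemma loop_any (μ : Measure (Matrix.unitaryGroup (Fin n) ℂ)) [IsProbabilityMeasure μ]
    [μ.IsMulLeftInvariant] (P Q A B : Matrix (Fin n) (Fin n) ℂ)
    (g : Matrix.unitaryGroup (Fin n) ℂ → ℂ)
    (G : Matrix.unitaryGroup (Fin n) ℂ → Matrix (Fin n) (Fin n) ℂ)
    (hg : Continuous g) (hG : Continuous G) (hgG : IsGrad Q g G) :
    ∫ U, loopF P Q A B g G U ∂μ = 0 := by
  have h1 : A - star A ∈ skewAdjoint (Matrix (Fin n) (Fin n) ℂ) := by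
    rw [skewAdjoint.mem_iff]; simp
  have h2 : Complex.I • (A + star A) ∈ skewAdjoint (Matrix (Fin n) (Fin n) ℂ) := by
    rw [skewAdjoint.mem_iff]
    simp only [star_smul, star_add, star_star]
    rw [add_comm, ← neg_smul]
    simp
  have e : ∀ U, loopF P Q A B g G U = (1/2 : ℂ) * loopF P Q (A - star A) B g G U
      + (- Complex.I / 2) * loopF P Q (Complex.I • (A + star A)) B g G U := by
    intro U
    have hA : A = (1/2 : ℂ) • (A - star A) + (- Complex.I / 2) • (Complex.I • (A + star A)) := by
      rw [smul_smul]
      have : -Complex.I / 2 * Complex.I = 1/2 := by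
        linear_combination (-1/2 : ℂ) * Complex.I_mul_I
      rw [this, ← smul_add]
      have : A - star A + (A + star A) = (2:ℂ) • A := by rw [two_smul]; abel
      rw [this, smul_smul]; norm_num
    generalize A - star A = A1 at *
    generalize Complex.I • (A + star A) = A2 at *
    rw [hA]
    simp only [loopF, mul_add, add_mul, mul_sub, sub_mul, Matrix.smul_mul, Matrix.mul_smul,
      Matrix.trace_add, Matrix.trace_sub, Matrix.trace_smul, smul_eq_mul]
    ring
  simp only [e]
  rw [integral_add, integral_const_mul, integral_const_mul,
    loop_skew μ P Q _ B h1 g G hg hG hgG, loop_skew μ P Q _ B h2 g G hg hG hgG]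
  · simp
  · exact (integrable_cont μ _ (loopF_cont P Q _ B g G hg hG)).const_mul _
  · exact (integrable_cont μ _ (loopF_cont P Q _ B g G hg hG)).const_mul _

lemma trace_four (A B P Y : Matrix (Fin n) (Fin n) ℂ) :
    (P * (B * (A * Y - Y * A) - (A * Y - Y * A) * B)).trace =
      (B * (1 * (A * (Y * P)))).trace - (B * (Y * (A * P))).trace
      - (B * (P * (A * Y))).trace + (B * ((P * Y) * (A * 1))).trace := by
  have e : P * (B * (A * Y - Y * A) - (A * Y - Y * A) * B) =
    P * (B * A * Y) - P * (B * Y * A) - (P * (A * Y)) * B + (P * Y * A) * B := by noncomm_ring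
  rw [e, Matrix.trace_add, Matrix.trace_sub, Matrix.trace_sub, Matrix.trace_mul_comm P,
    Matrix.trace_mul_comm P, Matrix.trace_mul_comm _ B, Matrix.trace_mul_comm _ B]
  simp only [mul_assoc, one_mul, mul_one]

lemma trace_comm2 (P B Y : Matrix (Fin n) (Fin n) ℂ) :
    (P * (B * Y - Y * B)).trace = (B * (Y * P - P * Y)).trace := by
  have e : P * (B * Y - Y * B) = P * (B * Y) - (P * Y) * B := by noncomm_ring
  rw [e, Matrix.trace_sub, Matrix.trace_mul_comm P, Matrix.trace_mul_comm _ B,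
    ← Matrix.trace_sub]
  congr 1
  noncomm_ring

lemma loopF_sum (P Q : Matrix (Fin n) (Fin n) ℂ)
    (g : Matrix.unitaryGroup (Fin n) ℂ → ℂ)
    (G : Matrix.unitaryGroup (Fin n) ℂ → Matrix (Fin n) (Fin n) ℂ) (U) :
    ∑ i, ∑ j, loopF P Q (Matrix.single j i 1) (Matrix.single i j 1) g G U =
      2 * (n * (P * X Q U).trace - P.trace * Q.trace) * g U
      + ((X Q U * P - P * X Q U) * (X Q U * G U - G U * X Q U)).trace := by
  have hT := X_trace Q U
  simp only [loopF]
  generalize X Q U = Y at *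
  have e : ∀ i j : Fin n,
      (P * (Matrix.single i j (1:ℂ) * (Matrix.single j i (1:ℂ) * Y - Y * Matrix.single j i (1:ℂ))
        - (Matrix.single j i (1:ℂ) * Y - Y * Matrix.single j i (1:ℂ)) *
          Matrix.single i j (1:ℂ))).trace * g U
        + (P * (Matrix.single i j (1:ℂ) * Y - Y * Matrix.single i j (1:ℂ))).trace
          * (G U * (Matrix.single j i (1:ℂ) * Y - Y * Matrix.single j i (1:ℂ))).trace =
     ((Matrix.single i j (1:ℂ) * (1 * (Matrix.single j i (1:ℂ) * (Y * P)))).trace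
      - (Matrix.single i j (1:ℂ) * (Y * (Matrix.single j i (1:ℂ) * P))).trace
      - (Matrix.single i j (1:ℂ) * (P * (Matrix.single j i (1:ℂ) * Y))).trace
      + (Matrix.single i j (1:ℂ) * ((P * Y) * (Matrix.single j i (1:ℂ) * 1))).trace) * g U
      + (Matrix.single i j (1:ℂ) * (Y * P - P * Y)).trace
       * (Matrix.single j i (1:ℂ) * (Y * G U - G U * Y)).trace := by
    intro i j
    rw [trace_four, trace_comm2, trace_comm2 (G U)]
  simp only [e, Finset.sum_add_distrib, Finset.sum_sub_distrib, ← Finset.sum_mul, sum_single_two,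
    sum_single_one]
  rw [hT, Matrix.trace_mul_comm Y P, Matrix.trace_one, Fintype.card_fin]
  ring

lemma loop_eq (μ : Measure (Matrix.unitaryGroup (Fin n) ℂ)) [IsProbabilityMeasure μ]
    [μ.IsMulLeftInvariant] (P Q : Matrix (Fin n) (Fin n) ℂ)
    (g : Matrix.unitaryGroup (Fin n) ℂ → ℂ)
    (G : Matrix.unitaryGroup (Fin n) ℂ → Matrix (Fin n) (Fin n) ℂ)
    (hg : Continuous g) (hG : Continuous G) (hgG : IsGrad Q g G) :
    ∫ U, (2 * (n * (P * X Q U).trace - P.trace * Q.trace) * g U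
      + ((X Q U * P - P * X Q U) * (X Q U * G U - G U * X Q U)).trace) ∂μ = 0 := by
  simp only [← loopF_sum]
  rw [integral_finsetSum]
  · refine Finset.sum_eq_zero fun i _ => ?_
    rw [integral_finsetSum]
    · exact Finset.sum_eq_zero fun j _ => loop_any μ P Q _ _ g G hg hG hgG
    · exact fun j _ => integrable_cont μ _ (loopF_cont P Q _ _ g G hg hG)
  · exact fun i _ => integrable_finsetSum _ fun j _ =>
      integrable_cont μ _ (loopF_cont P Q _ _ g G hg hG)

lemma trace_c1 (P Y : Matrix (Fin n) (Fin n) ℂ) (hP : P * P = P) (hY : Y * Y = Y) :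
    ((Y * P - P * Y) * (Y * P - P * Y)).trace
      = 2 * (P * Y * P * Y).trace - 2 * (P * Y).trace := by
  have e : (Y * P - P * Y) * (Y * P - P * Y) =
     Y * (P * Y * P) - Y * (P * P) * Y - P * (Y * Y) * P + P * Y * P * Y := by noncomm_ring
  rw [e, hP, hY, Matrix.trace_add, Matrix.trace_sub, Matrix.trace_sub, Matrix.trace_mul_comm Y,
    mul_assoc Y P Y, Matrix.trace_mul_comm Y (P * Y), mul_assoc P Y Y, hY,
    Matrix.trace_mul_comm (P * Y) P, ← mul_assoc P P Y, hP]
  ring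

lemma trace_c2 (P Y : Matrix (Fin n) (Fin n) ℂ) (hP : P * P = P) (hY : Y * Y = Y) :
    ((Y * P - P * Y) * (Y * (P * Y * P) - (P * Y * P) * Y)).trace
      = 2 * (P * Y * P * Y * P * Y).trace - 2 * (P * Y * P * Y).trace := by
  have e : (Y * P - P * Y) * (Y * (P * Y * P) - (P * Y * P) * Y) =
     Y * (P * Y * P * Y * P) - Y * ((P * P) * Y * P * Y) - (P * (Y * Y) * P * Y) * P
      + P * Y * P * Y * P * Y := by noncomm_ring
  have e1 : P * Y * P * Y * Y = P * Y * P * Y := by rw [mul_assoc _ Y Y, hY]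
  have e2 : P * (P * Y * P * Y) = P * Y * P * Y := by simp only [← mul_assoc, hP]
  rw [e, hP, hY, Matrix.trace_add, Matrix.trace_sub, Matrix.trace_sub, Matrix.trace_mul_comm Y,
    Matrix.trace_mul_comm Y, Matrix.trace_mul_comm _ P, e1, e2]
  ring

lemma grad_const (Q : Matrix (Fin n) (Fin n) ℂ) (c : ℂ) :
    IsGrad Q (fun _ => c) (fun _ => 0) := by
  intro A hA U
  simpa using hasDerivAt_const (0:ℝ) c

lemma grad_one (P Q : Matrix (Fin n) (Fin n) ℂ) (c : ℂ) :
    IsGrad Q (fun U => (P * X Q U).trace - c) (fun _ => P) := by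
  intro A hA U
  exact (trace_deriv ((X_deriv Q A hA U).const_mul P)).sub_const c

lemma grad_sq (Q : Matrix (Fin n) (Fin n) ℂ) (g G) (h : IsGrad Q g G) :
    IsGrad Q (fun U => g U ^ 2) (fun U => (2 * g U) • G U) := by
  intro A hA U
  have h1 := (h A hA U).mul (h A hA U)
  rw [R_zero, one_mul] at h1
  have e : (((2 * g U) • G U) * (A * X Q U - X Q U * A)).trace =
    (G U * (A * X Q U - X Q U * A)).trace * g U + g U * (G U * (A * X Q U - X Q U * A)).trace := by
    rw [Matrix.smul_mul, Matrix.trace_smul, smul_eq_mul]; ring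
  rw [e]
  simp only [pow_two]
  exact h1

lemma grad_two (P Q : Matrix (Fin n) (Fin n) ℂ) :
    IsGrad Q (fun U => (P * X Q U * P * X Q U).trace) (fun U => (2:ℂ) • (P * X Q U * P)) := by
  intro A hA U
  have h0 := X_deriv Q A hA U
  have h1 := trace_deriv (((h0.const_mul P).mul_const P).mul h0)
  rw [R_zero, one_mul] at h1
  have e : (((2:ℂ) • (P * X Q U * P)) * (A * X Q U - X Q U * A)).trace =
    (P * (A * X Q U - X Q U * A) * P * X Q U + P * X Q U * P * (A * X Q U - X Q U * A)).trace := by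
    generalize A * X Q U - X Q U * A = Z
    have e2 : P * Z * P * X Q U = (P * Z) * (P * X Q U) := by noncomm_ring
    rw [Matrix.trace_add, e2, Matrix.trace_mul_comm (P * Z), Matrix.smul_mul, Matrix.trace_smul]
    simp only [← mul_assoc, smul_eq_mul]
    ring
  rw [e]
  exact h1

lemma norm_int_le (μ : Measure (Matrix.unitaryGroup (Fin n) ℂ)) [IsProbabilityMeasure μ]
    (f : Matrix.unitaryGroup (Fin n) ℂ → ℂ) (C : ℝ) (h : ∀ U, ‖f U‖ ≤ C) :
    ‖∫ U, f U ∂μ‖ ≤ C := by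
  simpa using norm_integral_le_of_norm_le_const (μ := μ) (Filter.Eventually.of_forall h)

lemma third_bound (μ : Measure (Matrix.unitaryGroup (Fin n) ℂ)) [IsProbabilityMeasure μ]
    [μ.IsMulLeftInvariant] (hn : 0 < n) (P Q : Matrix (Fin n) (Fin n) ℂ) (hP : P * P = P)
    (hQ : Q * Q = Q) (hP1 : ‖P‖ ≤ 1) (hQ1 : ‖Q‖ ≤ 1) :
    ‖∫ U, ((P * X Q U).trace - ∫ V, (P * X Q V).trace ∂μ) ^ 3 ∂μ‖ ≤ 12 / n := by
  have hX := X_cont Q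
  have hn0 : (n : ℂ) ≠ 0 := by exact_mod_cast hn.ne'
  have hnr : (0 : ℝ) < n := by exact_mod_cast hn
  have hXsq := X_sq Q hQ
  obtain ⟨t1, ht1⟩ : ∃ t1, t1 = fun U => (P * X Q U).trace := ⟨_, rfl⟩
  obtain ⟨t2, ht2⟩ : ∃ t2, t2 = fun U => (P * X Q U * P * X Q U).trace := ⟨_, rfl⟩
  obtain ⟨t3, ht3⟩ : ∃ t3, t3 = fun U => (P * X Q U * P * X Q U * P * X Q U).trace := ⟨_, rfl⟩
  have c1 : Continuous t1 := by rw [ht1]; exact trace_cont (by fun_prop)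
  have c2 : Continuous t2 := by rw [ht2]; exact trace_cont (by fun_prop)
  have c3 : Continuous t3 := by rw [ht3]; exact trace_cont (by fun_prop)
  have hPX : ∀ U, ‖P * X Q U‖ ≤ 1 := fun U =>
    (norm_mul_le_of_le hP1 (X_norm Q hQ1 U)).trans (by norm_num)
  have hPX2 : ∀ U, ‖P * X Q U * P * X Q U‖ ≤ 1 := fun U => by
    rw [mul_assoc]
    exact (norm_mul_le_of_le (hPX U) (hPX U)).trans (by norm_num)
  have hPX3 : ∀ U, ‖P * X Q U * P * X Q U * P * X Q U‖ ≤ 1 := fun U => by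
    rw [mul_assoc (P * X Q U * P * X Q U)]
    exact (norm_mul_le_of_le (hPX2 U) (hPX U)).trans (by norm_num)
  have b1 : ∀ U, ‖t1 U‖ ≤ n := fun U => by rw [ht1]; exact norm_trace_le _ (hPX U)
  have b2 : ∀ U, ‖t2 U‖ ≤ n := fun U => by rw [ht2]; exact norm_trace_le _ (hPX2 U)
  have b3 : ∀ U, ‖t3 U‖ ≤ n := fun U => by rw [ht3]; exact norm_trace_le _ (hPX3 U)
  obtain ⟨c, hc⟩ : ∃ c, c = ∫ V, (P * X Q V).trace ∂μ := ⟨_, rfl⟩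
  rw [← hc]
  have I1 := integrable_cont μ _ c1
  have I2 := integrable_cont μ _ c2
  have I3 := integrable_cont μ _ c3
  have I12 : Integrable (fun U => t1 U - t2 U) μ := I1.sub I2
  have I23 : Integrable (fun U => t2 U - t3 U) μ := I2.sub I3
  have hct : ∫ V, t1 V ∂μ = c := by rw [hc, ht1]
  -- the mean
  have m0 := loop_eq μ P Q (fun _ => 1) (fun _ => 0) continuous_const continuous_const
    (grad_const Q 1)
  have m1 : (n : ℂ) * c = P.trace * Q.trace := by
    have e : ∀ U, (2 * (n * (P * X Q U).trace - P.trace * Q.trace) * 1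
      + ((X Q U * P - P * X Q U) * (X Q U * 0 - 0 * X Q U)).trace)
      = (2 * n) * t1 U - 2 * (P.trace * Q.trace) := by
      intro U; rw [ht1]; simp; ring
    simp only [e] at m0
    rw [integral_sub (I1.const_mul _) (integrable_const _), integral_const_mul, hct] at m0
    simp at m0
    linear_combination (1/2 : ℂ) * m0
  obtain ⟨f, hf⟩ : ∃ f, f = fun U => t1 U - c := ⟨_, rfl⟩
  have cf : Continuous f := by rw [hf]; fun_prop
  have If := integrable_cont μ _ cf
  have If2 : Integrable (fun U => f U ^ 2) μ := integrable_cont μ _ (cf.pow 2)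
  have If3 : Integrable (fun U => f U ^ 3) μ := integrable_cont μ _ (cf.pow 3)
  have Ift2 : Integrable (fun U => f U * t2 U) μ := integrable_cont μ _ (cf.mul c2)
  have hf0 : ∫ U, f U ∂μ = 0 := by
    rw [hf, integral_sub I1 (integrable_const _), hct]; simp
  have gf : IsGrad Q f (fun _ => P) := by
    rw [hf, ht1]; exact grad_one P Q c
  -- variance
  have v0 := loop_eq μ P Q f (fun _ => P) cf continuous_const gf
  have v1 : n * ∫ U, f U ^ 2 ∂μ = ∫ U, (t1 U - t2 U) ∂μ := by
    have e : ∀ U, (2 * (n * (P * X Q U).trace - P.trace * Q.trace) * f U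
      + ((X Q U * P - P * X Q U) * (X Q U * P - P * X Q U)).trace)
      = (2 * n) * (f U ^ 2) - 2 * (t1 U - t2 U) := by
      intro U
      rw [trace_c1 P _ hP (hXsq U), ← m1, hf, ht1, ht2]
      ring
    simp only [e] at v0
    rw [integral_sub (If2.const_mul _) (I12.const_mul _), integral_const_mul,
      integral_const_mul] at v0
    linear_combination (1/2 : ℂ) * v0
  -- covariance with t2
  have w0 := loop_eq μ P Q t2 (fun U => (2:ℂ) • (P * X Q U * P)) c2 (by fun_prop)
    (by rw [ht2]; exact grad_two P Q)
  have w1 : n * ∫ U, f U * t2 U ∂μ = 2 * ∫ U, (t2 U - t3 U) ∂μ := by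
    have e : ∀ U, (2 * (n * (P * X Q U).trace - P.trace * Q.trace) * t2 U
      + ((X Q U * P - P * X Q U) * (X Q U * ((2:ℂ) • (P * X Q U * P))
        - ((2:ℂ) • (P * X Q U * P)) * X Q U)).trace)
      = (2 * n) * (f U * t2 U) - 4 * (t2 U - t3 U) := by
      intro U
      rw [Matrix.mul_smul, Matrix.smul_mul, ← smul_sub, Matrix.mul_smul, Matrix.trace_smul,
        trace_c2 P _ hP (hXsq U), ← m1, hf, ht1, ht2, ht3, smul_eq_mul]
      ring
    simp only [e] at w0
    rw [integral_sub (Ift2.const_mul _) (I23.const_mul _), integral_const_mul,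
      integral_const_mul] at w0
    linear_combination (1/2 : ℂ) * w0
  -- third moment
  have z0 := loop_eq μ P Q (fun U => f U ^ 2) (fun U => (2 * f U) • P) (by fun_prop) (by fun_prop)
    (grad_sq Q f _ gf)
  have z1 : n * ∫ U, f U ^ 3 ∂μ = 2 * ∫ U, f U ^ 2 ∂μ - 2 * ∫ U, f U * t2 U ∂μ := by
    have e : ∀ U, (2 * (n * (P * X Q U).trace - P.trace * Q.trace) * f U ^ 2
      + ((X Q U * P - P * X Q U) * (X Q U * ((2 * f U) • P) - ((2 * f U) • P) * X Q U)).trace)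
      = (2 * n) * (f U ^ 3) - (4 * f U ^ 2 + (4 * c) * f U - 4 * (f U * t2 U)) := by
      intro U
      rw [Matrix.mul_smul, Matrix.smul_mul, ← smul_sub, Matrix.mul_smul, Matrix.trace_smul,
        trace_c1 P _ hP (hXsq U), ← m1, hf, ht1, ht2, smul_eq_mul]
      ring
    simp only [e] at z0
    have J1 : Integrable (fun U => 4 * f U ^ 2 + (4 * c) * f U) μ :=
      (If2.const_mul _).add (If.const_mul _)
    have J2 : Integrable (fun U => 4 * f U ^ 2 + (4 * c) * f U - 4 * (f U * t2 U)) μ :=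
      J1.sub (Ift2.const_mul _)
    rw [integral_sub (If3.const_mul _) J2,
      integral_sub J1 (Ift2.const_mul _),
      integral_add (If2.const_mul _) (If.const_mul _)] at z0
    simp only [integral_const_mul, hf0] at z0
    linear_combination (1/2 : ℂ) * z0
  have n1 : ‖∫ U, f U ^ 2 ∂μ‖ ≤ 2 := by
    have h := norm_int_le μ (fun U => t1 U - t2 U) (2 * n) (fun U =>
      (norm_sub_le _ _).trans (by linarith [b1 U, b2 U]))
    rw [← v1, norm_mul, Complex.norm_natCast] at h
    nlinarith
  have n2 : ‖∫ U, f U * t2 U ∂μ‖ ≤ 4 := by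
    have h := norm_int_le μ (fun U => t2 U - t3 U) (2 * n) (fun U =>
      (norm_sub_le _ _).trans (by linarith [b2 U, b3 U]))
    have h2 := congrArg norm w1
    rw [norm_mul, norm_mul, Complex.norm_natCast] at h2
    norm_num at h2
    nlinarith
  have h3 := congrArg norm z1
  rw [norm_mul, Complex.norm_natCast] at h3
  have h4 := norm_sub_le (2 * ∫ U, f U ^ 2 ∂μ) (2 * ∫ U, f U * t2 U ∂μ)
  rw [norm_mul, norm_mul] at h4
  norm_num at h4
  have : ∫ U, ((P * X Q U).trace - c) ^ 3 ∂μ = ∫ U, f U ^ 3 ∂μ := by rw [hf, ht1]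
  rw [this, le_div_iff₀ hnr]
  linarith

/-- coordinate projection -/
noncomputable def proj (n p : ℕ) : Matrix (Fin n) (Fin n) ℂ :=
  Matrix.diagonal fun i => if (i : ℕ) < p then 1 else 0

lemma proj_sq (p : ℕ) : proj n p * proj n p = proj n p := by
  simp [proj]

lemma proj_norm (p : ℕ) : ‖proj n p‖ ≤ 1 := by
  rw [proj, Matrix.l2_opNorm_diagonal, pi_norm_le_iff_of_nonneg zero_le_one]
  intro i
  split_ifs <;> simp

lemma trace_eq (p q : ℕ) (U : Matrix.unitaryGroup (Fin n) ℂ) :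
    (proj n p * X (proj n q) U).trace = (truncTraceU n p q U : ℂ) := by
  unfold truncTraceU proj X Matrix.trace
  push_cast
  refine Finset.sum_congr rfl fun i _ => ?_
  rw [Matrix.diag_apply, Matrix.diagonal_mul, Matrix.mul_apply, Finset.mul_sum]
  refine Finset.sum_congr rfl fun j _ => ?_
  rw [Matrix.mul_diagonal, Matrix.star_apply]
  by_cases hi : (i : ℕ) < p <;> by_cases hj : (j : ℕ) < q <;> simp [hi, hj]
  rw [Complex.mul_conj']

end TruncU
/-- If `U⁽ⁿ⁾` is Haar distributed on `U(n)` and `p(n)/n → s`, `q(n)/n → t`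
with `1 ≤ p(n), q(n) ≤ n` and `s, t ∈ [0,1]`, then the third central moment
`E[(T_{p(n),q(n)} - E T_{p(n),q(n)})³]` (the third classical cumulant) converges to `0`. -/
theorem third_cumulant_truncTraceU_tendsto_zero
    (μ : ∀ n : ℕ, Measure (Matrix.unitaryGroup (Fin n) ℂ))
    (hHaar : ∀ n, (μ n).IsHaarMeasure) (hProb : ∀ n, IsProbabilityMeasure (μ n))
    (p q : ℕ → ℕ)
    (hp : ∀ n, 2 ≤ n → 1 ≤ p n ∧ p n ≤ n) (hq : ∀ n, 2 ≤ n → 1 ≤ q n ∧ q n ≤ n)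
    (s t : ℝ) (hs : s ∈ Set.Icc (0 : ℝ) 1) (ht : t ∈ Set.Icc (0 : ℝ) 1)
    (hps : Tendsto (fun n : ℕ => (p n : ℝ) / n) atTop (nhds s))
    (hqt : Tendsto (fun n : ℕ => (q n : ℝ) / n) atTop (nhds t)) :
    Tendsto (fun n : ℕ =>
        ∫ U, (truncTraceU n (p n) (q n) U -
          ∫ V, truncTraceU n (p n) (q n) V ∂(μ n)) ^ 3 ∂(μ n))
      atTop (nhds 0) := by
  have hb : ∀ n : ℕ, 1 ≤ n → ‖∫ U, (truncTraceU n (p n) (q n) U -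
          ∫ V, truncTraceU n (p n) (q n) V ∂(μ n)) ^ 3 ∂(μ n)‖ ≤ 12 / n := by
    intro n hn
    have := hHaar n
    have := hProb n
    have h := TruncU.third_bound (μ n) hn (TruncU.proj n (p n)) (TruncU.proj n (q n))
      (TruncU.proj_sq _) (TruncU.proj_sq _) (TruncU.proj_norm _) (TruncU.proj_norm _)
    simp only [TruncU.trace_eq] at h
    rw [integral_complex_ofReal] at h
    have e : ∫ U, ((truncTraceU n (p n) (q n) U : ℂ) -
        ((∫ V, truncTraceU n (p n) (q n) V ∂(μ n) : ℝ) : ℂ)) ^ 3 ∂(μ n) =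
        ((∫ U, (truncTraceU n (p n) (q n) U -
          ∫ V, truncTraceU n (p n) (q n) V ∂(μ n)) ^ 3 ∂(μ n) : ℝ) : ℂ) := by
      generalize (∫ V, truncTraceU n (p n) (q n) V ∂(μ n)) = m
      rw [← integral_complex_ofReal]
      simp only [Complex.ofReal_pow, Complex.ofReal_sub]
    rw [e, Complex.norm_real] at h
    exact h
  refine squeeze_zero_norm' ?_ (tendsto_const_div_atTop_nhds_zero_nat (12 : ℝ))
  filter_upwards [Filter.eventually_ge_atTop 1] with n hn using hb n hn
end

section
/- For each n ≥ 2 let U^{(n)} be Haar distributed on the unitary group U(n) and set T^{(n)}_{p,q} = Σ_{i≤p, j≤q} |U^{(n)}_{ij}|². Fix s, t ∈ [0,1]. Then the real random variables T^{(n)}_{⌊ns⌋,⌊nt⌋} − E[T^{(n)}_{⌊ns⌋,⌊nt⌋}] converge in distribution, as n → ∞, to a centered Gaussian random variable with variance s(1−s)t(1−t). -/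
open MeasureTheory Matrix Filter ProbabilityTheory

namespace TruncCLT

section algebra

open scoped Matrix.Norms.L2Operator

variable {n : ℕ}

abbrev Mat (n : ℕ) := Matrix (Fin n) (Fin n) ℂ
abbrev Ug (n : ℕ) := Matrix.unitaryGroup (Fin n) ℂ

instance matBorel : BorelSpace (Mat n) :=
  inferInstanceAs (BorelSpace (Fin n → Fin n → ℂ))

instance matSecond : SecondCountableTopology (Mat n) :=
  inferInstanceAs (SecondCountableTopology (Fin n → Fin n → ℂ))

instance ugBorel : BorelSpace (Ug n) := Subtype.borelSpace _

instance ugSecond : SecondCountableTopology (Ug n) :=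
  inferInstanceAs (SecondCountableTopology (Subtype _))

instance matProper : ProperSpace (Mat n) := FiniteDimensional.proper_rclike ℂ _

/-- The conjugated matrix `U Q U*`. -/
noncomputable def cj (Q : Mat n) (U : Ug n) : Mat n := (U : Mat n) * Q * star (U : Mat n)

lemma continuous_cj (Q : Mat n) : Continuous (cj Q) := by
  unfold cj; fun_prop

lemma norm_cj_le (Q : Mat n) (U : Ug n) : ‖cj Q U‖ ≤ ‖Q‖ := by
  unfold cj
  have h1 : ‖(U : Mat n) * Q * star (U : Mat n)‖ = ‖(U : Mat n) * Q‖ :=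
    CStarRing.norm_mul_mem_unitary _ (Unitary.star_mem U.2)
  have h2 : ‖(U : Mat n) * Q‖ = ‖Q‖ := CStarRing.norm_coe_unitary_mul U Q
  rw [h1, h2]

lemma bdd_cj {E : Type*} [NormedAddCommGroup E] (Q : Mat n) (h : Mat n → E) (hc : Continuous h) :
    ∃ C, ∀ U : Ug n, ‖h (cj Q U)‖ ≤ C := by
  obtain ⟨C, hC⟩ := (isCompact_closedBall (0 : Mat n) ‖Q‖).exists_bound_of_continuousOn
    hc.continuousOn
  exact ⟨C, fun U => hC _ (by simpa using norm_cj_le Q U)⟩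

lemma integrable_cj (μ : Measure (Ug n)) [IsProbabilityMeasure μ] (Q : Mat n) (h : Mat n → ℂ)
    (hc : Continuous h) : Integrable (fun U => h (cj Q U)) μ := by
  obtain ⟨C, hC⟩ := bdd_cj Q h hc
  exact Integrable.of_bound (hc.comp (continuous_cj Q)).aestronglyMeasurable C
    (Eventually.of_forall hC)

lemma exp_mem (X : Mat n) (hX : star X = -X) (r : ℝ) :
    NormedSpace.exp (r • X) ∈ Matrix.unitaryGroup (Fin n) ℂ := by
  rw [Matrix.mem_unitaryGroup_iff, NormedSpace.star_exp, star_smul, hX]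
  simp only [star_trivial, smul_neg]
  rw [← Matrix.exp_add_of_commute (r • X) (-(r • X)) (Commute.neg_right rfl)]
  simp

lemma star_exp_eq (X : Mat n) (hX : star X = -X) (r : ℝ) :
    star (NormedSpace.exp (r • X)) = NormedSpace.exp (-(r • X)) := by
  rw [NormedSpace.star_exp, star_smul, hX]; simp

lemma cj_mul (Q : Mat n) (V U : Ug n) :
    cj Q (V * U) = (V : Mat n) * cj Q U * star (V : Mat n) := by
  simp [cj, mul_assoc]

lemma sd_skew (μ : Measure (Ug n)) [IsProbabilityMeasure μ] [μ.IsHaarMeasure] (Q : Mat n)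
    (F : Mat n → ℂ) (F' : Mat n → Mat n → ℂ)
    (hF : ∀ A, ∃ L : Mat n →L[ℂ] ℂ, HasFDerivAt F L A ∧ ∀ X, L X = F' A X)
    (hF' : Continuous fun p : Mat n × Mat n => F' p.1 p.2) (X : Mat n) (hX : star X = -X) :
    ∫ U, F' (cj Q U) (X * cj Q U - cj Q U * X) ∂μ = 0 := by
  let V : ℝ → Ug n := fun r => ⟨NormedSpace.exp (r • X), exp_mem X hX r⟩
  choose L hL hLF using hF
  have hFc : Continuous F := continuous_iff_continuousAt.2 fun A => (hL A).continuousAt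
  let h : Mat n → ℂ := fun C => F' C (X * C - C * X)
  have hh : Continuous h := by
    exact hF'.comp (f := fun C : Mat n => (C, X * C - C * X)) (by fun_prop)
  obtain ⟨C, hC⟩ := bdd_cj Q h hh
  have hV0 : V 0 = 1 := by
    apply Subtype.ext; simp [V]
  have hder : ∀ (U : Ug n) (r : ℝ),
      HasDerivAt (fun r => F (cj Q (V r * U))) (h (cj Q (V r * U))) r := by
    intro U r
    have e1 : HasDerivAt (fun u : ℝ => NormedSpace.exp (u • X))
      (X * NormedSpace.exp (r • X)) r := hasDerivAt_exp_smul_const' X r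
    have e2 : HasDerivAt (fun u : ℝ => NormedSpace.exp (u • (-X)))
      (NormedSpace.exp (r • (-X)) * (-X)) r := hasDerivAt_exp_smul_const (-X) r
    have e3 := (e1.mul_const (cj Q U)).mul e2
    have key : ∀ u : ℝ, cj Q (V u * U) = NormedSpace.exp (u • X) * cj Q U *
        NormedSpace.exp (u • (-X)) := by
      intro u
      rw [cj_mul]
      simp only [V]
      rw [star_exp_eq X hX, smul_neg]
    have e4 : HasDerivAt (fun u => cj Q (V u * U))
        (X * cj Q (V r * U) - cj Q (V r * U) * X) r := by
      simp_rw [key]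
      refine e3.congr_deriv ?_
      noncomm_ring
    refine (((hL _).restrictScalars ℝ).comp_hasDerivAt r e4).congr_deriv ?_
    simp [h, hLF]
  have hcont : ∀ r, Continuous fun U => cj Q (V r * U) := fun r =>
    (continuous_cj Q).comp (continuous_const.mul continuous_id)
  have := (hasDerivAt_integral_of_dominated_loc_of_deriv_le (μ := μ) (x₀ := (0 : ℝ))
    (F := fun r U => F (cj Q (V r * U))) (F' := fun r U => h (cj Q (V r * U)))
    (s := Set.univ) (bound := fun _ => C) Filter.univ_mem
    (Eventually.of_forall fun r => (hFc.comp (hcont r)).aestronglyMeasurable)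
    (by simpa [hV0] using integrable_cj μ Q F hFc)
    ((hh.comp (hcont 0)).aestronglyMeasurable)
    (Eventually.of_forall fun U r _ => hC _)
    (integrable_const C)
    (Eventually.of_forall fun U r _ => hder U r)).2
  have hconst : ∀ r, ∫ U, F (cj Q (V r * U)) ∂μ = ∫ U, F (cj Q U) ∂μ := fun r =>
    integral_mul_left_eq_self (fun U => F (cj Q U)) (V r)
  simp only [hconst, hV0, one_mul] at this
  exact this.unique (hasDerivAt_const _ _)

lemma sd_gen (μ : Measure (Ug n)) [IsProbabilityMeasure μ] [μ.IsHaarMeasure] (Q : Mat n)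
    (F : Mat n → ℂ) (F' : Mat n → Mat n → ℂ)
    (hF : ∀ A, ∃ L : Mat n →L[ℂ] ℂ, HasFDerivAt F L A ∧ ∀ X, L X = F' A X)
    (hF' : Continuous fun p : Mat n × Mat n => F' p.1 p.2) (X : Mat n) :
    ∫ U, F' (cj Q U) (X * cj Q U - cj Q U * X) ∂μ = 0 := by
  let H : Mat n := (2⁻¹ : ℂ) • (X - star X)
  let K : Mat n := (2⁻¹ * (-Complex.I) : ℂ) • (X + star X)
  have hH : star H = -H := by
    simp only [H, star_smul, star_sub, star_star, ← smul_neg, neg_sub]; simp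
  have hK : star K = -K := by
    simp only [K, star_smul, star_add, star_star]
    rw [← neg_smul, add_comm]
    congr 1; simp
  have hXd : X = H + Complex.I • K := by
    simp only [H, K, smul_smul]
    have : Complex.I * (2⁻¹ * -Complex.I) = (2⁻¹ : ℂ) := by
      linear_combination (-2⁻¹ : ℂ) * Complex.I_mul_I
    rw [this, ← smul_add, sub_add_add_cancel, ← two_smul ℂ X, smul_smul]; simp
  have h1 := sd_skew μ Q F F' hF hF' H hH
  have h2 := sd_skew μ Q F F' hF hF' K hK
  have hsplit : ∀ U : Ug n, F' (cj Q U) (X * cj Q U - cj Q U * X) =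
      F' (cj Q U) (H * cj Q U - cj Q U * H) +
      Complex.I * F' (cj Q U) (K * cj Q U - cj Q U * K) := by
    intro U
    obtain ⟨L, -, hL⟩ := hF (cj Q U)
    rw [← hL, ← hL, ← hL, ← smul_eq_mul (a := Complex.I), ← map_smul, ← map_add]
    congr 1
    conv_lhs => rw [hXd]
    simp only [add_mul, mul_add, smul_mul_assoc, mul_smul_comm, smul_sub]
    abel
  simp_rw [hsplit]
  rw [integral_add (integrable_cj μ Q (fun A => F' A (H * A - A * H))
      (hF'.comp (f := fun C : Mat n => (C, H * C - C * H)) (by fun_prop)))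
    ((integrable_cj μ Q (fun A => F' A (K * A - A * K))
      (hF'.comp (f := fun C : Mat n => (C, K * C - C * K)) (by fun_prop))).const_mul _),
    integral_const_mul, h1, h2]
  simp

/-- Entry functional. -/
noncomputable def ent (i j : Fin n) : Mat n →L[ℂ] ℂ :=
  LinearMap.toContinuousLinearMap (Matrix.entryLinearMap ℂ ℂ i j)

lemma ent_apply (i j : Fin n) (A : Mat n) : ent i j A = A i j := rfl

/-- Trace functional. -/
noncomputable def trL : Mat n →L[ℂ] ℂ :=
  LinearMap.toContinuousLinearMap (Matrix.traceLinearMap (Fin n) ℂ ℂ)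

lemma trL_apply (A : Mat n) : trL A = A.trace := rfl

lemma sum_single_eq (B : Mat n) : ∑ i, ∑ j, B i j • Matrix.single i j (1 : ℂ) = B := by
  conv_rhs => rw [Matrix.matrix_eq_sum_single B]
  simp [Matrix.smul_single]

lemma sd_word (μ : Measure (Ug n)) [IsProbabilityMeasure μ] [μ.IsHaarMeasure] (Q : Mat n)
    (g : Mat n → ℂ) (g' : Mat n → Mat n → ℂ)
    (hg : ∀ A, ∃ L : Mat n →L[ℂ] ℂ, HasFDerivAt g L A ∧ ∀ X, L X = g' A X)
    (hg' : Continuous fun p : Mat n × Mat n => g' p.1 p.2)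
    (W : Mat n → Mat n) (W' : Mat n → Mat n → Mat n)
    (hW : ∀ A, ∃ L : Mat n →L[ℂ] Mat n, HasFDerivAt W L A ∧ ∀ X, L X = W' A X)
    (hW' : Continuous fun p : Mat n × Mat n => W' p.1 p.2) :
    ∫ U, (g' (cj Q U) (W (cj Q U) * cj Q U - cj Q U * W (cj Q U)) +
      g (cj Q U) * ∑ i, ∑ j, W' (cj Q U)
        (Matrix.single i j 1 * cj Q U - cj Q U * Matrix.single i j 1) i j) ∂μ = 0 := by
  have hgc : Continuous g := continuous_iff_continuousAt.2 fun A =>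
    (hg A).choose_spec.1.continuousAt
  have hWc : Continuous W := continuous_iff_continuousAt.2 fun A =>
    (hW A).choose_spec.1.continuousAt
  let F' : Fin n → Fin n → Mat n → Mat n → ℂ := fun i j A X =>
    W A i j * g' A X + g A * W' A X i j
  have hF'c : ∀ i j, Continuous fun p : Mat n × Mat n => F' i j p.1 p.2 := by
    intro i j
    have h1 : Continuous fun p : Mat n × Mat n => W p.1 i j :=
      (ent i j).continuous.comp (hWc.comp continuous_fst)
    have h2 : Continuous fun p : Mat n × Mat n => W' p.1 p.2 i j :=
      (ent i j).continuous.comp hW'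
    exact (h1.mul hg').add ((hgc.comp continuous_fst).mul h2)
  have key : ∀ i j, ∫ U, F' i j (cj Q U)
      (Matrix.single i j 1 * cj Q U - cj Q U * Matrix.single i j 1) ∂μ = 0 := by
    intro i j
    refine sd_gen μ Q (fun A => g A * ent i j (W A)) (F' i j) ?_ (hF'c i j) _
    intro A
    obtain ⟨L, hL, hL'⟩ := hg A
    obtain ⟨K, hK, hK'⟩ := hW A
    refine ⟨_, hL.mul ((ent i j).hasFDerivAt.comp A hK), ?_⟩
    intro X
    simp [F', hL', hK', ent_apply]
    ring
  have hIntegr : ∀ i j, Integrable (fun U => F' i j (cj Q U)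
      (Matrix.single i j 1 * cj Q U - cj Q U * Matrix.single i j 1)) μ := fun i j =>
    integrable_cj μ Q (fun A => F' i j A (Matrix.single i j 1 * A - A * Matrix.single i j 1))
      ((hF'c i j).comp (f := fun C : Mat n =>
        (C, Matrix.single i j 1 * C - C * Matrix.single i j 1)) (by fun_prop))
  have : ∫ U, ∑ i, ∑ j, F' i j (cj Q U)
      (Matrix.single i j 1 * cj Q U - cj Q U * Matrix.single i j 1) ∂μ = 0 := by
    rw [integral_finsetSum _ fun i _ => integrable_finsetSum _ fun j _ => hIntegr i j]
    refine Finset.sum_eq_zero fun i _ => ?_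
    rw [integral_finsetSum _ fun j _ => hIntegr i j]
    exact Finset.sum_eq_zero fun j _ => key i j
  rw [← this]
  congr 1
  ext U
  simp only [F', Finset.sum_add_distrib, Finset.mul_sum]
  congr 1
  obtain ⟨L, -, hL⟩ := hg (cj Q U)
  simp only [← hL]
  set A := cj Q U
  conv_lhs => rw [← sum_single_eq (W A)]
  simp only [Finset.sum_mul, Finset.mul_sum, ← Finset.sum_sub_distrib, map_sum,
    smul_mul_assoc, mul_smul_comm, ← smul_sub, map_smul, smul_eq_mul]

lemma sum_single_left (B C : Mat n) :
    ∑ i, ∑ j, (C * Matrix.single i j (1 : ℂ) * B : Mat n) i j = C.trace * B.trace := by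
  have : ∀ i j, (C * Matrix.single i j (1 : ℂ) * B : Mat n) i j = C i i * B j j := by
    intro i j
    rw [Matrix.mul_apply]
    simp [Matrix.mul_apply, Matrix.single_apply, ite_and]
  simp [this, Matrix.trace, Finset.sum_mul_sum]

lemma hasW1 (P A : Mat n) : ∃ L : Mat n →L[ℂ] Mat n, HasFDerivAt (fun A => A * P) L A ∧
    ∀ X, L X = X * P :=
  ⟨(ContinuousLinearMap.mul ℂ (Mat n)).flip P,
    ((ContinuousLinearMap.mul ℂ (Mat n)).flip P).hasFDerivAt, fun X => by simp⟩

lemma hasW2 (P A : Mat n) : ∃ L : Mat n →L[ℂ] Mat n,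
    HasFDerivAt (fun A => A * P * (A * P)) L A ∧
    ∀ X, L X = X * P * (A * P) + A * P * (X * P) := by
  obtain ⟨L, hL, h⟩ := hasW1 P A
  refine ⟨_, hL.mul' hL, fun X => ?_⟩
  simp [h]
  rw [add_comm]

lemma hasTr1 (P A : Mat n) : ∃ L : Mat n →L[ℂ] ℂ,
    HasFDerivAt (fun A => (A * P).trace) L A ∧ ∀ X, L X = (X * P).trace := by
  obtain ⟨L, hL, h⟩ := hasW1 P A
  exact ⟨_, trL.hasFDerivAt.comp A hL, fun X => by simp [h, trL_apply]⟩

lemma hasTr2 (P A : Mat n) : ∃ L : Mat n →L[ℂ] ℂ,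
    HasFDerivAt (fun A => (A * P * (A * P)).trace) L A ∧
      ∀ X, L X = 2 * (X * P * (A * P)).trace := by
  obtain ⟨L, hL, h⟩ := hasW2 P A
  refine ⟨_, trL.hasFDerivAt.comp A hL, fun X => ?_⟩
  simp [h, trL_apply]
  rw [Matrix.trace_mul_comm (A * P) (X * P)]
  ring

lemma sd1 (μ : Measure (Ug n)) [IsProbabilityMeasure μ] [μ.IsHaarMeasure] (P Q : Mat n)
    (f f' : ℂ → ℂ) (hf : ∀ z, HasDerivAt f (f' z) z) (hf' : Continuous f') :
    ∫ U, (f' (cj Q U * P).trace *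
        ((cj Q U * P * cj Q U - cj Q U * (cj Q U * P)) * P).trace +
      f (cj Q U * P).trace * (n * (cj Q U * P).trace - (cj Q U).trace * P.trace)) ∂μ = 0 := by
  have := sd_word μ Q (fun A => f (A * P).trace) (fun A X => f' (A * P).trace * (X * P).trace)
    (fun A => by
      obtain ⟨L, hL, h⟩ := hasTr1 P A
      exact ⟨_, (hf _).comp_hasFDerivAt A hL, fun X => by simp [h]⟩)
    (by fun_prop) (fun A => A * P) (fun A X => X * P) (fun A => hasW1 P A) (by fun_prop)
  rw [← this]
  congr 1
  ext U
  congr 2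
  have h1 := sum_single_left (cj Q U * P) 1
  have h2 := sum_single_left P (cj Q U)
  simp only [one_mul, Matrix.trace_one, Fintype.card_fin] at h1
  simp only [sub_mul, Matrix.sub_apply, Finset.sum_sub_distrib]
  rw [h2, ← h1]
  simp only [mul_assoc]

lemma sd2 (μ : Measure (Ug n)) [IsProbabilityMeasure μ] [μ.IsHaarMeasure] (P Q : Mat n)
    (g : Mat n → ℂ) (g' : Mat n → Mat n → ℂ)
    (hg : ∀ A, ∃ L : Mat n →L[ℂ] ℂ, HasFDerivAt g L A ∧ ∀ X, L X = g' A X)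
    (hg' : Continuous fun p : Mat n × Mat n => g' p.1 p.2) :
    ∫ U, (g' (cj Q U) (cj Q U * P * (cj Q U * P) * cj Q U - cj Q U * (cj Q U * P * (cj Q U * P)))
      + g (cj Q U) * (n * (cj Q U * P * (cj Q U * P)).trace -
          (cj Q U).trace * (P * (cj Q U * P)).trace +
          ((cj Q U * P).trace * (cj Q U * P).trace -
            (cj Q U * P * cj Q U).trace * P.trace))) ∂μ = 0 := by
  have := sd_word μ Q g g' hg hg' (fun A => A * P * (A * P))
    (fun A X => X * P * (A * P) + A * P * (X * P)) (fun A => hasW2 P A) (by fun_prop)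
  rw [← this]
  congr 1
  ext U
  congr 2
  have h1 := sum_single_left (cj Q U * P * (cj Q U * P)) 1
  have h2 := sum_single_left (P * (cj Q U * P)) (cj Q U)
  have h3 := sum_single_left (cj Q U * P) (cj Q U * P)
  have h4 := sum_single_left P (cj Q U * P * cj Q U)
  simp only [one_mul, Matrix.trace_one, Fintype.card_fin] at h1
  simp only [sub_mul, mul_sub, Matrix.sub_apply, Matrix.add_apply, Finset.sum_sub_distrib,
    Finset.sum_add_distrib]
  rw [← h2, ← h1, ← h3, ← h4]
  simp only [mul_assoc]

/-- Coordinate projection on the first `p` coordinates. -/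
noncomputable def Pm (n p : ℕ) : Mat n := Matrix.diagonal fun i => if (i : ℕ) < p then 1 else 0

lemma Pm_mul (p : ℕ) : Pm n p * Pm n p = Pm n p := by
  simp [Pm, Matrix.diagonal_mul_diagonal]

lemma Pm_star (p : ℕ) : star (Pm n p) = Pm n p := by
  rw [Matrix.star_eq_conjTranspose, Pm, Matrix.diagonal_conjTranspose]
  congr 1
  ext i
  simp only [Pi.star_apply]
  split_ifs <;> simp

lemma Pm_trace (p : ℕ) (hp : p ≤ n) : (Pm n p).trace = p := by
  simp only [Pm, Matrix.trace_diagonal]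
  rw [Finset.sum_boole]
  congr 1
  rw [Fin.card_filter_val_lt]
  exact min_eq_right hp

lemma Pm_norm (p : ℕ) : ‖Pm n p‖ ≤ 1 := by
  rw [Pm, Matrix.l2_opNorm_diagonal, pi_norm_le_iff_of_nonneg zero_le_one]
  intro i
  split_ifs <;> simp

lemma trace_le (M : Mat n) : ‖M.trace‖ ≤ n * ‖M‖ := by
  have h : ∀ i, ‖M i i‖ ≤ ‖M‖ := by
    intro i
    have h1 := (Matrix.toEuclideanCLM (n := Fin n) (𝕜 := ℂ) M).le_opNorm
      (WithLp.toLp 2 (Pi.single i (1 : ℂ)))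
    rw [Matrix.toEuclideanCLM_toLp, Matrix.l2_opNorm_toEuclideanCLM] at h1
    have h2 := PiLp.norm_apply_le (WithLp.toLp 2 (M *ᵥ Pi.single i (1 : ℂ))) i
    simp at h1 h2
    exact h2.trans h1
  calc ‖M.trace‖ ≤ ∑ i, ‖M i i‖ := norm_sum_le _ _
    _ ≤ ∑ _i : Fin n, ‖M‖ := Finset.sum_le_sum fun i _ => h i
    _ = n * ‖M‖ := by simp

lemma trace_le_of (M : Mat n) {c : ℝ} (h : ‖M‖ ≤ c) : ‖M.trace‖ ≤ n * c :=
  (trace_le M).trans (by gcongr)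

lemma nmul {A B : Mat n} (hA : ‖A‖ ≤ 1) (hB : ‖B‖ ≤ 1) : ‖A * B‖ ≤ 1 :=
  (norm_mul_le _ _).trans (mul_le_one₀ hA (norm_nonneg _) hB)

lemma cj_norm (q : ℕ) (U : Ug n) : ‖cj (Pm n q) U‖ ≤ 1 := (norm_cj_le _ _).trans (Pm_norm q)

lemma cj_idem (q : ℕ) (U : Ug n) : cj (Pm n q) U * cj (Pm n q) U = cj (Pm n q) U := by
  have hU : star (U : Mat n) * (U : Mat n) = 1 := Unitary.coe_star_mul_self U
  unfold cj
  calc _ = (U : Mat n) * Pm n q * (star (U : Mat n) * (U : Mat n)) * Pm n q * star (U : Mat n) := by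
        simp only [mul_assoc]
    _ = _ := by rw [hU, mul_one, mul_assoc (U : Mat n), Pm_mul]

lemma cj_star (q : ℕ) (U : Ug n) : star (cj (Pm n q) U) = cj (Pm n q) U := by
  simp only [cj, star_mul, star_star, Pm_star, mul_assoc]

lemma cj_trace (q : ℕ) (hq : q ≤ n) (U : Ug n) : (cj (Pm n q) U).trace = q := by
  have hU : star (U : Mat n) * (U : Mat n) = 1 := Unitary.coe_star_mul_self U
  rw [cj, Matrix.trace_mul_comm, ← mul_assoc, hU, one_mul, Pm_trace q hq]

lemma trace_T (p q : ℕ) (U : Ug n) :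
    (cj (Pm n q) U * Pm n p).trace = (truncTraceU n p q U : ℂ) := by
  simp only [cj, Pm, truncTraceU, Matrix.trace, Matrix.diag_apply, Matrix.mul_diagonal]
  push_cast
  refine Finset.sum_congr rfl fun i _ => ?_
  rw [Matrix.mul_apply, Finset.sum_mul]
  refine Finset.sum_congr rfl fun j _ => ?_
  rw [Matrix.mul_diagonal, Matrix.star_apply]
  by_cases h1 : (i : ℕ) < p <;> by_cases h2 : (j : ℕ) < q <;> simp [h1, h2]
  rw [Complex.mul_conj, Complex.normSq_eq_norm_sq]
  push_cast; rfl

/-- The second order trace `tr (A P A P)`. -/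
noncomputable def ST (n p q : ℕ) (U : Ug n) : ℝ :=
  (cj (Pm n q) U * Pm n p * (cj (Pm n q) U * Pm n p)).trace.re

lemma trace_S (p q : ℕ) (U : Ug n) :
    (cj (Pm n q) U * Pm n p * (cj (Pm n q) U * Pm n p)).trace = (ST n p q U : ℂ) := by
  set A := cj (Pm n q) U with hA
  have h : star (A * Pm n p * (A * Pm n p)).trace = (A * Pm n p * (A * Pm n p)).trace := by
    rw [← Matrix.trace_conjTranspose, ← Matrix.star_eq_conjTranspose]
    simp only [star_mul, Pm_star, hA, cj_star]
    simp only [mul_assoc]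
    rw [Matrix.trace_mul_comm]
    simp only [mul_assoc]
  exact (Complex.conj_eq_iff_re.1 h).symm

lemma continuous_T (p q : ℕ) : Continuous (truncTraceU n p q) := by
  have : truncTraceU n p q = fun U => ((cj (Pm n q) U * Pm n p).trace).re := by
    ext U; rw [trace_T]; simp
  rw [this]
  have h := continuous_cj (Pm n q)
  exact Complex.continuous_re.comp ((h.mul continuous_const).matrix_trace)

lemma continuous_S (p q : ℕ) : Continuous (ST n p q) := by
  have h := continuous_cj (Pm n q)
  exact Complex.continuous_re.comp
    (((h.mul continuous_const).mul (h.mul continuous_const)).matrix_trace)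

lemma abs_T_le (p q : ℕ) (U : Ug n) : |truncTraceU n p q U| ≤ n := by
  have := trace_le_of _ (nmul (cj_norm q U) (Pm_norm p))
  rw [trace_T] at this
  simpa using this

lemma abs_S_le (p q : ℕ) (U : Ug n) : |ST n p q U| ≤ n := by
  have := trace_le_of _ (nmul (nmul (cj_norm q U) (Pm_norm p)) (nmul (cj_norm q U) (Pm_norm p)))
  rw [trace_S] at this
  simpa using this

lemma main1 (μ : Measure (Ug n)) [IsProbabilityMeasure μ] [μ.IsHaarMeasure] (p q : ℕ)
    (hp : p ≤ n) (hq : q ≤ n)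
    (f f' : ℂ → ℂ) (hf : ∀ z, HasDerivAt f (f' z) z) (hf' : Continuous f') :
    ∫ U, (f (truncTraceU n p q U) * (n * truncTraceU n p q U - p * q) -
      f' (truncTraceU n p q U) * (truncTraceU n p q U - ST n p q U)) ∂μ = 0 := by
  rw [← sd1 μ (Pm n p) (Pm n q) f f' hf hf']
  congr 1
  ext U
  have h : ((cj (Pm n q) U * Pm n p * cj (Pm n q) U -
      cj (Pm n q) U * (cj (Pm n q) U * Pm n p)) * Pm n p).trace
      = ST n p q U - truncTraceU n p q U := by
    have e1 : cj (Pm n q) U * (cj (Pm n q) U * Pm n p) * Pm n p = cj (Pm n q) U * Pm n p := by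
      rw [← mul_assoc, cj_idem, mul_assoc, Pm_mul]
    rw [← trace_S, ← trace_T, sub_mul, Matrix.trace_sub, e1, ← mul_assoc]
  rw [h, trace_T, cj_trace q hq, Pm_trace p hp]
  ring

/-- The remainder. -/
noncomputable def RT (n p q : ℕ) (U : Ug n) : ℝ :=
  n * ST n p q U - (p + q) * truncTraceU n p q U + truncTraceU n p q U ^ 2

lemma main2 (μ : Measure (Ug n)) [IsProbabilityMeasure μ] [μ.IsHaarMeasure] (p q : ℕ)
    (hp : p ≤ n) (hq : q ≤ n) :
    ∫ U, RT n p q U ^ 2 ∂μ ≤ 12 * n ^ 2 := by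
  set P := Pm n p with hP
  let g : Mat n → ℂ := fun A =>
    n * (A * P * (A * P)).trace - (p + q) * (A * P).trace + (A * P).trace ^ 2
  let g' : Mat n → Mat n → ℂ := fun A X =>
    n * (2 * (X * P * (A * P)).trace) - (p + q) * (X * P).trace +
      2 * (A * P).trace * (X * P).trace
  have hsd := sd2 μ P (Pm n q) g g' (fun A => by
      obtain ⟨L, hL, h⟩ := hasTr1 P A
      obtain ⟨K, hK, h'⟩ := hasTr2 P A
      refine ⟨_, ((hK.const_mul (n : ℂ)).sub (hL.const_mul ((p : ℂ) + q))).add (hL.pow 2), ?_⟩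
      intro X
      simp [h, h', g']) (by fun_prop)
  have hg : ∀ U, g (cj (Pm n q) U) = RT n p q U := by
    intro U
    simp only [g, RT, hP, trace_T, trace_S]
    push_cast; ring
  let D : Ug n → ℂ := fun U => g' (cj (Pm n q) U) (cj (Pm n q) U * P * (cj (Pm n q) U * P) *
    cj (Pm n q) U - cj (Pm n q) U * (cj (Pm n q) U * P * (cj (Pm n q) U * P)))
  have hD : ∀ U, ‖D U‖ ≤ 12 * n ^ 2 := by
    intro U
    simp only [D, g']
    set A := cj (Pm n q) U with hA
    set X := A * P * (A * P) * A - A * (A * P * (A * P)) with hX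
    have a1 : ‖A‖ ≤ 1 := cj_norm q U
    have p1 : ‖P‖ ≤ 1 := Pm_norm p
    have ap := nmul a1 p1
    have x1 : ‖X‖ ≤ 2 := by
      refine (norm_sub_le _ _).trans ?_
      have := nmul (nmul ap ap) a1
      have := nmul a1 (nmul ap ap)
      linarith
    have xp : ‖X * P‖ ≤ 2 := (norm_mul_le _ _).trans (by nlinarith [norm_nonneg X, norm_nonneg P])
    have xpap : ‖X * P * (A * P)‖ ≤ 2 :=
      (norm_mul_le _ _).trans (by nlinarith [norm_nonneg (X * P), norm_nonneg (A * P)])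
    have t1 := trace_le_of _ xp
    have t2 := trace_le_of _ xpap
    have t3 := trace_le_of _ ap
    have hn : (0 : ℝ) ≤ n := by positivity
    have hp' : (p : ℝ) ≤ n := by exact_mod_cast hp
    have hq' : (q : ℝ) ≤ n := by exact_mod_cast hq
    have hpq : ‖((p : ℂ) + q)‖ ≤ 2 * n := by
      refine (norm_add_le _ _).trans ?_
      simp; linarith
    calc _ ≤ ‖(n : ℂ) * (2 * (X * P * (A * P)).trace)‖ + ‖((p : ℂ) + q) * (X * P).trace‖
          + ‖2 * (A * P).trace * (X * P).trace‖ :=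
          (norm_add_le _ _).trans (by gcongr; exact norm_sub_le _ _)
      _ ≤ n * (2 * (n * 2)) + (2 * n) * (n * 2) + 2 * (n * 1) * (n * 2) := by
          simp only [norm_mul, Complex.norm_natCast, Complex.norm_ofNat]
          gcongr
      _ = _ := by ring
  have hsd' : ∫ U, (D U + ((RT n p q U ^ 2 : ℝ) : ℂ)) ∂μ = 0 := by
    rw [← hsd]
    congr 1
    ext U
    simp only [D, hg]
    congr 1
    have e1 : (P * (cj (Pm n q) U * P)).trace = (cj (Pm n q) U * P).trace := by
      rw [Matrix.trace_mul_comm, mul_assoc, hP, Pm_mul]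
    have e2 : (cj (Pm n q) U * P * cj (Pm n q) U).trace = (cj (Pm n q) U * P).trace := by
      rw [Matrix.trace_mul_comm, ← mul_assoc, cj_idem]
    rw [e1, e2, hP, trace_T, trace_S, cj_trace q hq, Pm_trace p hp]
    simp only [RT]
    push_cast; ring
  have hRc : Continuous (RT n p q) := by
    have h1 := continuous_T (n := n) p q
    have h2 := continuous_S (n := n) p q
    unfold RT; fun_prop
  have hDc : Continuous D := by
    have h := continuous_cj (Pm n q)
    simp only [D, g']; fun_prop
  have hDi : Integrable D μ := Integrable.of_bound hDc.aestronglyMeasurable _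
    (Eventually.of_forall hD)
  have hRi : Integrable (fun U => ((RT n p q U ^ 2 : ℝ) : ℂ)) μ := by
    have : Integrable (fun U => g (cj (Pm n q) U) ^ 2) μ :=
      integrable_cj μ (Pm n q) (fun A => g A ^ 2) (by fun_prop)
    simpa [hg] using this
  rw [integral_add hDi hRi, integral_complex_ofReal] at hsd'
  have h1 : ((∫ U, RT n p q U ^ 2 ∂μ : ℝ) : ℂ) = - ∫ U, D U ∂μ := by
    linear_combination hsd'
  have h2 : ‖∫ U, D U ∂μ‖ ≤ 12 * n ^ 2 := by
    have := norm_integral_le_of_norm_le_const (μ := μ) (Eventually.of_forall hD)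
    simpa using this
  have h3 : ‖((∫ U, RT n p q U ^ 2 ∂μ : ℝ) : ℂ)‖ ≤ 12 * n ^ 2 := by rw [h1, norm_neg]; exact h2
  rw [Complex.norm_real] at h3
  exact (le_abs_self _).trans h3

end algebra

section analysis

lemma charfun_ode {Ω : Type*} [MeasurableSpace Ω] (μ : Measure Ω) [IsProbabilityMeasure μ]
    (X Y : Ω → ℝ) (hX : Measurable X) (hY : Measurable Y) (C D : ℝ) (hXC : ∀ ω, |X ω| ≤ C)
    (hYD : ∀ ω, |Y ω| ≤ D)
    (h : ∀ θ : ℝ, ∫ ω, (X ω : ℂ) * Complex.exp (Complex.I * θ * X ω) ∂μ =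
      Complex.I * θ * ∫ ω, (Y ω : ℂ) * Complex.exp (Complex.I * θ * X ω) ∂μ)
    (v δ : ℝ) (hv : 0 ≤ v) (hδ : ∫ ω, |Y ω - v| ∂μ ≤ δ) (θ : ℝ) :
    ‖∫ ω, Complex.exp (Complex.I * θ * X ω) ∂μ - Complex.exp (-(v * θ ^ 2 / 2))‖ ≤ δ * θ ^ 2 := by
  have hδ0 : 0 ≤ δ := le_trans (integral_nonneg fun _ => abs_nonneg _) hδ
  have hexp : ∀ (u : ℝ) ω, ‖Complex.exp (Complex.I * u * X ω)‖ = 1 := by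
    intro u ω
    have : Complex.I * u * X ω = ((u * X ω : ℝ) : ℂ) * Complex.I := by push_cast; ring
    rw [this, Complex.norm_exp_ofReal_mul_I]
  have hXm : Measurable fun ω => (X ω : ℂ) := Complex.measurable_ofReal.comp hX
  have hYm : Measurable fun ω => (Y ω : ℂ) := Complex.measurable_ofReal.comp hY
  have hem : ∀ u : ℝ, Measurable fun ω => Complex.exp (Complex.I * u * X ω) := fun u =>
    Complex.measurable_exp.comp (hXm.const_mul _)
  have hei : ∀ u : ℝ, Integrable (fun ω => Complex.exp (Complex.I * u * X ω)) μ := fun u =>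
    Integrable.of_bound (hem u).aestronglyMeasurable 1 (Eventually.of_forall fun ω => (hexp u ω).le)
  have hYi : ∀ u : ℝ, Integrable (fun ω => (Y ω : ℂ) * Complex.exp (Complex.I * u * X ω)) μ :=
    fun u => Integrable.of_bound (hYm.mul (hem u)).aestronglyMeasurable D
      (Eventually.of_forall fun ω => by
        rw [norm_mul, hexp, mul_one, Complex.norm_real]; exact hYD ω)
  let φ : ℝ → ℂ := fun u => ∫ ω, Complex.exp (Complex.I * u * X ω) ∂μ
  have hφ : ∀ u : ℝ, HasDerivAt φ
      (Complex.I * ∫ ω, (X ω : ℂ) * Complex.exp (Complex.I * u * X ω) ∂μ) u := by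
    intro u
    have := (hasDerivAt_integral_of_dominated_loc_of_deriv_le (μ := μ) (x₀ := u)
      (F := fun (u : ℝ) ω => Complex.exp (Complex.I * u * X ω))
      (F' := fun (u : ℝ) ω => Complex.I * ((X ω : ℂ) * Complex.exp (Complex.I * u * X ω)))
      (s := Set.univ) (bound := fun _ => C) Filter.univ_mem
      (Eventually.of_forall fun r => (hem r).aestronglyMeasurable)
      (hei u) ((hXm.mul (hem u)).const_mul _).aestronglyMeasurable
      (Eventually.of_forall fun ω r _ => by
        rw [norm_mul, norm_mul, hexp, mul_one, Complex.norm_real, Complex.norm_I, one_mul]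
        exact hXC ω)
      (integrable_const C)
      (Eventually.of_forall fun ω r _ => by
        have h1 : HasDerivAt (fun u : ℝ => Complex.I * (u : ℂ) * X ω) (Complex.I * X ω) r := by
          simpa using ((Complex.ofRealCLM.hasDerivAt (x := r)).const_mul Complex.I).mul_const
            (X ω : ℂ)
        refine h1.cexp.congr_deriv ?_
        ring)).2
    rwa [integral_const_mul] at this
  let ψ : ℝ → ℂ := fun u => φ u * Complex.exp (v * u ^ 2 / 2)
  have hψ : ∀ u : ℝ, HasDerivAt ψ (-u * (∫ ω, ((Y ω : ℂ) - v) * Complex.exp (Complex.I * u * X ω) ∂μ) *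
      Complex.exp (v * u ^ 2 / 2)) u := by
    intro u
    have h1 : HasDerivAt (fun u : ℝ => (v : ℂ) * (u : ℂ) ^ 2 / 2) ((v : ℂ) * (u : ℂ)) u := by
      have := (((Complex.ofRealCLM.hasDerivAt (x := u)).pow 2).const_mul (v : ℂ)).div_const 2
      refine HasDerivAt.congr_deriv this ?_
      simp; ring
    refine ((hφ u).mul h1.cexp).congr_deriv ?_
    have h2 : ∫ ω, ((Y ω : ℂ) - v) * Complex.exp (Complex.I * u * X ω) ∂μ =
        ∫ ω, (Y ω : ℂ) * Complex.exp (Complex.I * u * X ω) ∂μ - v * φ u := by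
      simp_rw [sub_mul]
      rw [integral_sub (hYi u) ((hei u).const_mul _), integral_const_mul]
    rw [h2, h u]
    linear_combination (∫ ω, (Y ω : ℂ) * Complex.exp (Complex.I * u * X ω) ∂μ) * u *
      Complex.exp (v * u ^ 2 / 2) * Complex.I_mul_I
  have hexpv : ∀ u : ℝ, ‖Complex.exp (v * u ^ 2 / 2)‖ = Real.exp (v * u ^ 2 / 2) := by
    intro u
    rw [Complex.norm_exp]; norm_cast
  have hbound : ∀ u ∈ Set.Icc (-|θ|) |θ|, ‖-u * (∫ ω, ((Y ω : ℂ) - v) *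
      Complex.exp (Complex.I * u * X ω) ∂μ) * Complex.exp (v * u ^ 2 / 2)‖ ≤
      |θ| * δ * Real.exp (v * θ ^ 2 / 2) := by
    intro u hu
    have hu' : |u| ≤ |θ| := abs_le.2 hu
    rw [norm_mul, norm_mul, hexpv, norm_neg, Complex.norm_real, Real.norm_eq_abs]
    have h3 : ‖∫ ω, ((Y ω : ℂ) - v) * Complex.exp (Complex.I * u * X ω) ∂μ‖ ≤ δ := by
      refine (norm_integral_le_integral_norm _).trans (le_trans (le_of_eq ?_) hδ)
      congr 1
      ext ω
      rw [norm_mul, hexp, mul_one, ← Complex.ofReal_sub, Complex.norm_real, Real.norm_eq_abs]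
    have h4 : u ^ 2 ≤ θ ^ 2 := sq_le_sq.2 hu'
    gcongr
  have hmvt := (convex_Icc (-|θ|) |θ|).norm_image_sub_le_of_norm_hasDerivWithin_le
    (f := ψ) (fun u _ => (hψ u).hasDerivWithinAt) hbound
    (x := 0) (y := θ) (by simp) ⟨neg_abs_le θ, le_abs_self θ⟩
  have hψ0 : ψ 0 = 1 := by simp [ψ, φ]
  have hfin : φ θ - Complex.exp (-(v * θ ^ 2 / 2)) =
      (ψ θ - ψ 0) * Complex.exp (-(v * θ ^ 2 / 2)) := by
    rw [hψ0]
    simp only [ψ]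
    rw [sub_mul, mul_assoc, ← Complex.exp_add]
    simp
  change ‖φ θ - _‖ ≤ _
  rw [hfin, norm_mul]
  have hE : ‖Complex.exp (-(v * θ ^ 2 / 2))‖ = Real.exp (-(v * θ ^ 2 / 2)) := by
    rw [Complex.norm_exp]; norm_cast
  rw [hE]
  calc _ ≤ |θ| * δ * Real.exp (v * θ ^ 2 / 2) * ‖θ - 0‖ * Real.exp (-(v * θ ^ 2 / 2)) := by gcongr
    _ = δ * (|θ| * |θ|) * (Real.exp (v * θ ^ 2 / 2) * Real.exp (-(v * θ ^ 2 / 2))) := by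
        rw [sub_zero, Real.norm_eq_abs]; ring
    _ = δ * θ ^ 2 := by rw [← Real.exp_add, abs_mul_abs_self, add_neg_cancel, Real.exp_zero]; ring

variable {n : ℕ}

lemma intT (μ : Measure (Ug n)) [IsProbabilityMeasure μ] (p q : ℕ) (F : ℝ → ℝ → ℝ)
    (hF : Continuous fun x : ℝ × ℝ => F x.1 x.2) :
    Integrable (fun U => F (truncTraceU n p q U) (ST n p q U)) μ := by
  have hc : Continuous fun U : Ug n => (truncTraceU n p q U, ST n p q U) :=
    (continuous_T p q).prodMk (continuous_S p q)
  obtain ⟨C, hC⟩ := ((isCompact_Icc (a := -(n : ℝ)) (b := n)).prod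
    (isCompact_Icc (a := -(n : ℝ)) (b := n))).exists_bound_of_continuousOn hF.continuousOn
  exact Integrable.of_bound (hF.comp hc).aestronglyMeasurable C
    (Eventually.of_forall fun U => hC (truncTraceU n p q U, ST n p q U)
      ⟨abs_le.1 (abs_T_le p q U), abs_le.1 (abs_S_le p q U)⟩)

lemma mean_T (μ : Measure (Ug n)) [IsProbabilityMeasure μ] [μ.IsHaarMeasure] (p q : ℕ)
    (hp : p ≤ n) (hq : q ≤ n) (hn : 0 < n) :
    ∫ U, truncTraceU n p q U ∂μ = p * q / n := by
  have h := main1 μ p q hp hq (fun _ => 1) (fun _ => 0) (fun z => hasDerivAt_const _ _)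
    continuous_const
  have h' : ∫ U, (((n * truncTraceU n p q U - p * q : ℝ)) : ℂ) ∂μ = 0 := by
    rw [← h]; congr 1; ext U; push_cast; ring
  rw [integral_complex_ofReal] at h'
  have h2 : ∫ U, (n * truncTraceU n p q U - p * q : ℝ) ∂μ = 0 := by exact_mod_cast h'
  have hi : Integrable (fun U => truncTraceU n p q U) μ := intT μ p q (fun x _ => x) (by fun_prop)
  rw [integral_sub (hi.const_mul _) (integrable_const _), integral_const_mul, integral_const] at h2
  have : (n : ℝ) ≠ 0 := by positivity
  simp at h2
  field_simp
  linarith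

lemma var_T (μ : Measure (Ug n)) [IsProbabilityMeasure μ] [μ.IsHaarMeasure] (p q : ℕ)
    (hp : p ≤ n) (hq : q ≤ n) (hn : 0 < n) :
    ∫ U, (truncTraceU n p q U - p * q / n) ^ 2 ∂μ ≤ 2 := by
  have hn0 : (n : ℝ) ≠ 0 := by positivity
  have hn1 : (0 : ℝ) < n := by positivity
  have h := main1 μ p q hp hq (fun z => z - ((p * q / n : ℝ) : ℂ)) (fun _ => 1)
    (fun z => (hasDerivAt_id z).sub_const _) continuous_const
  have h' : ∫ U, (((n * (truncTraceU n p q U - p * q / n) ^ 2 -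
      (truncTraceU n p q U - ST n p q U) : ℝ)) : ℂ) ∂μ = 0 := by
    rw [← h]; congr 1; ext U
    have : (n : ℂ) ≠ 0 := by exact_mod_cast hn0
    push_cast; field_simp
  rw [integral_complex_ofReal] at h'
  have h2 : ∫ U, (n * (truncTraceU n p q U - p * q / n) ^ 2 -
      (truncTraceU n p q U - ST n p q U) : ℝ) ∂μ = 0 := by exact_mod_cast h'
  have hi1 : Integrable (fun U => (truncTraceU n p q U - p * q / n) ^ 2) μ :=
    intT μ p q (fun x _ => (x - p * q / n) ^ 2) (by fun_prop)
  have hi2 : Integrable (fun U => truncTraceU n p q U - ST n p q U) μ :=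
    intT μ p q (fun x y => x - y) (by fun_prop)
  rw [integral_sub (hi1.const_mul _) hi2, integral_const_mul] at h2
  have h3 : ∫ U, (truncTraceU n p q U - ST n p q U) ∂μ ≤ ∫ U, (2 * n : ℝ) ∂μ := by
    refine integral_mono hi2 (integrable_const _) fun U => ?_
    have := abs_le.1 (abs_T_le p q U)
    have := abs_le.1 (abs_S_le p q U)
    simp only; linarith
  simp at h3
  nlinarith

lemma delta_bound (μ : Measure (Ug n)) [IsProbabilityMeasure μ] [μ.IsHaarMeasure] (p q : ℕ)
    (hp : p ≤ n) (hq : q ≤ n) (hn : 0 < n) (v : ℝ) :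
    ∫ U, |(truncTraceU n p q U - ST n p q U) / n - v| ∂μ ≤
      11 / n + |(p / n : ℝ) * (1 - p / n) * (q / n) * (1 - q / n) - v| := by
  have hn1 : (0 : ℝ) < n := by positivity
  set w : ℝ := (p / n : ℝ) * (1 - p / n) * (q / n) * (1 - q / n) with hw
  have hpt : ∀ U : Ug n, |(truncTraceU n p q U - ST n p q U) / n - v| ≤
      (3 / (2 * n)) * (truncTraceU n p q U - p * q / n) ^ 2 + (1 / (2 * n ^ 3)) * RT n p q U ^ 2 +
        (2 / n + |w - v|) := by
    intro U
    have hT := abs_T_le p q U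
    have hdef : RT n p q U = n * ST n p q U - (p + q) * truncTraceU n p q U +
      truncTraceU n p q U ^ 2 := rfl
    set T := truncTraceU n p q U
    set S := ST n p q U
    set R := RT n p q U
    have e : (T - S) / n - v = (T - p * q / n) * ((1 - p / n - q / n + p / n * (q / n) + T / n) / n)
        - R / n ^ 2 + (w - v) := by
      rw [hdef, hw]; field_simp; ring
    set a : ℝ := p / n with ha
    set b : ℝ := q / n with hb
    have ha0 : 0 ≤ a := by positivity
    have hb0 : 0 ≤ b := by positivity
    have ha1 : a ≤ 1 := by rw [ha, div_le_one hn1]; exact_mod_cast hp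
    have hb1 : b ≤ 1 := by rw [hb, div_le_one hn1]; exact_mod_cast hq
    have hτ : |T / n| ≤ 1 := by rw [abs_div, abs_of_pos hn1, div_le_one hn1]; exact hT
    have hc : |1 - a - b + a * b + T / n| ≤ 3 := by
      rw [abs_le] at hτ ⊢
      constructor <;> nlinarith [mul_nonneg ha0 hb0, mul_nonneg (sub_nonneg.2 ha1) (sub_nonneg.2 hb1)]
    have b1 : |(T - p * q / n) * ((1 - a - b + a * b + T / n) / n)| ≤
        (3 / (2 * n)) * (T - p * q / n) ^ 2 + 3 / (2 * n) := by
      rw [abs_mul, abs_div, abs_of_pos hn1]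
      calc _ ≤ |T - p * q / n| * (3 / n) := by gcongr
        _ = (3 / (2 * n)) * (2 * |T - p * q / n|) := by field_simp
        _ ≤ (3 / (2 * n)) * (|T - p * q / n| ^ 2 + 1) := by
          gcongr; nlinarith [sq_nonneg (|T - p * q / n| - 1)]
        _ = _ := by rw [sq_abs]; ring
    have b2 : |R / n ^ 2| ≤ (1 / (2 * n ^ 3)) * R ^ 2 + 1 / (2 * n) := by
      rw [abs_div, abs_of_pos (by positivity : (0 : ℝ) < n ^ 2), ← sq_abs R]
      have : (1 / (2 * n ^ 3)) * |R| ^ 2 + 1 / (2 * n) - |R| / n ^ 2 =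
          (|R| - n) ^ 2 / (2 * n ^ 3) := by field_simp; ring
      have h0 : 0 ≤ (|R| - n) ^ 2 / (2 * (n : ℝ) ^ 3) := by positivity
      linarith
    rw [e]
    calc _ ≤ |(T - p * q / n) * ((1 - a - b + a * b + T / n) / n)| + |R / n ^ 2| + |w - v| :=
          (abs_add_le _ _).trans (by gcongr; exact abs_sub _ _)
      _ ≤ _ := by
          have : (3 : ℝ) / (2 * n) + 1 / (2 * n) = 2 / n := by field_simp; norm_num
          linarith
  have hi1 : Integrable (fun U => (truncTraceU n p q U - p * q / n) ^ 2) μ :=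
    intT μ p q (fun x _ => (x - p * q / n) ^ 2) (by fun_prop)
  have hi2 : Integrable (fun U => RT n p q U ^ 2) μ :=
    intT μ p q (fun x y => (n * y - (p + q) * x + x ^ 2) ^ 2) (by fun_prop)
  have hi0 : Integrable (fun U => |(truncTraceU n p q U - ST n p q U) / n - v|) μ :=
    intT μ p q (fun x y => |(x - y) / n - v|) (by fun_prop)
  refine (integral_mono hi0 (((hi1.const_mul _).add (hi2.const_mul _)).add
    (integrable_const (2 / (n : ℝ) + |w - v|))) hpt).trans ?_
  simp only [Pi.add_apply]
  have hi12 : Integrable (fun U => 3 / (2 * (n : ℝ)) * (truncTraceU n p q U - p * q / n) ^ 2 +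
      1 / (2 * (n : ℝ) ^ 3) * RT n p q U ^ 2) μ := (hi1.const_mul _).add (hi2.const_mul _)
  rw [integral_add hi12 (integrable_const _),
    integral_add (hi1.const_mul _) (hi2.const_mul _), integral_const_mul, integral_const_mul]
  have hV := var_T μ p q hp hq hn
  have hR := main2 μ p q hp hq
  have hV' := mul_le_mul_of_nonneg_left hV (by positivity : (0 : ℝ) ≤ 3 / (2 * n))
  have hR' := mul_le_mul_of_nonneg_left hR (by positivity : (0 : ℝ) ≤ 1 / (2 * n ^ 3))
  have e2 : (3 : ℝ) / (2 * n) * 2 + 1 / (2 * n ^ 3) * (12 * n ^ 2) + 2 / n = 11 / n := by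
    field_simp; norm_num
  simp only [integral_const, probReal_univ, one_smul]
  linarith

lemma charfun_T (μ : Measure (Ug n)) [IsProbabilityMeasure μ] [μ.IsHaarMeasure] (p q : ℕ)
    (hp : p ≤ n) (hq : q ≤ n) (hn : 0 < n) (v : ℝ) (hv : 0 ≤ v) (θ : ℝ) :
    ‖∫ U, Complex.exp (Complex.I * θ *
        ((truncTraceU n p q U - ∫ V, truncTraceU n p q V ∂μ : ℝ) : ℂ)) ∂μ -
      Complex.exp (-(v * θ ^ 2 / 2))‖ ≤
      (11 / n + |(p / n : ℝ) * (1 - p / n) * (q / n) * (1 - q / n) - v|) * θ ^ 2 := by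
  rw [mean_T μ p q hp hq hn]
  have hn1 : (0 : ℝ) < n := by positivity
  have hnC : (n : ℂ) ≠ 0 := by exact_mod_cast hn.ne'
  refine charfun_ode μ (fun U => truncTraceU n p q U - p * q / n)
    (fun U => (truncTraceU n p q U - ST n p q U) / n)
    ((continuous_T p q).sub continuous_const).measurable
    (((continuous_T p q).sub (continuous_S p q)).div_const _).measurable
    (n + |(p * q / n : ℝ)|) 2 (fun U => ?_) (fun U => ?_) ?_ v _ hv
    (delta_bound μ p q hp hq hn v) θ
  · have := abs_T_le p q U
    have := abs_sub (truncTraceU n p q U) (p * q / n)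
    linarith
  · rw [abs_div, abs_of_pos hn1, div_le_iff₀ hn1]
    have := abs_T_le p q U
    have := abs_S_le p q U
    have := abs_sub (truncTraceU n p q U) (ST n p q U)
    linarith
  · intro θ
    have h := main1 μ p q hp hq
      (fun z => Complex.exp (Complex.I * θ * (z - ((p * q / n : ℝ) : ℂ))))
      (fun z => Complex.I * θ * Complex.exp (Complex.I * θ * (z - ((p * q / n : ℝ) : ℂ))))
      (fun z => by
        have := (((hasDerivAt_id z).sub_const ((p * q / n : ℝ) : ℂ)).const_mul
          (Complex.I * θ)).cexp
        refine this.congr_deriv ?_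
        simp; ring) (by fun_prop)
    have hc := continuous_cj (Pm n q)
    have hTc := continuous_T (n := n) p q
    have hSc := continuous_S (n := n) p q
    have hTc' : Continuous fun U : Ug n => (truncTraceU n p q U : ℂ) :=
      Complex.continuous_ofReal.comp hTc
    have hSc' : Continuous fun U : Ug n => (ST n p q U : ℂ) :=
      Complex.continuous_ofReal.comp hSc
    have hE : ∀ U : Ug n, ‖Complex.exp (Complex.I * θ *
        ((truncTraceU n p q U - p * q / n : ℝ) : ℂ))‖ = 1 := by
      intro U
      have : Complex.I * θ * ((truncTraceU n p q U - p * q / n : ℝ) : ℂ) =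
        ((θ * (truncTraceU n p q U - p * q / n) : ℝ) : ℂ) * Complex.I := by push_cast; ring
      rw [this, Complex.norm_exp_ofReal_mul_I]
    have i1 : Integrable (fun U => ((truncTraceU n p q U - p * q / n : ℝ) : ℂ) *
        Complex.exp (Complex.I * θ * ((truncTraceU n p q U - p * q / n : ℝ) : ℂ))) μ := by
      refine (intT μ p q (fun x _ => (x - p * q / n)) (by fun_prop)).norm.mono'
        (Continuous.aestronglyMeasurable (by fun_prop)) (Eventually.of_forall fun U => ?_)
      rw [norm_mul, hE, mul_one, Complex.norm_real]
    have i2 : Integrable (fun U => (((truncTraceU n p q U - ST n p q U) / n : ℝ) : ℂ) *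
        Complex.exp (Complex.I * θ * ((truncTraceU n p q U - p * q / n : ℝ) : ℂ))) μ := by
      refine (intT μ p q (fun x y => (x - y) / n) (by fun_prop)).norm.mono'
        (Continuous.aestronglyMeasurable (by fun_prop)) (Eventually.of_forall fun U => ?_)
      rw [norm_mul, hE, mul_one, Complex.norm_real]
    rw [← sub_eq_zero, ← integral_const_mul, ← integral_sub i1 (i2.const_mul _)]
    have h2 : (n : ℂ)⁻¹ * (0 : ℂ) = 0 := by simp
    rw [← h2, ← h, ← integral_const_mul]
    congr 1
    ext U
    push_cast
    field_simp

end analysis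

end TruncCLT

/-- If `U⁽ⁿ⁾` is Haar distributed on `U(n)` and `s, t ∈ [0,1]`, then
`T_{⌊ns⌋,⌊nt⌋} - E[T_{⌊ns⌋,⌊nt⌋}]` converges in distribution to a centered Gaussian with
variance `s(1-s)t(1-t)` (weak convergence tested against bounded continuous functions). -/
theorem truncTraceU_marginal_clt
    (μ : ∀ n : ℕ, Measure (Matrix.unitaryGroup (Fin n) ℂ))
    (hHaar : ∀ n, (μ n).IsHaarMeasure) (hProb : ∀ n, IsProbabilityMeasure (μ n))
    (s t : ℝ) (hs : s ∈ Set.Icc (0 : ℝ) 1) (ht : t ∈ Set.Icc (0 : ℝ) 1) :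
    ∀ f : BoundedContinuousFunction ℝ ℝ,
      Tendsto (fun n : ℕ =>
          ∫ U, f (truncTraceU n ⌊(n : ℝ) * s⌋₊ ⌊(n : ℝ) * t⌋₊ U -
            ∫ V, truncTraceU n ⌊(n : ℝ) * s⌋₊ ⌊(n : ℝ) * t⌋₊ V ∂(μ n)) ∂(μ n))
        atTop
        (nhds (∫ x, f x ∂(gaussianReal 0 (Real.toNNReal (s * (1 - s) * t * (1 - t)))))) := by
  intro f
  set v : ℝ := s * (1 - s) * t * (1 - t) with hv
  have hv0 : 0 ≤ v := by
    have := sub_nonneg.2 hs.2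
    have := sub_nonneg.2 ht.2
    have := hs.1
    have := ht.1
    positivity
  let X : ∀ n : ℕ, Matrix.unitaryGroup (Fin n) ℂ → ℝ := fun n U =>
    truncTraceU n ⌊(n : ℝ) * s⌋₊ ⌊(n : ℝ) * t⌋₊ U -
            ∫ V, truncTraceU n ⌊(n : ℝ) * s⌋₊ ⌊(n : ℝ) * t⌋₊ V ∂(μ n)
  have hXm : ∀ n, Measurable (X n) := fun n =>
    ((TruncCLT.continuous_T _ _).sub continuous_const).measurable
  have hpm : ∀ n, IsProbabilityMeasure ((μ n).map (X n)) := fun n =>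
    Measure.isProbabilityMeasure_map (hXm n).aemeasurable
  let ν : ℕ → ProbabilityMeasure ℝ := fun n => ⟨(μ n).map (X n), hpm n⟩
  let ν₀ : ProbabilityMeasure ℝ := ⟨gaussianReal 0 (Real.toNNReal v), inferInstance⟩
  have hlim : Tendsto ν atTop (nhds ν₀) := by
    rw [ProbabilityMeasure.tendsto_iff_tendsto_charFun]
    intro θ
    have h0 : charFun (ν₀ : Measure ℝ) θ = Complex.exp (-(v * θ ^ 2 / 2)) := by
      change charFun (gaussianReal 0 (Real.toNNReal v)) θ = _
      rw [charFun_gaussianReal]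
      congr 1
      simp [hv0]
    have h1 : ∀ n, charFun (ν n : Measure ℝ) θ =
        ∫ U, Complex.exp (Complex.I * θ * (X n U : ℂ)) ∂(μ n) := by
      intro n
      change charFun ((μ n).map (X n)) θ = _
      rw [charFun_apply_real, integral_map (hXm n).aemeasurable
        (Continuous.aestronglyMeasurable (by fun_prop))]
      congr 1
      ext U
      congr 1
      ring
    rw [h0]
    simp_rw [h1]
    rw [tendsto_iff_norm_sub_tendsto_zero]
    have hfl : ∀ r : ℝ, 0 ≤ r → Tendsto (fun n : ℕ => (⌊(n : ℝ) * r⌋₊ : ℝ) / n) atTop (nhds r) := by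
      intro r hr
      have := (tendsto_nat_floor_mul_div_atTop hr).comp tendsto_natCast_atTop_atTop
      refine this.congr fun n => ?_
      simp [mul_comm]
    have hbd : Tendsto (fun n : ℕ => (11 / (n : ℝ) +
        |(⌊(n : ℝ) * s⌋₊ / n : ℝ) * (1 - ⌊(n : ℝ) * s⌋₊ / n) * (⌊(n : ℝ) * t⌋₊ / n) *
          (1 - ⌊(n : ℝ) * t⌋₊ / n) - v|) * θ ^ 2) atTop (nhds 0) := by
      have a1 := hfl s hs.1
      have a2 := hfl t ht.1
      have a3 : Tendsto (fun n : ℕ => 11 / (n : ℝ)) atTop (nhds 0) :=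
        tendsto_const_div_atTop_nhds_zero_nat 11
      have := (a3.add (((((a1.mul (a1.const_sub 1)).mul a2).mul (a2.const_sub 1)).sub_const
        v).abs)).mul_const (θ ^ 2)
      simpa [hv] using this
    refine squeeze_zero' (Eventually.of_forall fun n => norm_nonneg _) ?_ hbd
    filter_upwards [eventually_gt_atTop 0] with n hn
    have := hHaar n
    have := hProb n
    have hle : ∀ r : ℝ, r ≤ 1 → ⌊(n : ℝ) * r⌋₊ ≤ n := fun r hr =>
      Nat.floor_le_of_le (mul_le_of_le_one_right (by positivity) hr)
    exact TruncCLT.charfun_T (μ n) _ _ (hle s hs.2) (hle t ht.2) hn v hv0 θ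
  have := ProbabilityMeasure.tendsto_iff_forall_integral_tendsto.1 hlim f
  have hmap : ∀ n, ∫ x, f x ∂(ν n : Measure ℝ) = ∫ U, f (X n U) ∂(μ n) := fun n =>
    integral_map (hXm n).aemeasurable f.continuous.aestronglyMeasurable
  simp_rw [hmap] at this
  exact this
end

section
/- For each n ≥ 2 let U^{(n)} be Haar distributed on the unitary group U(n) and set T^{(n)}_{p,q} = Σ_{i≤p, j≤q} |U^{(n)}_{ij}|². Fix k ≥ 1, real numbers a_1,…,a_k, and points (s_1,t_1),…,(s_k,t_k) ∈ [0,1]². Then the real random variables X^{(n)} = Σ_{i=1}^k a_i (T^{(n)}_{⌊n s_i⌋,⌊n t_i⌋} − E[T^{(n)}_{⌊n s_i⌋,⌊n t_i⌋}]) converge in distribution, as n → ∞, to a centered Gaussian random variable with variance Σ_{i,j=1}^k a_i a_j (s_i∧s_j − s_i s_j)(t_i∧t_j − t_i t_j). -/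
open MeasureTheory Matrix Filter ProbabilityTheory

namespace TTU

variable {n : ℕ}

/-- Abbreviation for the unitary group. -/
abbrev UG (n : ℕ) := Matrix.unitaryGroup (Fin n) ℂ

instance matBorel : BorelSpace (Matrix (Fin n) (Fin n) ℂ) :=
  inferInstanceAs (BorelSpace (Fin n → Fin n → ℂ))

instance ugBorel : BorelSpace (UG n) := Subtype.borelSpace _

instance ugCompact : CompactSpace (UG n) := by
  have hc : IsClosed ((Matrix.unitaryGroup (Fin n) ℂ : Set (Matrix (Fin n) (Fin n) ℂ))) :=
    isClosed_unitary
  have hK : IsCompact (Set.pi Set.univ (fun _ : Fin n => Set.pi Set.univ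
      (fun _ : Fin n => Metric.closedBall (0 : ℂ) 1))) :=
    isCompact_univ_pi fun _ => isCompact_univ_pi fun _ => isCompact_closedBall _ _
  have : IsCompact ((Matrix.unitaryGroup (Fin n) ℂ : Set (Matrix (Fin n) (Fin n) ℂ))) := by
    refine IsCompact.of_isClosed_subset hK hc ?_
    intro U hU i _ j _
    simpa using entry_norm_bound_of_unitary hU i j
  exact isCompact_iff_compactSpace.mp this

/-- The one-parameter subgroup generated by a skew-Hermitian matrix. -/
noncomputable def expU (S : Matrix (Fin n) (Fin n) ℂ) (hS : star S = -S) (t : ℝ) : UG n :=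
  ⟨NormedSpace.exp (t • S), by
    rw [Matrix.mem_unitaryGroup_iff, Matrix.star_eq_conjTranspose, ← Matrix.exp_conjTranspose,
      ← Matrix.exp_add_of_commute]
    · rw [← Matrix.star_eq_conjTranspose, star_smul, hS]; simp
    · rw [← Matrix.star_eq_conjTranspose, star_smul, hS]
      exact ((((Commute.refl S).neg_right).smul_left t).smul_right _)⟩

lemma expU_zero (S : Matrix (Fin n) (Fin n) ℂ) (hS : star S = -S) : expU S hS 0 = 1 := by
  apply Subtype.ext
  simp [expU]

lemma expU_add (S : Matrix (Fin n) (Fin n) ℂ) (hS : star S = -S) (s t : ℝ) :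
    expU S hS (s + t) = expU S hS s * expU S hS t := by
  apply Subtype.ext
  simp only [expU, add_smul]
  exact Matrix.exp_add_of_commute _ _ (((Commute.refl S).smul_left s).smul_right t)

section expo
attribute [local instance] Matrix.linftyOpNormedRing Matrix.linftyOpNormedAlgebra

lemma expU_hasDerivAt (S : Matrix (Fin n) (Fin n) ℂ) (hS : star S = -S) (a b : Fin n) :
    HasDerivAt (fun t : ℝ => (expU S hS t : Matrix (Fin n) (Fin n) ℂ) a b) (S a b) 0 := by
  have h := hasDerivAt_exp_smul_const (𝕂 := ℝ) S (0 : ℝ)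
  let L : Matrix (Fin n) (Fin n) ℂ →ₗ[ℝ] ℂ :=
      { toFun := fun M => M a b, map_add' := fun _ _ => rfl, map_smul' := fun _ _ => rfl }
  have h2 := (LinearMap.toContinuousLinearMap L).hasFDerivAt.comp_hasDerivAt (0 : ℝ) h
  rw [zero_smul, NormedSpace.exp_zero, one_mul] at h2
  exact h2

end expo

/-- `F` has the (complexified, right-invariant) derivatives `g a b` along the matrix units. -/
structure HasG (F : UG n → ℂ) (g : Fin n → Fin n → UG n → ℂ) : Prop where
  cont : Continuous F
  contg : ∀ a b, Continuous (g a b)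
  der : ∀ (S : Matrix (Fin n) (Fin n) ℂ) (hS : star S = -S) (U : UG n),
    HasDerivAt (fun t : ℝ => F (expU S hS t * U)) (∑ a, ∑ b, S a b * g a b U) 0

lemma integrable_of_cont (μ : Measure (UG n)) [IsProbabilityMeasure μ] {F : UG n → ℂ}
    (h : Continuous F) : Integrable F μ :=
  h.integrable_of_hasCompactSupport (HasCompactSupport.of_compactSpace F)

lemma HasG.congr {F : UG n → ℂ} {g g' : Fin n → Fin n → UG n → ℂ} (h : HasG F g)
    (hg : ∀ a b U, g a b U = g' a b U) : HasG F g' := by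
  have : g = g' := by ext a b U; exact hg a b U
  exact this ▸ h

lemma HasG.const (c : ℂ) : HasG (fun _ : UG n => c) (fun _ _ _ => 0) where
  cont := continuous_const
  contg _ _ := continuous_const
  der S hS U := by simpa using hasDerivAt_const (0 : ℝ) c

lemma HasG.mul {F G : UG n → ℂ} {f g : Fin n → Fin n → UG n → ℂ} (hF : HasG F f) (hG : HasG G g) :
    HasG (fun U => F U * G U) (fun a b U => f a b U * G U + F U * g a b U) where
  cont := hF.cont.mul hG.cont
  contg a b := ((hF.contg a b).mul hG.cont).add (hF.cont.mul (hG.contg a b))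
  der S hS U := by
    refine ((hF.der S hS U).mul (hG.der S hS U)).congr_deriv ?_
    simp only [expU_zero, one_mul, mul_add, Finset.sum_add_distrib, Finset.sum_mul, Finset.mul_sum]
    congr 1 <;> refine Finset.sum_congr rfl fun a _ => Finset.sum_congr rfl fun b _ => by ring

lemma HasG.sum {ι : Type*} (s : Finset ι) {F : ι → UG n → ℂ} {f : ι → Fin n → Fin n → UG n → ℂ}
    (hF : ∀ i ∈ s, HasG (F i) (f i)) :
    HasG (fun U => ∑ i ∈ s, F i U) (fun a b U => ∑ i ∈ s, f i a b U) where
  cont := continuous_finsetSum _ fun i hi => (hF i hi).cont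
  contg a b := continuous_finsetSum _ fun i hi => (hF i hi).contg a b
  der S hS U := by
    refine (HasDerivAt.fun_sum fun i hi => (hF i hi).der S hS U).congr_deriv ?_
    simp only [Finset.mul_sum]
    rw [Finset.sum_comm]
    refine Finset.sum_congr rfl fun a _ => ?_
    rw [Finset.sum_comm]

lemma HasG.const_mul (c : ℂ) {F : UG n → ℂ} {f : Fin n → Fin n → UG n → ℂ} (hF : HasG F f) :
    HasG (fun U => c * F U) (fun a b U => c * f a b U) :=
  ((HasG.const c).mul hF).congr fun a b U => by simp

lemma HasG.cexp {F : UG n → ℂ} {f : Fin n → Fin n → UG n → ℂ} (hF : HasG F f) :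
    HasG (fun U => Complex.exp (F U)) (fun a b U => Complex.exp (F U) * f a b U) where
  cont := Complex.continuous_exp.comp hF.cont
  contg a b := (Complex.continuous_exp.comp hF.cont).mul (hF.contg a b)
  der S hS U := by
    refine ((hF.der S hS U).cexp).congr_deriv ?_
    simp only [expU_zero, one_mul, Finset.mul_sum]
    refine Finset.sum_congr rfl fun a _ => Finset.sum_congr rfl fun b _ => by ring

lemma HasG.integral_skew (μ : Measure (UG n)) [μ.IsHaarMeasure] [IsProbabilityMeasure μ]
    {F : UG n → ℂ} {g : Fin n → Fin n → UG n → ℂ} (h : HasG F g)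
    (S : Matrix (Fin n) (Fin n) ℂ) (hS : star S = -S) :
    ∑ a, ∑ b, S a b * ∫ U, g a b U ∂μ = 0 := by
  set H : UG n → ℂ := fun U => ∑ a, ∑ b, S a b * g a b U with hH
  have hHc : Continuous H := continuous_finsetSum _ fun a _ => continuous_finsetSum _ fun b _ =>
    continuous_const.mul (h.contg a b)
  obtain ⟨C, hC⟩ := (isCompact_univ (X := UG n)).exists_bound_of_continuousOn hHc.continuousOn
  have hd : ∀ (U : UG n) (t : ℝ),
      HasDerivAt (fun t : ℝ => F (expU S hS t * U)) (H (expU S hS t * U)) t := by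
    intro U t
    have h1 := h.der S hS (expU S hS t * U)
    have h2 : HasDerivAt (fun x : ℝ => F (expU S hS (x - t) * (expU S hS t * U)))
        (H (expU S hS t * U)) t := by
      have h3 : HasDerivAt (fun t' : ℝ => F (expU S hS t' * (expU S hS t * U)))
        (H (expU S hS t * U)) (t - t) := by rw [sub_self]; exact h1
      exact h3.comp_sub_const t t
    refine h2.congr_of_eventuallyEq (Eventually.of_forall fun x => ?_)
    simp only
    rw [← mul_assoc, ← expU_add, sub_add_cancel]
  have hmeas : ∀ {K : UG n → ℂ}, Continuous K → ∀ V : UG n,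
      AEStronglyMeasurable (fun U => K (V * U)) μ := fun hK V =>
    (integrable_of_cont μ (hK.comp (continuous_const.mul continuous_id))).aestronglyMeasurable
  have key := hasDerivAt_integral_of_dominated_loc_of_deriv_le (μ := μ) (𝕜 := ℝ)
    (bound := fun _ => C) (F := fun t U => F (expU S hS t * U)) (x₀ := 0) (s := Set.univ)
    (F' := fun t U => H (expU S hS t * U)) Filter.univ_mem
    (Eventually.of_forall fun t => hmeas h.cont _)
    (integrable_of_cont μ (h.cont.comp (continuous_const.mul continuous_id)))
    (hmeas hHc _)
    (Eventually.of_forall fun U t _ => hC _ (Set.mem_univ _))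
    (integrable_const C)
    (Eventually.of_forall fun U t _ => hd U t)
  have hconst : (fun t : ℝ => ∫ U, F (expU S hS t * U) ∂μ) = fun _ => ∫ U, F U ∂μ := by
    funext t
    exact integral_mul_left_eq_self F _
  have h0 : ∫ U, H (expU S hS 0 * U) ∂μ = 0 := by
    have k2 := key.2
    rw [hconst] at k2
    exact k2.unique (hasDerivAt_const _ _)
  simp only [expU_zero, one_mul] at h0
  rw [← h0]
  simp only [H]
  have hi : ∀ a b, Integrable (fun U => S a b * g a b U) μ := fun a b =>
    integrable_of_cont μ (continuous_const.mul (h.contg a b))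
  rw [integral_finsetSum]
  · refine Finset.sum_congr rfl fun a _ => ?_
    rw [integral_finsetSum]
    · refine Finset.sum_congr rfl fun b _ => ?_
      rw [integral_const_mul]
    · exact fun b _ => hi a b
  · exact fun a _ => integrable_finsetSum _ fun b _ => hi a b

lemma HasG.integral_eq_zero (μ : Measure (UG n)) [μ.IsHaarMeasure] [IsProbabilityMeasure μ]
    {F : UG n → ℂ} {g : Fin n → Fin n → UG n → ℂ} (h : HasG F g) (a b : Fin n) :
    ∫ U, g a b U ∂μ = 0 := by
  have hs : ∀ (c : ℂ) (x y : Fin n), ∑ a, ∑ b, Matrix.single x y c a b * ∫ U, g a b U ∂μ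
      = c * ∫ U, g x y U ∂μ := by
    intro c x y
    rw [Finset.sum_eq_single x, Finset.sum_eq_single y]
    · simp
    · intro z _ hz; simp [hz.symm]
    · simp
    · intro z _ hz; simp [hz.symm]
    · simp
  have h1 := h.integral_skew μ (Matrix.single a b 1 - Matrix.single b a 1) (by
    simp [Matrix.star_eq_conjTranspose, Matrix.conjTranspose_single])
  have h2 := h.integral_skew μ (Matrix.single a b Complex.I + Matrix.single b a Complex.I) (by
    simp [Matrix.star_eq_conjTranspose, Matrix.conjTranspose_single]
    simp only [← Matrix.single_neg])
  simp only [Matrix.sub_apply, Matrix.add_apply, sub_mul, add_mul, Finset.sum_sub_distrib,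
    Finset.sum_add_distrib, hs, one_mul] at h1 h2
  have h3 : Complex.I * (∫ U, g a b U ∂μ + ∫ U, g b a U ∂μ) = 0 := by rw [mul_add]; exact h2
  have h4 := (mul_eq_zero.1 h3).resolve_left Complex.I_ne_zero
  linear_combination h1 / 2 + h4 / 2


lemma div_zero (μ : Measure (UG n)) [μ.IsHaarMeasure] [IsProbabilityMeasure μ]
    {M : Fin n → Fin n → UG n → ℂ} {m : Fin n → Fin n → Fin n → Fin n → UG n → ℂ}
    (h : ∀ a b, HasG (M a b) (m a b)) :
    ∫ U, ∑ a, ∑ b, m a b a b U ∂μ = 0 := by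
  rw [integral_finsetSum]
  · refine Finset.sum_eq_zero fun a _ => ?_
    rw [integral_finsetSum]
    · exact Finset.sum_eq_zero fun b _ => (h a b).integral_eq_zero μ a b
    · exact fun b _ => integrable_of_cont μ ((h a b).contg a b)
  · exact fun a _ => integrable_finsetSum _ fun b _ => integrable_of_cont μ ((h a b).contg a b)

/-- The matrix `U diag(e) U*`. -/
noncomputable def W (e : Fin n → ℝ) (U : UG n) : Matrix (Fin n) (Fin n) ℂ :=
  (U : Matrix (Fin n) (Fin n) ℂ) * Matrix.diagonal (fun j => (e j : ℂ)) *
    star (U : Matrix (Fin n) (Fin n) ℂ)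

lemma W_apply (e : Fin n → ℝ) (U : UG n) (c d : Fin n) :
    W e U c d = ∑ j, U.1 c j * (e j : ℂ) * star (U.1 d j) := by
  rw [W, Matrix.mul_apply]
  simp [Matrix.mul_diagonal, Matrix.star_apply]

lemma continuous_entry (a b : Fin n) : Continuous (fun U : UG n => U.1 a b) :=
  (continuous_apply b).comp ((continuous_apply a).comp continuous_subtype_val)

lemma continuous_W (e : Fin n → ℝ) (c d : Fin n) : Continuous (fun U : UG n => W e U c d) := by
  simp only [W_apply]
  exact continuous_finsetSum _ fun j _ => ((continuous_entry c j).mul continuous_const).mul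
    (continuous_star.comp (continuous_entry d j))

lemma hasG_W (e : Fin n → ℝ) (c d : Fin n) :
    HasG (fun U => W e U c d) (fun a b U => (if a = c then W e U b d else 0) -
      (if b = d then W e U c a else 0)) where
  cont := continuous_W e c d
  contg a b := by
    refine Continuous.sub ?_ ?_
    · split_ifs
      · exact continuous_W e b d
      · exact continuous_const
    · split_ifs
      · exact continuous_W e c a
      · exact continuous_const
  der S hS U := by
    have hS' : ∀ x y, star (S x y) = - S y x := fun x y => by
      have := congrFun (congrFun hS y) x
      simpa [Matrix.star_apply] using this
    have hE : ∀ x j, HasDerivAt (fun t : ℝ => (expU S hS t * U).1 x j) (∑ y, S x y * U.1 y j) 0 := by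
      intro x j
      have : (fun t : ℝ => (expU S hS t * U).1 x j) =
          fun t : ℝ => ∑ y, (expU S hS t).1 x y * U.1 y j := by
        funext t
        exact Matrix.mul_apply
      rw [this]
      exact HasDerivAt.fun_sum fun y _ => (expU_hasDerivAt S hS x y).mul_const _
    simp only [W_apply]
    refine (HasDerivAt.fun_sum fun j _ =>
      ((hE c j).mul_const (e j : ℂ)).mul (hE d j).star).congr_deriv ?_
    simp only [expU_zero, one_mul, star_sum, star_mul', hS', mul_sub, Finset.sum_sub_distrib,
      Finset.sum_add_distrib]
    rw [sub_eq_add_neg]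
    congr 1
    · simp only [mul_ite, mul_zero]
      rw [Finset.sum_comm (f := fun x y => if x = c then _ else _)]
      simp only [Finset.sum_ite_eq', Finset.mem_univ, if_true, Finset.sum_mul, Finset.mul_sum]
      rw [Finset.sum_comm]
      refine Finset.sum_congr rfl fun a _ => Finset.sum_congr rfl fun b _ => by ring
    · simp only [mul_ite, mul_zero, Finset.sum_ite_eq', Finset.mem_univ, if_true, Finset.sum_mul,
        Finset.mul_sum, ← Finset.sum_neg_distrib]
      rw [Finset.sum_comm]
      refine Finset.sum_congr rfl fun a _ => Finset.sum_congr rfl fun b _ => by ring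

/-- Linear statistic. -/
noncomputable def Z (d e : Fin n → ℝ) (U : UG n) : ℂ := ∑ a, (d a : ℂ) * W e U a a

lemma hasG_Z (d e : Fin n → ℝ) :
    HasG (Z d e) (fun a b U => ((d a : ℂ) - d b) * W e U b a) := by
  refine (HasG.sum Finset.univ fun c _ => (hasG_W e c c).const_mul (d c : ℂ)).congr ?_
  intro a b U
  simp only [mul_sub, mul_ite, mul_zero, Finset.sum_sub_distrib, Finset.sum_ite_eq,
    Finset.mem_univ, if_true]
  ring

lemma ibpA (μ : Measure (UG n)) [μ.IsHaarMeasure] [IsProbabilityMeasure μ]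
    (d e : Fin n → ℝ) (hd : ∑ a, d a = 0) {G : UG n → ℂ} {g : Fin n → Fin n → UG n → ℂ}
    (hG : HasG G g) :
    (n : ℂ) * ∫ U, Z d e U * G U ∂μ = - ∫ U, ∑ a, ∑ b, W e U a b * d b * g a b U ∂μ := by
  have h := div_zero μ (fun a b => ((hasG_W e a b).const_mul (d b : ℂ)).mul hG)
  have hd' : ∑ a, (d a : ℂ) = 0 := by exact_mod_cast congrArg (fun x : ℝ => (x : ℂ)) hd
  rw [eq_neg_iff_add_eq_zero, ← integral_const_mul, ← integral_add, ← h]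
  · congr 1
    funext U
    simp only [if_true, Finset.sum_add_distrib, mul_sub, sub_mul, Finset.sum_sub_distrib]
    have h1 : ∑ a : Fin n, ∑ b, (d b : ℂ) * W e U b b * G U = n * (Z d e U * G U) := by
      simp [Z, Finset.sum_mul]
    have h2 : ∑ a : Fin n, ∑ b, (d b : ℂ) * W e U a a * G U = 0 := by
      simp [← Finset.sum_mul, hd']
    rw [h1, h2, sub_zero]
    congr 1
    refine Finset.sum_congr rfl fun a _ => Finset.sum_congr rfl fun b _ => by ring
  · exact integrable_of_cont μ (continuous_const.mul ((hasG_Z d e).cont.mul hG.cont))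
  · exact integrable_of_cont μ (continuous_finsetSum _ fun a _ => continuous_finsetSum _ fun b _ =>
      ((continuous_W e a b).mul continuous_const).mul (hG.contg a b))

/-- Quartic statistic. -/
noncomputable def Y (d e d' e' : Fin n → ℝ) (U : UG n) : ℂ :=
  ∑ b, ∑ c, W e U b c * d c * W e' U c b * d' b

lemma continuous_Y (d e d' e' : Fin n → ℝ) : Continuous (Y d e d' e') :=
  continuous_finsetSum _ fun b _ => continuous_finsetSum _ fun c _ =>
    (((continuous_W e b c).mul continuous_const).mul (continuous_W e' c b)).mul continuous_const

lemma star_mul_sum (U : UG n) (j k : Fin n) :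
    ∑ a, star (U.1 a j) * U.1 a k = if j = k then 1 else 0 := by
  have h := Matrix.mem_unitaryGroup_iff'.1 U.2
  have := congrFun (congrFun h j) k
  simpa [Matrix.mul_apply, Matrix.star_apply, Matrix.one_apply] using this

lemma W_mul (e e' : Fin n → ℝ) (U : UG n) : W e U * W e' U = W (fun j => e j * e' j) U := by
  have h := Matrix.mem_unitaryGroup_iff'.1 U.2
  simp only [W]
  rw [show ∀ A B C D E F : Matrix (Fin n) (Fin n) ℂ, A * B * C * (D * E * F) =
    A * (B * (C * D) * E) * F from fun A B C D E F => by simp only [mul_assoc], h, mul_one,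
    Matrix.diagonal_mul_diagonal]
  simp

lemma W_trace (e : Fin n → ℝ) (U : UG n) : ∑ a, W e U a a = ((∑ j, e j : ℝ) : ℂ) := by
  have : ∑ a, W e U a a = (W e U).trace := rfl
  rw [this, W, Matrix.trace_mul_comm, ← mul_assoc, Matrix.mem_unitaryGroup_iff'.1 U.2, one_mul,
    Matrix.trace_diagonal]
  simp

lemma ibpB (μ : Measure (UG n)) [μ.IsHaarMeasure] [IsProbabilityMeasure μ]
    (d e d' e' : Fin n → ℝ) (he : ∑ a, e a = 0) (hd' : ∑ a, d' a = 0)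
    {G : UG n → ℂ} {g : Fin n → Fin n → UG n → ℂ} (hG : HasG G g) :
    (n : ℂ) * ∫ U, Y d e d' e' U * G U ∂μ = - ∫ U, Z d e U * Z d' e' U * G U ∂μ -
      ∫ U, ∑ a, ∑ b, (∑ c, W e U a c * d c * W e' U c b) * d' b * g a b U ∂μ := by
  have h := div_zero μ (fun a b => (HasG.sum Finset.univ fun c _ =>
    ((hasG_W e a c).mul (hasG_W e' c b)).const_mul ((d c : ℂ) * d' b)).mul hG)
  have hd2 : ∑ a, (d' a : ℂ) = 0 := by exact_mod_cast congrArg (fun x : ℝ => (x : ℂ)) hd'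
  have he2 : ∀ U, ∑ a, W e U a a = 0 := fun U => by rw [W_trace, he]; simp
  have i1 : Integrable (fun U => (n : ℂ) * (Y d e d' e' U * G U)) μ :=
    integrable_of_cont μ (continuous_const.mul ((continuous_Y _ _ _ _).mul hG.cont))
  have i2 : Integrable (fun U => ∑ a, ∑ b, (∑ c, W e U a c * d c * W e' U c b) * d' b * g a b U) μ :=
    integrable_of_cont μ (continuous_finsetSum _ fun a _ => continuous_finsetSum _ fun b _ =>
      ((continuous_finsetSum _ fun c _ => ((continuous_W e a c).mul continuous_const).mul
        (continuous_W e' c b)).mul continuous_const).mul (hG.contg a b))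
  have i3 : Integrable (fun U => Z d e U * Z d' e' U * G U) μ :=
    integrable_of_cont μ (((hasG_Z d e).cont.mul (hasG_Z d' e').cont).mul hG.cont)
  rw [eq_sub_iff_add_eq, eq_neg_iff_add_eq_zero, ← integral_const_mul, ← integral_add,
    ← integral_add, ← h]
  · congr 1
    funext U
    have h1 : ∑ a : Fin n, ∑ b, ∑ c, (d c : ℂ) * d' b * (W e U b c * W e' U c b) * G U =
        n * (Y d e d' e' U * G U) := by
      simp only [Y, Finset.sum_const, Finset.card_univ, Fintype.card_fin, nsmul_eq_mul,
        Finset.sum_mul]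
      congr 1
      refine Finset.sum_congr rfl fun a _ => Finset.sum_congr rfl fun b _ => by ring
    have h2 : ∑ a : Fin n, ∑ b, ∑ c, (d c : ℂ) * d' b *
        ((if b = c then W e U a a else 0) * W e' U c b) * G U = 0 := by
      have : ∀ a b, ∑ c, (d c : ℂ) * d' b *
        ((if b = c then W e U a a else 0) * W e' U c b) * G U =
          W e U a a * (d b * d' b * W e' U b b * G U) := by
        intro a b
        simp only [ite_mul, zero_mul, mul_ite, mul_zero, Finset.sum_ite_eq, Finset.mem_univ,
          if_true]
        ring
      simp only [this, ← Finset.mul_sum]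
      rw [← Finset.sum_mul, he2, zero_mul]
    have h3 : ∑ a : Fin n, ∑ b, ∑ c, (d c : ℂ) * d' b *
        (W e U a c * (if a = c then W e' U b b else 0)) * G U = Z d e U * Z d' e' U * G U := by
      simp only [Z, mul_ite, mul_zero, ite_mul, zero_mul, Finset.sum_ite_eq, Finset.mem_univ,
          if_true, Finset.sum_mul, Finset.mul_sum]
      rw [Finset.sum_comm]
      refine Finset.sum_congr rfl fun a _ => Finset.sum_congr rfl fun b _ => by ring
    have h4 : ∑ a : Fin n, ∑ b, ∑ c, (d c : ℂ) * d' b * (W e U a c * W e' U c a) * G U = 0 := by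
      have : ∀ a b, ∑ c, (d c : ℂ) * d' b * (W e U a c * W e' U c a) * G U =
          d' b * ∑ c, (d c : ℂ) * (W e U a c * W e' U c a) * G U := by
        intro a b
        rw [Finset.mul_sum]
        refine Finset.sum_congr rfl fun a _ => by ring
      simp only [this, ← Finset.sum_mul, hd2, zero_mul, Finset.sum_const_zero]
    have h5 : ∑ a : Fin n, ∑ b, ∑ c, (d c : ℂ) * d' b * (W e U a c * W e' U c b) * g a b U =
        ∑ a : Fin n, ∑ b, ∑ c, W e U a c * d c * W e' U c b * d' b * g a b U :=
      Finset.sum_congr rfl fun a _ => Finset.sum_congr rfl fun b _ =>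
        Finset.sum_congr rfl fun c _ => by ring
    simp only [if_true, mul_add, add_mul, mul_sub, sub_mul, Finset.sum_mul,
      Finset.sum_add_distrib, Finset.sum_sub_distrib]
    rw [h1, h2, h3, h4, h5]
    ring
  · exact i1.add i2
  · exact i3
  · exact i1
  · exact i2


/-- Real form of the linear statistic. -/
noncomputable def Zr (d e : Fin n → ℝ) (U : UG n) : ℝ := ∑ a, ∑ j, d a * e j * ‖U.1 a j‖ ^ 2

lemma Z_eq (d e : Fin n → ℝ) (U : UG n) : Z d e U = (Zr d e U : ℂ) := by
  simp only [Z, Zr, W_apply, Complex.ofReal_sum, Finset.mul_sum]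
  refine Finset.sum_congr rfl fun a _ => Finset.sum_congr rfl fun j _ => ?_
  have : U.1 a j * star (U.1 a j) = ((‖U.1 a j‖ ^ 2 : ℝ) : ℂ) := by
    rw [Complex.star_def, Complex.mul_conj']; push_cast; rfl
  push_cast at this ⊢
  rw [← this]; ring

lemma continuous_Zr (d e : Fin n → ℝ) : Continuous (Zr d e) :=
  continuous_finsetSum _ fun a _ => continuous_finsetSum _ fun j _ =>
    continuous_const.mul ((continuous_entry a j).norm.pow 2)

lemma row_sum (U : UG n) (i : Fin n) : ∑ j, ‖U.1 i j‖ ^ 2 = 1 := by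
  have h := congrFun (congrFun (Matrix.mem_unitaryGroup_iff.1 U.2) i) i
  rw [Matrix.mul_apply, Matrix.one_apply_eq] at h
  have h2 : ((∑ j, ‖U.1 i j‖ ^ 2 : ℝ) : ℂ) = 1 := by
    rw [← h]; push_cast
    refine Finset.sum_congr rfl fun j _ => ?_
    rw [Matrix.star_apply, Complex.star_def, Complex.mul_conj']
  exact_mod_cast h2

lemma col_sum (U : UG n) (j : Fin n) : ∑ i, ‖U.1 i j‖ ^ 2 = 1 := by
  have h := star_mul_sum U j j
  have h2 : ((∑ i, ‖U.1 i j‖ ^ 2 : ℝ) : ℂ) = 1 := by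
    rw [if_pos rfl] at h
    rw [← h]; push_cast
    refine Finset.sum_congr rfl fun i _ => ?_
    rw [Complex.star_def, mul_comm, Complex.mul_conj']
  exact_mod_cast h2

lemma Zr_shift (d e : Fin n → ℝ) (x y : ℝ) (U : UG n) :
    Zr (fun i => d i - x) (fun j => e j - y) U =
      Zr d e U - y * ∑ i, d i - x * ∑ j, e j + n * x * y := by
  have h1 : ∑ a, ∑ j, d a * ‖U.1 a j‖ ^ 2 = ∑ a, d a := by
    refine Finset.sum_congr rfl fun a _ => ?_
    rw [← Finset.mul_sum, row_sum, mul_one]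
  have h2 : ∑ a, ∑ j, e j * ‖U.1 a j‖ ^ 2 = ∑ a, e a := by
    rw [Finset.sum_comm]
    refine Finset.sum_congr rfl fun a _ => ?_
    rw [← Finset.mul_sum, col_sum, mul_one]
  have h3 : ∑ a, ∑ j, ‖U.1 a j‖ ^ 2 = n := by
    simp [row_sum]
  rw [← h1, ← h2]
  have : (n : ℝ) * x * y = x * y * ∑ a, ∑ j, ‖U.1 a j‖ ^ 2 := by rw [h3]; ring
  rw [this]
  simp only [Zr, Finset.mul_sum, ← Finset.sum_sub_distrib, ← Finset.sum_add_distrib]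
  refine Finset.sum_congr rfl fun a _ => Finset.sum_congr rfl fun b _ => by ring

lemma frob_trace (M : Matrix (Fin n) (Fin n) ℂ) :
    ((∑ a, ∑ b, ‖M a b‖ ^ 2 : ℝ) : ℂ) = (M * star M).trace := by
  simp only [Matrix.trace, Matrix.diag, Matrix.mul_apply, Matrix.star_apply]
  push_cast
  refine Finset.sum_congr rfl fun a _ => Finset.sum_congr rfl fun b _ => ?_
  rw [Complex.star_def, Complex.mul_conj']

lemma frob_conj (U : UG n) (B : Matrix (Fin n) (Fin n) ℂ) :
    ∑ a, ∑ b, ‖(U.1 * B * star U.1) a b‖ ^ 2 = ∑ a, ∑ b, ‖B a b‖ ^ 2 := by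
  have h := Matrix.mem_unitaryGroup_iff'.1 U.2
  have : ((∑ a, ∑ b, ‖(U.1 * B * star U.1) a b‖ ^ 2 : ℝ) : ℂ) =
      ((∑ a, ∑ b, ‖B a b‖ ^ 2 : ℝ) : ℂ) := by
    rw [frob_trace, frob_trace, star_mul, star_mul, star_star,
      show U.1 * B * star U.1 * (U.1 * (star B * star U.1)) =
        U.1 * (B * (star U.1 * U.1) * star B) * star U.1 by simp only [mul_assoc],
      h, mul_one, Matrix.trace_mul_comm, ← mul_assoc, h, one_mul]
  exact_mod_cast this

lemma frob_diag (d : Fin n → ℝ) :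
    ∑ a, ∑ b, ‖Matrix.diagonal (fun j => (d j : ℂ)) a b‖ ^ 2 = ∑ a, d a ^ 2 := by
  refine Finset.sum_congr rfl fun a _ => ?_
  rw [Finset.sum_eq_single a]
  · simp
  · intro b _ hb; simp [Matrix.diagonal_apply_ne _ hb.symm]
  · simp

lemma sq_sum_le {d : Fin n → ℝ} (hd : ∀ i, |d i| ≤ 2) : ∑ a, d a ^ 2 ≤ 4 * n := by
  calc ∑ a, d a ^ 2 ≤ ∑ a : Fin n, (4 : ℝ) := by
        refine Finset.sum_le_sum fun a _ => ?_
        have := sq_le_sq' (by linarith [abs_le.1 (hd a)]) (abs_le.1 (hd a)).2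
        linarith
    _ = 4 * n := by simp [mul_comm]

lemma frob_W {e : Fin n → ℝ} (he : ∀ i, |e i| ≤ 2) (U : UG n) :
    ∑ a, ∑ b, ‖W e U a b‖ ^ 2 ≤ 4 * n := by
  rw [W, frob_conj, frob_diag]
  exact sq_sum_le he

lemma frob_WDW {d e e' : Fin n → ℝ} (hd : ∀ i, |d i| ≤ 2) (he : ∀ i, |e i| ≤ 2)
    (he' : ∀ i, |e' i| ≤ 2) (U : UG n) :
    ∑ a, ∑ b, ‖∑ c, W e U a c * d c * W e' U c b‖ ^ 2 ≤ 64 * n := by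
  set D := Matrix.diagonal (fun j => (d j : ℂ)) with hD
  set E := Matrix.diagonal (fun j => (e j : ℂ)) with hE
  set E' := Matrix.diagonal (fun j => (e' j : ℂ)) with hE'
  set N := star U.1 * D * U.1 with hN
  have hM : ∀ a b, ∑ c, W e U a c * d c * W e' U c b = (U.1 * (E * N * E') * star U.1) a b := by
    intro a b
    have : U.1 * (E * N * E') * star U.1 = W e U * D * W e' U := by
      simp only [W, hN, mul_assoc, hE, hE']
    rw [this, Matrix.mul_apply]
    simp [hD, Matrix.mul_diagonal]
  simp only [hM]
  rw [frob_conj]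
  have hN2 : ∑ a, ∑ b, ‖N a b‖ ^ 2 = ∑ a, d a ^ 2 := by
    have := frob_conj (star U) D
    rw [frob_diag] at this
    rw [← this]
    simp [hN]
  calc ∑ a, ∑ b, ‖(E * N * E') a b‖ ^ 2 ≤ ∑ a, ∑ b, 16 * ‖N a b‖ ^ 2 := by
        refine Finset.sum_le_sum fun a _ => Finset.sum_le_sum fun b _ => ?_
        have h1 : ‖(E * N * E') a b‖ = |e a| * ‖N a b‖ * |e' b| := by
          simp [hE, hE', Matrix.mul_diagonal, Matrix.diagonal_mul]
        have h2 : ‖(E * N * E') a b‖ ≤ 4 * ‖N a b‖ := by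
          rw [h1]
          have : |e a| * |e' b| ≤ 2 * 2 :=
            mul_le_mul (he a) (he' b) (abs_nonneg _) (by norm_num)
          nlinarith [norm_nonneg (N a b)]
        calc ‖(E * N * E') a b‖ ^ 2 ≤ (4 * ‖N a b‖) ^ 2 := by gcongr
          _ = _ := by ring
    _ = 16 * ∑ a, d a ^ 2 := by simp only [← Finset.mul_sum, hN2]
    _ ≤ 64 * n := by linarith [sq_sum_le hd]

lemma bd_gen {A : Matrix (Fin n) (Fin n) ℂ} {K : ℝ} {d d' e' : Fin n → ℝ} (U : UG n)
    (hA : ∑ a, ∑ b, ‖A a b‖ ^ 2 ≤ K) (hd : ∀ i, |d i| ≤ 2) (hd' : ∀ i, |d' i| ≤ 2)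
    (he' : ∀ i, |e' i| ≤ 2) :
    ‖∑ a, ∑ b, A a b * d b * (((d' a : ℂ) - d' b) * W e' U b a)‖ ≤ 4 * K + 16 * n := by
  have hW := frob_W he' U
  rw [Finset.sum_comm] at hW
  calc ‖∑ a, ∑ b, A a b * d b * (((d' a : ℂ) - d' b) * W e' U b a)‖
      ≤ ∑ a, ∑ b, ‖A a b * d b * (((d' a : ℂ) - d' b) * W e' U b a)‖ :=
        (norm_sum_le _ _).trans (Finset.sum_le_sum fun a _ => norm_sum_le _ _)
    _ ≤ ∑ a, ∑ b, (4 * ‖A a b‖ ^ 2 + 4 * ‖W e' U b a‖ ^ 2) := by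
        refine Finset.sum_le_sum fun a _ => Finset.sum_le_sum fun b _ => ?_
        rw [norm_mul, norm_mul, norm_mul]
        have h1 : ‖(d b : ℂ)‖ ≤ 2 := by simpa using hd b
        have h2 : ‖(d' a : ℂ) - d' b‖ ≤ 4 := by
          refine (norm_sub_le _ _).trans ?_
          have := hd' a
          have := hd' b
          simp only [Complex.norm_real, Real.norm_eq_abs]
          linarith
        have h3 : ‖(d b : ℂ)‖ * ‖(d' a : ℂ) - d' b‖ ≤ 2 * 4 :=
          mul_le_mul h1 h2 (norm_nonneg _) (by norm_num)
        have h4 : 0 ≤ ‖A a b‖ * ‖W e' U b a‖ := by positivity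
        nlinarith [sq_nonneg (‖A a b‖ - ‖W e' U b a‖)]
    _ = 4 * (∑ a, ∑ b, ‖A a b‖ ^ 2) + 4 * (∑ a, ∑ b, ‖W e' U b a‖ ^ 2) := by
        simp only [Finset.sum_add_distrib, Finset.mul_sum]
    _ ≤ 4 * K + 16 * n := by linarith

/-- The real random variable. -/
noncomputable def Xr {k : ℕ} (α : Fin k → ℝ) (d e : Fin k → Fin n → ℝ) (U : UG n) : ℝ :=
  ∑ l, α l * Zr (d l) (e l) U

/-- The exponential test function. -/
noncomputable def G {k : ℕ} (α : Fin k → ℝ) (d e : Fin k → Fin n → ℝ) (lam : ℝ) (U : UG n) : ℂ :=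
  Complex.exp (∑ l, (lam * α l * Complex.I) * Z (d l) (e l) U)

lemma G_eq {k : ℕ} (α : Fin k → ℝ) (d e : Fin k → Fin n → ℝ) (lam : ℝ) (U : UG n) :
    G α d e lam U = Complex.exp ((lam * Xr α d e U : ℝ) * Complex.I) := by
  rw [G]
  congr 1
  simp only [Xr, Z_eq]
  push_cast
  rw [Finset.mul_sum, Finset.sum_mul]
  exact Finset.sum_congr rfl fun l _ => by ring

lemma norm_G {k : ℕ} (α : Fin k → ℝ) (d e : Fin k → Fin n → ℝ) (lam : ℝ) (U : UG n) :
    ‖G α d e lam U‖ = 1 := by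
  rw [G_eq, Complex.norm_exp_ofReal_mul_I]

lemma hasG_G {k : ℕ} (α : Fin k → ℝ) (d e : Fin k → Fin n → ℝ) (lam : ℝ) :
    HasG (G α d e lam) (fun a b U => G α d e lam U *
      ∑ l, (lam * α l * Complex.I) * (((d l a : ℂ) - d l b) * W (e l) U b a)) :=
  (HasG.sum Finset.univ fun l _ => (hasG_Z (d l) (e l)).const_mul (lam * α l * Complex.I)).cexp

lemma bd_G {k : ℕ} (α : Fin k → ℝ) (d e : Fin k → Fin n → ℝ) (lam : ℝ) (U : UG n)
    {A : Matrix (Fin n) (Fin n) ℂ} {K : ℝ} {p : Fin n → ℝ}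
    (hA : ∑ a, ∑ b, ‖A a b‖ ^ 2 ≤ K) (hp : ∀ i, |p i| ≤ 2) (hd : ∀ l i, |d l i| ≤ 2)
    (he : ∀ l i, |e l i| ≤ 2) :
    ‖∑ a, ∑ b, A a b * p b * (G α d e lam U *
      ∑ l, (lam * α l * Complex.I) * (((d l a : ℂ) - d l b) * W (e l) U b a))‖ ≤
      |lam| * (∑ l, |α l|) * (4 * K + 16 * n) := by
  have h : ∑ a, ∑ b, A a b * p b * (G α d e lam U *
      ∑ l, (lam * α l * Complex.I) * (((d l a : ℂ) - d l b) * W (e l) U b a)) =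
      ∑ l, (G α d e lam U * (lam * α l * Complex.I)) *
        ∑ a, ∑ b, A a b * p b * (((d l a : ℂ) - d l b) * W (e l) U b a) := by
    simp only [Finset.mul_sum]
    rw [Finset.sum_comm' (t' := Finset.univ) (s' := fun _ => Finset.univ) (by simp)]
    rw [Finset.sum_congr rfl fun b _ => Finset.sum_comm]
    rw [Finset.sum_comm]
    refine Finset.sum_congr rfl fun l _ => ?_
    rw [Finset.sum_comm]
    refine Finset.sum_congr rfl fun a _ => Finset.sum_congr rfl fun b _ => by ring
  rw [h, Finset.mul_sum, Finset.sum_mul]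
  refine (norm_sum_le _ _).trans (Finset.sum_le_sum fun l _ => ?_)
  rw [norm_mul, norm_mul, norm_G, one_mul]
  have : ‖(lam : ℂ) * α l * Complex.I‖ = |lam| * |α l| := by simp
  rw [this]
  exact mul_le_mul_of_nonneg_left (bd_gen U hA hp (hd l) (he l)) (by positivity)

lemma norm_integral_le (μ : Measure (UG n)) [IsProbabilityMeasure μ] {F : UG n → ℂ} {C : ℝ}
    (h : ∀ U, ‖F U‖ ≤ C) : ‖∫ U, F U ∂μ‖ ≤ C := by
  have := norm_integral_le_of_norm_le_const (μ := μ) (Eventually.of_forall h)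
  simpa using this


section estimates

variable (μ : Measure (UG n)) [μ.IsHaarMeasure] [IsProbabilityMeasure μ]

lemma integral_Z (hn : 1 ≤ n) (d e : Fin n → ℝ) (hd : ∑ a, d a = 0) :
    ∫ U, Zr d e U ∂μ = 0 := by
  have h := ibpA μ d e hd (HasG.const 1)
  have hn' : (n : ℂ) ≠ 0 := by exact_mod_cast (by omega : n ≠ 0)
  simp only [mul_one, mul_zero, Finset.sum_const_zero, integral_zero, neg_zero, mul_eq_zero, hn',
    false_or, Z_eq] at h
  rw [integral_complex_ofReal] at h
  exact_mod_cast h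

lemma integral_Zsq (hn : 1 ≤ n) (d e : Fin n → ℝ) (hd0 : ∑ a, d a = 0) (hd : ∀ i, |d i| ≤ 2)
    (he : ∀ i, |e i| ≤ 2) : ∫ U, Zr d e U ^ 2 ∂μ ≤ 32 := by
  have h := ibpA μ d e hd0 (hasG_Z d e)
  have h1 : ∫ U, Z d e U * Z d e U ∂μ = ((∫ U, Zr d e U ^ 2 ∂μ : ℝ) : ℂ) := by
    rw [← integral_complex_ofReal]
    congr 1
    funext U
    rw [Z_eq]; push_cast; ring
  rw [h1] at h
  have h2 : ‖(n : ℂ) * ((∫ U, Zr d e U ^ 2 ∂μ : ℝ) : ℂ)‖ ≤ 32 * n := by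
    rw [h, norm_neg]
    refine norm_integral_le μ fun U => ?_
    have := bd_gen U (frob_W he U) hd hd he
    linarith
  rw [norm_mul, Complex.norm_natCast, Complex.norm_real, Real.norm_eq_abs] at h2
  have hn' : (0 : ℝ) < n := by exact_mod_cast hn
  have h3 : |∫ U, Zr d e U ^ 2 ∂μ| ≤ 32 := by
    by_contra hc
    push Not at hc
    nlinarith
  exact (le_abs_self _).trans h3

variable {k : ℕ} (α : Fin k → ℝ) (d e : Fin k → Fin n → ℝ) (lam : ℝ)

lemma est_C (hn : 1 ≤ n) (hd : ∀ l i, |d l i| ≤ 2) (he : ∀ l i, |e l i| ≤ 2)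
    (p q : Fin n → ℝ) (hp0 : ∑ a, p a = 0) (hp : ∀ i, |p i| ≤ 2) (hq : ∀ i, |q i| ≤ 2) :
    ‖∫ U, Z p q U * G α d e lam U ∂μ‖ ≤ 32 * (|lam| * ∑ l, |α l|) := by
  have h := ibpA μ p q hp0 (hasG_G α d e lam)
  have h2 : ‖(n : ℂ) * ∫ U, Z p q U * G α d e lam U ∂μ‖ ≤ n * (32 * (|lam| * ∑ l, |α l|)) := by
    rw [h, norm_neg]
    refine norm_integral_le μ fun U => ?_
    refine (bd_G α d e lam U (frob_W hq U) hp hd he).trans (le_of_eq ?_)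
    ring
  rw [norm_mul, Complex.norm_natCast] at h2
  have hn' : (0 : ℝ) < n := by exact_mod_cast hn
  exact le_of_mul_le_mul_left h2 hn'

lemma est_D (hn : 1 ≤ n) (hd : ∀ l i, |d l i| ≤ 2) (he : ∀ l i, |e l i| ≤ 2)
    (hd0 : ∀ l, ∑ a, d l a = 0) (he0 : ∀ l, ∑ a, e l a = 0) (l m : Fin k) :
    ‖∫ U, Y (d l) (e l) (d m) (e m) U * G α d e lam U ∂μ‖ ≤
      32 + 272 * (|lam| * ∑ l, |α l|) := by
  have h := ibpB μ (d l) (e l) (d m) (e m) (he0 l) (hd0 m) (hasG_G α d e lam)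
  have hn' : (1 : ℝ) ≤ n := by exact_mod_cast hn
  have hZ : ‖∫ U, Z (d l) (e l) U * Z (d m) (e m) U * G α d e lam U ∂μ‖ ≤ 32 := by
    have i1 : ∀ l, Integrable (fun U => Zr (d l) (e l) U ^ 2) μ := fun l =>
      ((continuous_Zr (d l) (e l)).pow 2).integrable_of_hasCompactSupport
        (HasCompactSupport.of_compactSpace _)
    calc _ ≤ ∫ U, (Zr (d l) (e l) U ^ 2 / 2 + Zr (d m) (e m) U ^ 2 / 2) ∂μ := by
          refine norm_integral_le_of_norm_le (((i1 l).div_const 2).add ((i1 m).div_const 2))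
            (Eventually.of_forall fun U => ?_)
          rw [norm_mul, norm_mul, norm_G, mul_one, Z_eq, Z_eq, Complex.norm_real,
            Complex.norm_real, Real.norm_eq_abs, Real.norm_eq_abs]
          have := sq_nonneg (|Zr (d l) (e l) U| - |Zr (d m) (e m) U|)
          have h1 := sq_abs (Zr (d l) (e l) U)
          have h2 := sq_abs (Zr (d m) (e m) U)
          nlinarith
      _ = (∫ U, Zr (d l) (e l) U ^ 2 ∂μ) / 2 + (∫ U, Zr (d m) (e m) U ^ 2 ∂μ) / 2 := by
          rw [integral_add ((i1 l).div_const 2) ((i1 m).div_const 2), integral_div, integral_div]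
      _ ≤ 32 := by
          have h1 := integral_Zsq μ hn (d l) (e l) (hd0 l) (hd l) (he l)
          have h2 := integral_Zsq μ hn (d m) (e m) (hd0 m) (hd m) (he m)
          linarith
  have h2 : ‖(n : ℂ) * ∫ U, Y (d l) (e l) (d m) (e m) U * G α d e lam U ∂μ‖ ≤
      n * (32 + 272 * (|lam| * ∑ l, |α l|)) := by
    rw [h]
    refine (norm_sub_le _ _).trans ?_
    rw [norm_neg]
    have h3 := norm_integral_le μ (fun U => (bd_G α d e lam U
      (A := fun a b => ∑ c, W (e l) U a c * (d l) c * W (e m) U c b)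
      (frob_WDW (hd l) (he l) (he m) U) (hd m) hd he))
    refine (add_le_add hZ h3).trans ?_
    nlinarith
  rw [norm_mul, Complex.norm_natCast] at h2
  exact le_of_mul_le_mul_left h2 (by linarith)

/-- normalized covariance -/
noncomputable def cov (x y : Fin n → ℝ) : ℝ := (∑ i, x i * y i) / n

lemma Z_prod (hn : 1 ≤ n) (P Q : Fin n → ℝ) (U : UG n) :
    Z P Q U = Z (fun i => P i - (∑ i, P i) / n) (fun i => Q i - (∑ i, Q i) / n) U +
      n * (((∑ i, P i) / n : ℝ) * ((∑ i, Q i) / n : ℝ)) := by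
  rw [Z_eq, Z_eq, Zr_shift]
  have hn' : (n : ℂ) ≠ 0 := by exact_mod_cast (by omega : n ≠ 0)
  push_cast
  field_simp
  ring

lemma sum_ident (d e d' e' : Fin n → ℝ) (U : UG n) :
    ∑ a, ∑ b, W e U a b * d b * (((d' a : ℂ) - d' b) * W e' U b a) =
      Y d e d' e' U - Z (fun i => d i * d' i) (fun i => e i * e' i) U := by
  have h1 : Z (fun i => d i * d' i) (fun i => e i * e' i) U =
      ∑ a, ∑ b, W e U a b * d b * (d' b * W e' U b a) := by
    have : (fun i => e i * e' i) = fun i => e' i * e i := by funext i; ring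
    rw [this, Z, Finset.sum_comm]
    refine Finset.sum_congr rfl fun b _ => ?_
    rw [← W_mul, Matrix.mul_apply, Finset.mul_sum]
    refine Finset.sum_congr rfl fun a _ => ?_
    push_cast; ring
  rw [h1, Y, ← Finset.sum_sub_distrib]
  refine Finset.sum_congr rfl fun a _ => ?_
  rw [← Finset.sum_sub_distrib]
  refine Finset.sum_congr rfl fun b _ => by ring

lemma mean_le (hn : 1 ≤ n) {P : Fin n → ℝ} (hP : ∀ i, |P i| ≤ 1) : |(∑ i, P i) / n| ≤ 1 := by
  have hn' : (0 : ℝ) < n := by exact_mod_cast hn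
  rw [abs_div, Nat.abs_cast, div_le_one hn']
  calc |∑ i, P i| ≤ ∑ i, |P i| := Finset.abs_sum_le_sum_abs _ _
    _ ≤ ∑ i : Fin n, (1 : ℝ) := Finset.sum_le_sum fun i _ => hP i
    _ = n := by simp

lemma pair_est (hn : 1 ≤ n) (hd : ∀ l i, |d l i| ≤ 1) (he : ∀ l i, |e l i| ≤ 1)
    (hd0 : ∀ l, ∑ a, d l a = 0) (he0 : ∀ l, ∑ a, e l a = 0) (l m : Fin k) :
    ‖(∫ U, (∑ a, ∑ b, W (e l) U a b * d l b * (((d m a : ℂ) - d m b) * W (e m) U b a)) *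
        G α d e lam U ∂μ) + n * (cov (d l) (d m) * cov (e l) (e m)) * ∫ U, G α d e lam U ∂μ‖ ≤
      32 + 304 * (|lam| * ∑ l, |α l|) := by
  have hd2 : ∀ l i, |d l i| ≤ 2 := fun l i => (hd l i).trans (by norm_num)
  have he2 : ∀ l i, |e l i| ≤ 2 := fun l i => (he l i).trans (by norm_num)
  have hn' : (n : ℝ) ≠ 0 := by exact_mod_cast (by omega : n ≠ 0)
  set P : Fin n → ℝ := fun i => d l i * d m i with hP
  set Q : Fin n → ℝ := fun i => e l i * e m i with hQ
  have hP1 : ∀ i, |P i| ≤ 1 := fun i => by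
    rw [hP, abs_mul]; exact mul_le_one₀ (hd l i) (abs_nonneg _) (hd m i)
  have hQ1 : ∀ i, |Q i| ≤ 1 := fun i => by
    rw [hQ, abs_mul]; exact mul_le_one₀ (he l i) (abs_nonneg _) (he m i)
  set P' : Fin n → ℝ := fun i => P i - (∑ i, P i) / n with hP'
  set Q' : Fin n → ℝ := fun i => Q i - (∑ i, Q i) / n with hQ'
  have hP2 : ∀ i, |P' i| ≤ 2 := fun i =>
    (abs_sub _ _).trans (by linarith [hP1 i, mean_le hn hP1])
  have hQ2 : ∀ i, |Q' i| ≤ 2 := fun i =>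
    (abs_sub _ _).trans (by linarith [hQ1 i, mean_le hn hQ1])
  have hP0 : ∑ i, P' i = 0 := by
    simp only [hP', Finset.sum_sub_distrib, Finset.sum_const, Finset.card_univ, Fintype.card_fin,
      nsmul_eq_mul]
    field_simp
    ring
  have hC := est_C μ α d e lam hn hd2 he2 P' Q' hP0 hP2 hQ2
  have hD := est_D μ α d e lam hn hd2 he2 hd0 he0 l m
  have hGc := (hasG_G α d e lam).cont
  have i1 : Integrable (fun U => Y (d l) (e l) (d m) (e m) U * G α d e lam U) μ :=
    integrable_of_cont μ ((continuous_Y _ _ _ _).mul hGc)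
  have i2 : Integrable (fun U => Z P' Q' U * G α d e lam U) μ :=
    integrable_of_cont μ ((hasG_Z _ _).cont.mul hGc)
  have i3 : Integrable (fun U => ((n : ℂ) * (cov (d l) (d m) * cov (e l) (e m))) * G α d e lam U) μ :=
    integrable_of_cont μ (continuous_const.mul hGc)
  have : (∫ U, (∑ a, ∑ b, W (e l) U a b * d l b * (((d m a : ℂ) - d m b) * W (e m) U b a)) *
        G α d e lam U ∂μ) + n * (cov (d l) (d m) * cov (e l) (e m)) * ∫ U, G α d e lam U ∂μ =
      (∫ U, Y (d l) (e l) (d m) (e m) U * G α d e lam U ∂μ) - ∫ U, Z P' Q' U * G α d e lam U ∂μ := by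
    have hpt : ∀ U, (∑ a, ∑ b, W (e l) U a b * d l b * (((d m a : ℂ) - d m b) * W (e m) U b a)) *
        G α d e lam U = Y (d l) (e l) (d m) (e m) U * G α d e lam U - Z P' Q' U * G α d e lam U -
          ((n : ℂ) * (cov (d l) (d m) * cov (e l) (e m))) * G α d e lam U := by
      intro U
      rw [sum_ident, Z_prod hn]
      simp only [cov, hP', hQ', hP, hQ]
      ring
    simp only [hpt]
    have i12 : Integrable (fun U => Y (d l) (e l) (d m) (e m) U * G α d e lam U -
        Z P' Q' U * G α d e lam U) μ := i1.sub i2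
    rw [integral_sub i12 i3, integral_sub i1 i2, integral_const_mul]
    ring
  rw [this]
  refine (norm_sub_le _ _).trans ((add_le_add hD hC).trans (le_of_eq ?_))
  ring

/-- limiting variance at level n -/
noncomputable def vn : ℝ := ∑ l, ∑ m, α l * α m * (cov (d l) (d m) * cov (e l) (e m))

lemma main_est (hn : 1 ≤ n) (hd : ∀ l i, |d l i| ≤ 1) (he : ∀ l i, |e l i| ≤ 1)
    (hd0 : ∀ l, ∑ a, d l a = 0) (he0 : ∀ l, ∑ a, e l a = 0) :
    ‖(∫ U, (Xr α d e U : ℂ) * G α d e lam U ∂μ) -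
        Complex.I * lam * vn α d e * ∫ U, G α d e lam U ∂μ‖ ≤
      |lam| * (∑ l, |α l|) ^ 2 * (32 + 304 * (|lam| * ∑ l, |α l|)) / n := by
  have hn' : (0 : ℝ) < n := by exact_mod_cast hn
  set A := ∑ l, |α l| with hA
  set B := 32 + 304 * (|lam| * A) with hB
  have hGc := (hasG_G α d e lam).cont
  set J : Fin k → Fin k → ℂ := fun l m =>
    ∫ U, (∑ a, ∑ b, W (e l) U a b * d l b * (((d m a : ℂ) - d m b) * W (e m) U b a)) *
        G α d e lam U ∂μ with hJ
  have hl : ∀ l, (n : ℂ) * ∫ U, Z (d l) (e l) U * G α d e lam U ∂μ =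
      - ∑ m, (lam * α m * Complex.I) * J l m := by
    intro l
    rw [ibpA μ (d l) (e l) (hd0 l) (hasG_G α d e lam)]
    congr 1
    simp only [hJ, ← integral_const_mul]
    rw [← integral_finsetSum]
    · congr 1
      funext U
      simp only [Finset.mul_sum, Finset.sum_mul]
      rw [Finset.sum_comm' (t' := Finset.univ) (s' := fun _ => Finset.univ) (by simp)]
      rw [Finset.sum_congr rfl fun b _ => Finset.sum_comm]
      rw [Finset.sum_comm]
      refine Finset.sum_congr rfl fun l _ => ?_
      rw [Finset.sum_comm]
      refine Finset.sum_congr rfl fun a _ => Finset.sum_congr rfl fun b _ => by ring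
    · intro m _
      refine integrable_of_cont μ (continuous_const.mul (Continuous.mul ?_ hGc))
      exact continuous_finsetSum _ fun a _ => continuous_finsetSum _ fun b _ =>
        ((continuous_W _ a b).mul continuous_const).mul (continuous_const.mul (continuous_W _ b a))
  have hX : ∫ U, (Xr α d e U : ℂ) * G α d e lam U ∂μ =
      ∑ l, α l * ∫ U, Z (d l) (e l) U * G α d e lam U ∂μ := by
    simp only [← integral_const_mul]
    rw [← integral_finsetSum]
    · congr 1
      funext U
      simp only [Xr, Z_eq]
      push_cast
      rw [Finset.sum_mul]
      exact Finset.sum_congr rfl fun l _ => by ring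
    · intro m _
      exact integrable_of_cont μ (continuous_const.mul ((hasG_Z _ _).cont.mul hGc))
  rw [le_div_iff₀ hn', mul_comm, ← Complex.norm_natCast n, ← norm_mul]
  have hfin : (n : ℂ) * ((∫ U, (Xr α d e U : ℂ) * G α d e lam U ∂μ) -
        Complex.I * lam * vn α d e * ∫ U, G α d e lam U ∂μ) =
      ∑ l, ∑ m, (-(lam * α l * α m * Complex.I)) *
        (J l m + n * (cov (d l) (d m) * cov (e l) (e m)) * ∫ U, G α d e lam U ∂μ) := by
    rw [hX, mul_sub, Finset.mul_sum]
    have : ∀ l, (n : ℂ) * (α l * ∫ U, Z (d l) (e l) U * G α d e lam U ∂μ) =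
        ∑ m, (-(lam * α l * α m * Complex.I)) * J l m := by
      intro l
      rw [mul_left_comm, hl, ← Finset.sum_neg_distrib, Finset.mul_sum]
      exact Finset.sum_congr rfl fun m _ => by ring
    simp only [this, mul_add, Finset.sum_add_distrib]
    rw [sub_eq_add_neg]
    congr 1
    simp only [vn]
    push_cast
    simp only [Finset.mul_sum, Finset.sum_mul, ← Finset.sum_neg_distrib]
    exact Finset.sum_congr rfl fun l _ => Finset.sum_congr rfl fun m _ => by ring
  rw [hfin]
  calc _ ≤ ∑ l, ∑ m, |lam| * |α l| * |α m| * B := by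
        refine (norm_sum_le _ _).trans (Finset.sum_le_sum fun l _ => (norm_sum_le _ _).trans
          (Finset.sum_le_sum fun m _ => ?_))
        rw [norm_mul]
        have h1 : ‖-((lam : ℂ) * α l * α m * Complex.I)‖ = |lam| * |α l| * |α m| := by simp
        rw [h1]
        exact mul_le_mul_of_nonneg_left (pair_est μ α d e lam hn hd he hd0 he0 l m) (by positivity)
    _ = |lam| * A ^ 2 * B := by
        rw [sq, hA]
        simp only [Finset.mul_sum, Finset.sum_mul]
        rw [Finset.sum_comm]
        exact Finset.sum_congr rfl fun l _ => Finset.sum_congr rfl fun m _ => by ring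

end estimates


section charfun

variable (μ : Measure (UG n)) [μ.IsHaarMeasure] [IsProbabilityMeasure μ]
variable {k : ℕ} (α : Fin k → ℝ) (d e : Fin k → Fin n → ℝ)

lemma continuous_Xr : Continuous (Xr α d e) :=
  continuous_finsetSum _ fun l _ => continuous_const.mul (continuous_Zr _ _)

lemma phi_deriv (lam : ℝ) : HasDerivAt (fun lam => ∫ U, G α d e lam U ∂μ)
    (Complex.I * ∫ U, (Xr α d e U : ℂ) * G α d e lam U ∂μ) lam := by
  obtain ⟨C, hC⟩ := (isCompact_univ (X := UG n)).exists_bound_of_continuousOn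
    (continuous_Xr α d e).continuousOn
  have hXc : Continuous (fun U => (Xr α d e U : ℂ)) :=
    Complex.continuous_ofReal.comp (continuous_Xr α d e)
  have key := hasDerivAt_integral_of_dominated_loc_of_deriv_le (μ := μ) (𝕜 := ℝ)
    (bound := fun _ => C) (F := fun t U => G α d e t U) (x₀ := lam) (s := Set.univ)
    (F' := fun t U => Complex.I * ((Xr α d e U : ℂ) * G α d e t U)) Filter.univ_mem
    (Eventually.of_forall fun t =>
      (integrable_of_cont μ (hasG_G α d e t).cont).aestronglyMeasurable)
    (integrable_of_cont μ (hasG_G α d e lam).cont)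
    (integrable_of_cont μ (continuous_const.mul
      (hXc.mul (hasG_G α d e lam).cont))).aestronglyMeasurable
    (Eventually.of_forall fun U t _ => by
      rw [norm_mul, norm_mul, norm_G, Complex.norm_I, one_mul, mul_one, Complex.norm_real]
      exact hC U (Set.mem_univ _))
    (integrable_const C)
    (Eventually.of_forall fun U t _ => by
      simp only [G_eq]
      have h1 : HasDerivAt (fun x : ℝ => ((x * Xr α d e U : ℝ) : ℂ) * Complex.I)
          ((Xr α d e U : ℂ) * Complex.I) t := by
        have := ((hasDerivAt_id t).mul_const (Xr α d e U)).ofReal_comp.mul_const Complex.I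
        simpa using this
      refine h1.cexp.congr_deriv ?_
      ring)
  have k2 := key.2
  rwa [integral_const_mul] at k2

lemma cov_le (hn : 1 ≤ n) {x y : Fin n → ℝ} (hx : ∀ i, |x i| ≤ 1) (hy : ∀ i, |y i| ≤ 1) :
    |cov x y| ≤ 1 :=
  mean_le hn fun i => by rw [abs_mul]; exact mul_le_one₀ (hx i) (abs_nonneg _) (hy i)

lemma vn_le (hn : 1 ≤ n) (hd : ∀ l i, |d l i| ≤ 1) (he : ∀ l i, |e l i| ≤ 1) :
    |vn α d e| ≤ (∑ l, |α l|) ^ 2 := by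
  rw [sq, vn, Finset.sum_mul]
  refine (Finset.abs_sum_le_sum_abs _ _).trans (Finset.sum_le_sum fun l _ => ?_)
  rw [Finset.mul_sum]
  refine (Finset.abs_sum_le_sum_abs _ _).trans (Finset.sum_le_sum fun m _ => ?_)
  rw [abs_mul, abs_mul, abs_mul]
  have h := mul_le_one₀ (cov_le hn (hd l) (hd m)) (abs_nonneg _) (cov_le hn (he l) (he m))
  exact mul_le_of_le_one_right (by positivity) h

lemma phi_est (hn : 1 ≤ n) (hd : ∀ l i, |d l i| ≤ 1) (he : ∀ l i, |e l i| ≤ 1)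
    (hd0 : ∀ l, ∑ a, d l a = 0) (he0 : ∀ l, ∑ a, e l a = 0) (lam : ℝ) :
    ‖(∫ U, G α d e lam U ∂μ) * Complex.exp ((vn α d e * lam ^ 2 / 2 : ℝ) : ℂ) - 1‖ ≤
      (Real.exp ((∑ l, |α l|) ^ 2 * lam ^ 2 / 2) *
        (|lam| * (∑ l, |α l|) ^ 2 * (32 + 304 * (|lam| * ∑ l, |α l|))) * |lam|) / n := by
  set A := ∑ l, |α l| with hA
  have hA0 : 0 ≤ A := Finset.sum_nonneg fun l _ => abs_nonneg _
  set v := vn α d e with hv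
  set φ : ℝ → ℂ := fun s => ∫ U, G α d e s U ∂μ with hφ
  have hder : ∀ s : ℝ, HasDerivAt (fun s : ℝ => φ s * Complex.exp ((v * s ^ 2 / 2 : ℝ) : ℂ))
      (Complex.exp ((v * s ^ 2 / 2 : ℝ) : ℂ) * (Complex.I *
        ((∫ U, (Xr α d e U : ℂ) * G α d e s U ∂μ) - Complex.I * s * v * φ s))) s := by
    intro s
    have h1 := phi_deriv μ α d e s
    have h2 : HasDerivAt (fun s : ℝ => ((v * s ^ 2 / 2 : ℝ) : ℂ)) ((v * s : ℝ) : ℂ) s := by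
      apply HasDerivAt.ofReal_comp
      have := (((hasDerivAt_id s).pow 2).const_mul v).div_const 2
      refine this.congr_deriv ?_
      simp
      ring
    refine (h1.mul h2.cexp).congr_deriv ?_
    push_cast
    linear_combination (Complex.exp (v * s ^ 2 / 2) * s * v * φ s) * Complex.I_sq
  have hbd : ∀ s ∈ Set.uIcc 0 lam, ‖Complex.exp ((v * s ^ 2 / 2 : ℝ) : ℂ) * (Complex.I *
        ((∫ U, (Xr α d e U : ℂ) * G α d e s U ∂μ) - Complex.I * s * v * φ s))‖ ≤
      Real.exp (A ^ 2 * lam ^ 2 / 2) * (|lam| * A ^ 2 * (32 + 304 * (|lam| * A)) / n) := by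
    intro s hs
    have hsl : |s| ≤ |lam| := by
      have := Set.abs_sub_left_of_mem_uIcc hs
      simpa using this
    rw [norm_mul, norm_mul, Complex.norm_I, one_mul, ← Complex.ofReal_exp, Complex.norm_real,
      Real.norm_eq_abs, abs_of_pos (Real.exp_pos _)]
    have h1 := main_est μ α d e s hn hd he hd0 he0
    have hs2 : s ^ 2 ≤ lam ^ 2 := sq_le_sq.2 hsl
    have hvA : v ≤ A ^ 2 := (le_abs_self _).trans (vn_le α d e hn hd he)
    refine mul_le_mul ?_ (h1.trans ?_) (norm_nonneg _) (Real.exp_pos _).le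
    · apply Real.exp_le_exp.2
      have : v * s ^ 2 ≤ A ^ 2 * lam ^ 2 := mul_le_mul hvA hs2 (sq_nonneg _) (sq_nonneg _)
      linarith
    · rw [← hA]
      gcongr
  have hmv := (convex_uIcc (0 : ℝ) lam).norm_image_sub_le_of_norm_hasDerivWithin_le
    (fun s _ => (hder s).hasDerivWithinAt) hbd Set.left_mem_uIcc Set.right_mem_uIcc
  have h0 : φ 0 * Complex.exp ((v * 0 ^ 2 / 2 : ℝ) : ℂ) = 1 := by
    simp [hφ, G]
  rw [h0] at hmv
  refine hmv.trans (le_of_eq ?_)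
  rw [sub_zero, Real.norm_eq_abs]
  ring

end charfun

/-- centered indicator -/
noncomputable def cind (n p : ℕ) (i : Fin n) : ℝ := (if (i : ℕ) < p then 1 else 0) - (p : ℝ) / n

lemma sum_ind {p : ℕ} (hp : p ≤ n) : ∑ i : Fin n, (if (i : ℕ) < p then (1 : ℝ) else 0) = p := by
  rw [Fin.sum_univ_eq_sum_range (fun i => if i < p then (1 : ℝ) else 0) n, Finset.sum_ite]
  simp only [Finset.sum_const, Finset.sum_const_zero, nsmul_eq_mul, mul_one, mul_zero, add_zero]
  congr 1
  have : (Finset.range n).filter (fun x => x < p) = Finset.range p := by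
    ext x; simp; omega
  rw [this, Finset.card_range]

lemma cind_sum (hn : 1 ≤ n) {p : ℕ} (hp : p ≤ n) : ∑ i, cind n p i = 0 := by
  have hn' : (n : ℝ) ≠ 0 := by exact_mod_cast (by omega : n ≠ 0)
  simp only [cind, Finset.sum_sub_distrib, sum_ind hp]
  simp
  field_simp
  ring

lemma cind_le (hn : 1 ≤ n) {p : ℕ} (hp : p ≤ n) (i : Fin n) : |cind n p i| ≤ 1 := by
  have hn' : (0 : ℝ) < n := by exact_mod_cast hn
  have h1 : (p : ℝ) / n ≤ 1 := by rw [div_le_one hn']; exact_mod_cast hp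
  have h2 : 0 ≤ (p : ℝ) / n := by positivity
  rw [cind, abs_le]
  split_ifs <;> constructor <;> linarith

lemma cind_cov (hn : 1 ≤ n) {p q : ℕ} (hp : p ≤ n) (hq : q ≤ n) :
    cov (cind n p) (cind n q) = min ((p : ℝ) / n) ((q : ℝ) / n) - (p : ℝ) / n * ((q : ℝ) / n) := by
  have hn' : (0 : ℝ) < n := by exact_mod_cast hn
  have h : ∀ i : Fin n, cind n p i * cind n q i =
      (if (i : ℕ) < min p q then (1 : ℝ) else 0) - (q : ℝ) / n * (if (i : ℕ) < p then 1 else 0)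
        - (p : ℝ) / n * (if (i : ℕ) < q then 1 else 0) + (p : ℝ) / n * ((q : ℝ) / n) := by
    intro i
    simp only [cind, lt_min_iff]
    by_cases h1 : (i : ℕ) < p <;> by_cases h2 : (i : ℕ) < q <;>
      simp only [h1, h2, and_self, and_true, and_false, if_true, if_false] <;> ring
  rw [cov]
  simp only [h, Finset.sum_add_distrib, Finset.sum_sub_distrib, ← Finset.mul_sum, sum_ind hp,
    sum_ind hq, sum_ind ((min_le_left p q).trans hp)]
  rw [min_div_div_right hn'.le, ← Nat.cast_min]
  simp only [Finset.sum_const, Finset.card_univ, Fintype.card_fin, nsmul_eq_mul]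
  field_simp
  ring

lemma trunc_eq (hn : 1 ≤ n) {p q : ℕ} (hp : p ≤ n) (hq : q ≤ n) (U : UG n) :
    truncTraceU n p q U = Zr (cind n p) (cind n q) U + (p : ℝ) * q / n := by
  have hn' : (n : ℝ) ≠ 0 := by exact_mod_cast (by omega : n ≠ 0)
  have h := Zr_shift (fun i : Fin n => if (i : ℕ) < p then (1 : ℝ) else 0)
    (fun i : Fin n => if (i : ℕ) < q then (1 : ℝ) else 0) ((p : ℝ) / n) ((q : ℝ) / n) U
  rw [sum_ind hp, sum_ind hq] at h
  have h2 : truncTraceU n p q U = Zr (fun i : Fin n => if (i : ℕ) < p then (1 : ℝ) else 0)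
    (fun i : Fin n => if (i : ℕ) < q then (1 : ℝ) else 0) U := by
    rw [truncTraceU, Zr]
    refine Finset.sum_congr rfl fun a _ => Finset.sum_congr rfl fun b _ => ?_
    by_cases h1 : (a : ℕ) < p <;> by_cases h2 : (b : ℕ) < q <;> simp [h1, h2]
  have h3 : Zr (cind n p) (cind n q) U = Zr (fun i : Fin n => (if (i : ℕ) < p then (1 : ℝ) else 0) - (p : ℝ) / n)
    (fun i : Fin n => (if (i : ℕ) < q then (1 : ℝ) else 0) - (q : ℝ) / n) U := rfl
  rw [h3, h, h2]
  field_simp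
  ring

lemma trunc_centered (μ : Measure (UG n)) [μ.IsHaarMeasure] [IsProbabilityMeasure μ]
    (hn : 1 ≤ n) {p q : ℕ} (hp : p ≤ n) (hq : q ≤ n) (U : UG n) :
    truncTraceU n p q U - ∫ V, truncTraceU n p q V ∂μ = Zr (cind n p) (cind n q) U := by
  simp only [trunc_eq hn hp hq]
  rw [integral_add ((continuous_Zr _ _).integrable_of_hasCompactSupport
    (HasCompactSupport.of_compactSpace _)) (integrable_const _),
    integral_Z μ hn _ _ (cind_sum hn hp)]
  simp

lemma floor_le {n : ℕ} {s : ℝ} (hs : s ∈ Set.Icc (0 : ℝ) 1) : ⌊(n : ℝ) * s⌋₊ ≤ n := by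
  apply Nat.floor_le_of_le
  exact mul_le_of_le_one_right (Nat.cast_nonneg n) hs.2

lemma floor_tendsto {s : ℝ} (hs : s ∈ Set.Icc (0 : ℝ) 1) :
    Tendsto (fun n : ℕ => (⌊(n : ℝ) * s⌋₊ : ℝ) / n) atTop (nhds s) := by
  have := (tendsto_nat_floor_mul_div_atTop (R := ℝ) hs.1).comp tendsto_natCast_atTop_atTop
  refine this.congr fun n => ?_
  simp [mul_comm]

end TTU

/-- Finite-dimensional CLT: if `U⁽ⁿ⁾` is Haar distributed on `U(n)`,
`a₁, …, a_k ∈ ℝ` and `(s₁,t₁), …, (s_k,t_k) ∈ [0,1]²`, then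
`X⁽ⁿ⁾ = Σᵢ aᵢ (T_{⌊nsᵢ⌋,⌊ntᵢ⌋} - E[T_{⌊nsᵢ⌋,⌊ntᵢ⌋}])` converges in distribution to a centered
Gaussian with variance `Σᵢⱼ aᵢ aⱼ (sᵢ∧sⱼ - sᵢsⱼ)(tᵢ∧tⱼ - tᵢtⱼ)` (weak convergence tested
against bounded continuous functions). -/
theorem truncTraceU_fdd_clt
    (μ : ∀ n : ℕ, Measure (Matrix.unitaryGroup (Fin n) ℂ))
    (hHaar : ∀ n, (μ n).IsHaarMeasure) (hProb : ∀ n, IsProbabilityMeasure (μ n))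
    (k : ℕ) (hk : 1 ≤ k) (a : Fin k → ℝ) (s t : Fin k → ℝ)
    (hs : ∀ i, s i ∈ Set.Icc (0 : ℝ) 1) (ht : ∀ i, t i ∈ Set.Icc (0 : ℝ) 1) :
    ∀ f : BoundedContinuousFunction ℝ ℝ,
      Tendsto (fun n : ℕ =>
          ∫ U, f (∑ i : Fin k, a i *
            (truncTraceU n ⌊(n : ℝ) * s i⌋₊ ⌊(n : ℝ) * t i⌋₊ U -
              ∫ V, truncTraceU n ⌊(n : ℝ) * s i⌋₊ ⌊(n : ℝ) * t i⌋₊ V ∂(μ n))) ∂(μ n))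
        atTop
        (nhds (∫ x, f x ∂(gaussianReal 0 (Real.toNNReal (∑ i : Fin k, ∑ j : Fin k,
          a i * a j * (min (s i) (s j) - s i * s j) * (min (t i) (t j) - t i * t j)))))) := by
  intro f
  haveI := hHaar
  haveI := hProb
  let d : ∀ n : ℕ, Fin k → Fin n → ℝ := fun n l => TTU.cind n ⌊(n : ℝ) * s l⌋₊
  let e : ∀ n : ℕ, Fin k → Fin n → ℝ := fun n l => TTU.cind n ⌊(n : ℝ) * t l⌋₊
  set σ : ℝ := ∑ i : Fin k, ∑ j : Fin k,
    a i * a j * (min (s i) (s j) - s i * s j) * (min (t i) (t j) - t i * t j) with hσ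
  have hv : Tendsto (fun n : ℕ => TTU.vn a (d n) (e n)) atTop (nhds σ) := by
    have h1 : Tendsto (fun n : ℕ => ∑ i : Fin k, ∑ j : Fin k, a i * a j *
        (min ((⌊(n : ℝ) * s i⌋₊ : ℝ) / n) ((⌊(n : ℝ) * s j⌋₊ : ℝ) / n) -
          (⌊(n : ℝ) * s i⌋₊ : ℝ) / n * ((⌊(n : ℝ) * s j⌋₊ : ℝ) / n)) *
        (min ((⌊(n : ℝ) * t i⌋₊ : ℝ) / n) ((⌊(n : ℝ) * t j⌋₊ : ℝ) / n) -
          (⌊(n : ℝ) * t i⌋₊ : ℝ) / n * ((⌊(n : ℝ) * t j⌋₊ : ℝ) / n))) atTop (nhds σ) := by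
      refine tendsto_finsetSum _ fun i _ => tendsto_finsetSum _ fun j _ => ?_
      have si := TTU.floor_tendsto (hs i)
      have sj := TTU.floor_tendsto (hs j)
      have ti := TTU.floor_tendsto (ht i)
      have tj := TTU.floor_tendsto (ht j)
      exact (tendsto_const_nhds.mul ((si.min sj).sub (si.mul sj))).mul
        ((ti.min tj).sub (ti.mul tj))
    refine h1.congr' ?_
    filter_upwards [eventually_ge_atTop 1] with n hn
    rw [TTU.vn]
    refine Finset.sum_congr rfl fun i _ => Finset.sum_congr rfl fun j _ => ?_
    rw [TTU.cind_cov hn (TTU.floor_le (hs i)) (TTU.floor_le (hs j)),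
      TTU.cind_cov hn (TTU.floor_le (ht i)) (TTU.floor_le (ht j)), mul_assoc]
  have hphi : ∀ lam : ℝ, Tendsto (fun n : ℕ => ∫ U, TTU.G a (d n) (e n) lam U ∂(μ n)) atTop
      (nhds (Complex.exp ((-(σ * lam ^ 2 / 2) : ℝ) : ℂ))) := by
    intro lam
    have h1 : Tendsto (fun n : ℕ => (∫ U, TTU.G a (d n) (e n) lam U ∂(μ n)) *
        Complex.exp ((TTU.vn a (d n) (e n) * lam ^ 2 / 2 : ℝ) : ℂ)) atTop (nhds 1) := by
      rw [tendsto_iff_norm_sub_tendsto_zero]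
      refine squeeze_zero' (Eventually.of_forall fun n => norm_nonneg _) ?_
        (tendsto_const_div_atTop_nhds_zero_nat
          (Real.exp ((∑ l, |a l|) ^ 2 * lam ^ 2 / 2) *
            (|lam| * (∑ l, |a l|) ^ 2 * (32 + 304 * (|lam| * ∑ l, |a l|))) * |lam|))
      filter_upwards [eventually_ge_atTop 1] with n hn
      exact TTU.phi_est (μ n) a (d n) (e n) hn
        (fun l i => TTU.cind_le hn (TTU.floor_le (hs l)) i)
        (fun l i => TTU.cind_le hn (TTU.floor_le (ht l)) i)
        (fun l => TTU.cind_sum hn (TTU.floor_le (hs l)))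
        (fun l => TTU.cind_sum hn (TTU.floor_le (ht l))) lam
    have h2 : Tendsto (fun n : ℕ =>
        Complex.exp ((-(TTU.vn a (d n) (e n) * lam ^ 2 / 2) : ℝ) : ℂ)) atTop
        (nhds (Complex.exp ((-(σ * lam ^ 2 / 2) : ℝ) : ℂ))) :=
      (Complex.continuous_exp.tendsto _).comp ((Complex.continuous_ofReal.tendsto _).comp
        ((hv.mul_const _).div_const _).neg)
    have h3 := h1.mul h2
    rw [one_mul] at h3
    refine h3.congr fun n => ?_
    rw [mul_assoc, ← Complex.exp_add, ← Complex.ofReal_add, add_neg_cancel, Complex.ofReal_zero,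
      Complex.exp_zero, mul_one]
  have hσ0 : 0 ≤ σ := by
    have h1 : ‖Complex.exp ((-(σ * 1 ^ 2 / 2) : ℝ) : ℂ)‖ ≤ 1 := by
      refine le_of_tendsto (hphi 1).norm (Eventually.of_forall fun n => ?_)
      refine (norm_integral_le_integral_norm _).trans (le_of_eq ?_)
      simp [TTU.norm_G]
    rw [← Complex.ofReal_exp, Complex.norm_real, Real.norm_eq_abs, abs_of_pos (Real.exp_pos _),
      Real.exp_le_one_iff] at h1
    linarith
  have hmeas : ∀ n, AEMeasurable (TTU.Xr a (d n) (e n)) (μ n) := fun n =>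
    (TTU.continuous_Xr a (d n) (e n)).measurable.aemeasurable
  let ν : ℕ → ProbabilityMeasure ℝ := fun n =>
    ⟨(μ n).map (TTU.Xr a (d n) (e n)), Measure.isProbabilityMeasure_map (hmeas n)⟩
  let ν₀ : ProbabilityMeasure ℝ := ⟨gaussianReal 0 σ.toNNReal, inferInstance⟩
  have hlim : Tendsto ν atTop (nhds ν₀) := by
    refine ProbabilityMeasure.tendsto_of_tendsto_charFun fun lam => ?_
    have e0 : charFun (ν₀ : Measure ℝ) lam = Complex.exp ((-(σ * lam ^ 2 / 2) : ℝ) : ℂ) := by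
      change charFun (gaussianReal 0 σ.toNNReal) lam = _
      rw [charFun_gaussianReal, Real.coe_toNNReal _ hσ0]
      push_cast
      congr 1
      ring
    rw [e0]
    refine (hphi lam).congr fun n => ?_
    change _ = charFun ((μ n).map (TTU.Xr a (d n) (e n))) lam
    rw [charFun_apply_real, integral_map (hmeas n)
      (Continuous.aestronglyMeasurable (by fun_prop))]
    refine integral_congr_ae (Eventually.of_forall fun U => ?_)
    simp only [TTU.G_eq]
    push_cast
    rfl
  have hfin := (ProbabilityMeasure.tendsto_iff_forall_integral_tendsto.1 hlim) f
  refine hfin.congr' ?_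
  filter_upwards [eventually_ge_atTop 1] with n hn
  change ∫ x, f x ∂((μ n).map (TTU.Xr a (d n) (e n))) = _
  rw [integral_map (hmeas n) f.continuous.aestronglyMeasurable]
  refine integral_congr_ae (Eventually.of_forall fun U => ?_)
  simp only [TTU.trunc_centered (μ n) hn (TTU.floor_le (hs _)) (TTU.floor_le (ht _))]
  rfl
end

section
/- Let n ≥ 2, let O be a random matrix distributed according to the Haar probability measure on the orthogonal group O(n), and for 1 ≤ p, q ≤ n set T_{p,q} = Σ_{i≤p, j≤q} O_{ij}². Then E[T_{p,q}] = pq/n and Var(T_{p,q}) = 2 pq (n² − n(p+q) + pq) / (n²(n+2)(n−1)). -/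
open MeasureTheory Matrix ProbabilityTheory

/-- `T_{p,q} = Σ_{1 ≤ i ≤ p, 1 ≤ j ≤ q} O_{ij}²`, the trace of the product of the upper-left
`p × q` truncation of the orthogonal matrix `O` with its transpose. -/
noncomputable def truncTraceO (n p q : ℕ) (O : Matrix.orthogonalGroup (Fin n) ℝ) : ℝ :=
  ∑ i : Fin n, ∑ j : Fin n,
    if (i : ℕ) < p ∧ (j : ℕ) < q then ((O : Matrix (Fin n) (Fin n) ℝ) i j) ^ 2 else 0

namespace TruncAux

set_option linter.unusedSectionVars false

instance matBorel (n : ℕ) : BorelSpace (Matrix (Fin n) (Fin n) ℝ) :=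
  inferInstanceAs (BorelSpace (Fin n → Fin n → ℝ))

variable {n : ℕ}

/-- Plane reflection matrix mixing rows `i` and `k`. -/
def refl (i k : Fin n) (c s : ℝ) : Matrix (Fin n) (Fin n) ℝ := fun r t =>
  if r = i then (if t = i then c else 0) + (if t = k then s else 0)
  else if r = k then (if t = i then s else 0) + (if t = k then -c else 0)
  else if t = r then 1 else 0

lemma refl_mul (i k : Fin n) (c s : ℝ) (M : Matrix (Fin n) (Fin n) ℝ) (r j : Fin n) :
    (refl i k c s * M) r j = if r = i then c * M i j + s * M k j
      else if r = k then s * M i j - c * M k j else M r j := by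
  rw [Matrix.mul_apply]
  unfold refl
  split_ifs <;> simp [add_mul, Finset.sum_add_distrib, sub_eq_add_neg]

lemma refl_mem (i k : Fin n) (h : i ≠ k) (c s : ℝ) (hcs : c ^ 2 + s ^ 2 = 1) :
    refl i k c s ∈ Matrix.orthogonalGroup (Fin n) ℝ := by
  rw [Matrix.mem_orthogonalGroup_iff]
  have hs : (refl i k c s)ᵀ = refl i k c s := by
    ext r t
    simp only [Matrix.transpose_apply]
    unfold refl
    have := h.symm
    by_cases h1 : r = i <;> by_cases h2 : r = k <;> by_cases h3 : t = i <;>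
      by_cases h4 : t = k <;> simp_all [eq_comm]
  rw [hs]
  ext r t
  rw [refl_mul, Matrix.one_apply]
  unfold refl
  have := h.symm
  by_cases h1 : r = i <;> by_cases h2 : r = k <;> by_cases h3 : t = i <;>
      by_cases h4 : t = k <;> simp_all [eq_comm] <;> linarith

lemma entry_meas (i j : Fin n) :
    Measurable fun O : Matrix.orthogonalGroup (Fin n) ℝ => (O : Matrix (Fin n) (Fin n) ℝ) i j :=
  Measurable.comp (g := fun M : Fin n → Fin n → ℝ => M i j)
    ((measurable_pi_apply j).comp (measurable_pi_apply i)) measurable_subtype_coe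

lemma entry_le (O : Matrix.orthogonalGroup (Fin n) ℝ) (i j : Fin n) :
    |(O : Matrix (Fin n) (Fin n) ℝ) i j| ≤ 1 := entry_norm_bound_of_unitary O.2 i j

variable (μ : Measure (Matrix.orthogonalGroup (Fin n) ℝ))
    [μ.IsHaarMeasure] [IsProbabilityMeasure μ]

lemma integrable4 (i j i' j' k l k' l' : Fin n) :
    Integrable (fun O : Matrix.orthogonalGroup (Fin n) ℝ => O.1 i j * O.1 i' j' * (O.1 k l * O.1 k' l')) μ := by
  refine Integrable.of_bound (C := 1) ?_ (Filter.Eventually.of_forall fun O => ?_)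
  · exact (((entry_meas i j).mul (entry_meas i' j')).mul
      ((entry_meas k l).mul (entry_meas k' l'))).aestronglyMeasurable
  · rw [Real.norm_eq_abs, abs_mul, abs_mul, abs_mul]
    have := entry_le O
    exact mul_le_one₀ (mul_le_one₀ (this _ _) (abs_nonneg _) (this _ _)) (by positivity)
      (mul_le_one₀ (this _ _) (abs_nonneg _) (this _ _))

lemma integrable2 (i j i' j' : Fin n) :
    Integrable (fun O : Matrix.orthogonalGroup (Fin n) ℝ => O.1 i j * O.1 i' j') μ := by
  refine Integrable.of_bound (C := 1) ?_ (Filter.Eventually.of_forall fun O => ?_)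
  · exact ((entry_meas i j).mul (entry_meas i' j')).aestronglyMeasurable
  · rw [Real.norm_eq_abs, abs_mul]
    have := entry_le O
    exact (mul_le_one₀ (this _ _) (abs_nonneg _) (this _ _))

lemma inv_refl (i k : Fin n) (h : i ≠ k) (c s : ℝ) (hcs : c ^ 2 + s ^ 2 = 1)
    (f : Matrix (Fin n) (Fin n) ℝ → ℝ) :
    ∫ O, f (refl i k c s * O.1) ∂μ = ∫ O, f O.1 ∂μ :=
  integral_mul_left_eq_self (μ := μ) (fun O => f O.1) ⟨_, refl_mem i k h c s hcs⟩

/-- Second moment along a column pair. -/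
noncomputable def M2 (i j : Fin n) : ℝ := ∫ O, O.1 i j * O.1 i j ∂μ
noncomputable def MB (j l i k : Fin n) : ℝ := ∫ O, O.1 i j * O.1 i j * (O.1 k l * O.1 k l) ∂μ
noncomputable def MC (j l i k : Fin n) : ℝ := ∫ O, O.1 i j * O.1 i l * (O.1 k j * O.1 k l) ∂μ

lemma M2_swap (i k j : Fin n) (h : i ≠ k) : M2 μ i j = M2 μ k j := by
  unfold M2
  rw [← inv_refl μ i k h 0 1 (by norm_num) (fun M => M i j * M i j)]
  simp [refl_mul]

lemma MB_swap (i k j l : Fin n) (h : i ≠ k) : MB μ j l i k = MB μ j l k i := by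
  unfold MB
  rw [← inv_refl μ i k h 0 1 (by norm_num) (fun M => M i j * M i j * (M k l * M k l))]
  simp [refl_mul, h.symm]

lemma MB_diag (i k j l : Fin n) (h : i ≠ k) : MB μ j l i i = MB μ j l k k := by
  unfold MB
  rw [← inv_refl μ i k h 0 1 (by norm_num) (fun M => M i j * M i j * (M i l * M i l))]
  simp [refl_mul]

lemma MB_swap' (i k k' j l : Fin n) (h : i ≠ k) (h' : i ≠ k') : MB μ j l i k = MB μ j l i k' := by
  by_cases hk : k = k'
  · rw [hk]
  unfold MB
  rw [← inv_refl μ k k' hk 0 1 (by norm_num) (fun M => M i j * M i j * (M k l * M k l))]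
  simp [refl_mul, h, h']

lemma int5 {f₁ f₂ f₃ f₄ f₅ : Matrix.orthogonalGroup (Fin n) ℝ → ℝ} (h₁ : Integrable f₁ μ)
    (h₂ : Integrable f₂ μ) (h₃ : Integrable f₃ μ) (h₄ : Integrable f₄ μ) (h₅ : Integrable f₅ μ) :
    ∫ O, (f₁ O + f₂ O + f₃ O + f₄ O + 4 * f₅ O) ∂μ =
      ∫ O, f₁ O ∂μ + ∫ O, f₂ O ∂μ + ∫ O, f₃ O ∂μ + ∫ O, f₄ O ∂μ + 4 * ∫ O, f₅ O ∂μ := by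
  have h12 : Integrable (fun O => f₁ O + f₂ O) μ := h₁.add h₂
  have h123 : Integrable (fun O => f₁ O + f₂ O + f₃ O) μ := h12.add h₃
  have h1234 : Integrable (fun O => f₁ O + f₂ O + f₃ O + f₄ O) μ := h123.add h₄
  rw [integral_add h1234 (h₅.const_mul 4), integral_add h123 h₄, integral_add h12 h₃,
    integral_add h₁ h₂, integral_const_mul]

lemma rot (i k j l : Fin n) (h : i ≠ k) :
    MB μ j l i i = MB μ j l i k + 2 * MC μ j l i k := by
  have hc : (√2⁻¹ : ℝ) ^ 2 = 1 / 2 := by rw [Real.sq_sqrt (by norm_num)]; norm_num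
  have key := inv_refl μ i k h (√2⁻¹) (√2⁻¹) (by rw [hc]; norm_num)
    (fun M => M i j * M i j * (M i l * M i l) + M k j * M k j * (M k l * M k l))
  simp only [refl_mul, if_true, h.symm, if_false] at key
  have e : ∀ O : Matrix.orthogonalGroup (Fin n) ℝ, 
     (√2⁻¹ * O.1 i j + √2⁻¹ * O.1 k j) * (√2⁻¹ * O.1 i j + √2⁻¹ * O.1 k j) *
      ((√2⁻¹ * O.1 i l + √2⁻¹ * O.1 k l) * (√2⁻¹ * O.1 i l + √2⁻¹ * O.1 k l)) +
     (√2⁻¹ * O.1 i j - √2⁻¹ * O.1 k j) * (√2⁻¹ * O.1 i j - √2⁻¹ * O.1 k j) *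
      ((√2⁻¹ * O.1 i l - √2⁻¹ * O.1 k l) * (√2⁻¹ * O.1 i l - √2⁻¹ * O.1 k l)) =
     (1 / 2) * (O.1 i j * O.1 i j * (O.1 i l * O.1 i l) + O.1 k j * O.1 k j * (O.1 k l * O.1 k l)
      + O.1 i j * O.1 i j * (O.1 k l * O.1 k l) + O.1 k j * O.1 k j * (O.1 i l * O.1 i l)
      + 4 * (O.1 i j * O.1 i l * (O.1 k j * O.1 k l))) := by
    intro O
    have h4 : (√2⁻¹ : ℝ) ^ 4 = 1 / 4 := by
      rw [show (√2⁻¹ : ℝ) ^ 4 = ((√2⁻¹ : ℝ) ^ 2) ^ 2 by ring, hc]; norm_num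
    generalize (√2⁻¹ : ℝ) = w at *
    linear_combination (2 * (O.1 i j * O.1 i j * (O.1 i l * O.1 i l) + O.1 k j * O.1 k j * (O.1 k l * O.1 k l)
      + O.1 i j * O.1 i j * (O.1 k l * O.1 k l) + O.1 k j * O.1 k j * (O.1 i l * O.1 i l)
      + 4 * (O.1 i j * O.1 i l * (O.1 k j * O.1 k l)))) * h4
  simp_rw [e] at key
  have I := integrable4 μ
  rw [integral_const_mul, int5 μ (I _ _ _ _ _ _ _ _) (I _ _ _ _ _ _ _ _) (I _ _ _ _ _ _ _ _)
      (I _ _ _ _ _ _ _ _) (I _ _ _ _ _ _ _ _),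
    integral_add (I _ _ _ _ _ _ _ _) (I _ _ _ _ _ _ _ _)] at key
  have h1 := MB_swap μ i k j l h
  have h2 := MB_diag μ i k j l h
  unfold MB at *
  unfold MC
  linarith

lemma col_orth (O : Matrix.orthogonalGroup (Fin n) ℝ) (j l : Fin n) :
    ∑ k, O.1 k j * O.1 k l = if j = l then 1 else 0 := by
  have := (Matrix.mem_orthogonalGroup_iff' (Fin n) ℝ).1 O.2
  have := congrFun (congrFun this j) l
  simpa [Matrix.mul_apply, Matrix.one_apply] using this

lemma M2_val (hn : 2 ≤ n) (i j : Fin n) : M2 μ i j = 1 / n := by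
  have h : ∑ k, M2 μ k j = 1 := by
    unfold M2
    rw [← integral_finsetSum _ (fun k _ => integrable2 μ _ _ _ _)]
    simp [col_orth]
  have h2 : ∀ k, M2 μ k j = M2 μ i j := fun k => by
    by_cases hk : k = i
    · rw [hk]
    · exact M2_swap μ k i j hk
  simp [h2] at h
  have : (n : ℝ) ≠ 0 := by positivity
  field_simp
  linarith

lemma sumB (hn : 2 ≤ n) (j l i : Fin n) : ∑ k, MB μ j l i k = 1 / n := by
  unfold MB
  rw [← integral_finsetSum _ (fun k _ => integrable4 μ _ _ _ _ _ _ _ _)]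
  simp [← Finset.mul_sum, col_orth]
  simpa [M2] using M2_val μ hn i j

lemma sumC (j l i : Fin n) (h : j ≠ l) : ∑ k, MC μ j l i k = 0 := by
  unfold MC
  rw [← integral_finsetSum _ (fun k _ => integrable4 μ _ _ _ _ _ _ _ _)]
  simp [← Finset.mul_sum, col_orth, h]

lemma sum_split (f : Fin n → ℝ) (i : Fin n) (b : ℝ) (h : ∀ k, k ≠ i → f k = b) :
    ∑ k, f k = f i + ((n : ℝ) - 1) * b := by
  rw [← Finset.add_sum_erase _ _ (Finset.mem_univ i),
    Finset.sum_congr rfl (fun k hk => h k (Finset.ne_of_mem_erase hk))]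
  have : 1 ≤ n := i.pos
  simp [Finset.card_erase_of_mem, Nat.cast_sub this]

lemma MB_val (hn : 2 ≤ n) (i k j l : Fin n) : MB μ j l i k =
    ((n : ℝ) + 1) / (n * (n - 1) * (n + 2)) + (if i = k then -2 / ((n : ℝ) * (n - 1) * (n + 2)) else 0)
    + (if j = l then -2 / ((n : ℝ) * (n - 1) * (n + 2)) else 0)
    + (if i = k then if j = l then 2 * (n : ℝ) / (n * (n - 1) * (n + 2)) else 0 else 0) := by
  have hn' : (2 : ℝ) ≤ n := by exact_mod_cast hn
  have n1 : (n : ℝ) ≠ 0 := by linarith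
  have n2 : (n : ℝ) - 1 ≠ 0 := by linarith
  have n3 : (n : ℝ) + 2 ≠ 0 := by linarith
  obtain ⟨m, hm, hmk⟩ : ∃ m, i ≠ m ∧ (i ≠ k → m = k) := by
    by_cases h : i = k
    · have : Nontrivial (Fin n) := Fin.nontrivial_iff_two_le.2 hn
      obtain ⟨m, hm⟩ := exists_ne i
      exact ⟨m, hm.symm, fun h' => absurd h h'⟩
    · exact ⟨k, h, fun _ => rfl⟩
  have s1 := sumB μ hn j l i
  rw [sum_split _ i (MB μ j l i m) (fun t ht => MB_swap' μ i t m j l ht.symm hm)] at s1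
  have s2 := rot μ i m j l hm
  -- solve
  have sol : MB μ j l i i = (if j = l then 3 else 1) / ((n : ℝ) * (n + 2)) ∧
      MB μ j l i m = (if j = l then (n : ℝ) - 1 else n + 1) / (n * (n - 1) * (n + 2)) := by
    have a : MB μ j l i i = (if j = l then 3 else 1) / ((n : ℝ) * (n + 2)) := by
      by_cases hjl : j = l
      · subst hjl
        have : MC μ j j i m = MB μ j j i m := rfl
        rw [this] at s2
        have e : MB μ j j i m = MB μ j j i i / 3 := by linarith
        rw [e] at s1
        field_simp at s1
        simp only [if_true]
        field_simp
        linarith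
      · have s3 := sumC μ j l i hjl
        rw [sum_split _ i (MC μ j l i m) (fun t ht => by
          have r1 := rot μ i t j l ht.symm
          have r2 := MB_swap' μ i t m j l ht.symm hm
          linarith)] at s3
        have : MC μ j l i i = MB μ j l i i := by
          unfold MC MB; congr 1; ext O; ring
        rw [this] at s3
        have hh : ((n : ℝ) + 2) * MB μ j l i i = 1 / n := by
          linear_combination s1 + 2 * s3 + ((n : ℝ) - 1) * s2
        simp only [if_neg hjl]
        rw [eq_div_iff (by positivity), mul_comm (n : ℝ), ← mul_assoc, mul_comm _ ((n : ℝ) + 2), hh]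
        field_simp
    refine ⟨a, ?_⟩
    rw [a] at s1
    have e : MB μ j l i m = (1 / n - (if j = l then 3 else 1) / ((n : ℝ) * (n + 2))) / (n - 1) := by
      rw [eq_div_iff n2]; linarith
    rw [e]
    split_ifs <;> field_simp <;> ring
  by_cases h : i = k
  · subst h
    rw [sol.1]
    simp only [if_true]
    split_ifs <;> field_simp <;> ring
  · rw [← hmk h, sol.2]
    simp only [hm, if_false]
    split_ifs <;> field_simp <;> ring

lemma trunc_eq (p q : ℕ) (O : Matrix.orthogonalGroup (Fin n) ℝ) :
    truncTraceO n p q O = ∑ i : Fin n with i.1 < p, ∑ j : Fin n with j.1 < q, O.1 i j * O.1 i j := by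
  unfold truncTraceO
  simp_rw [Finset.sum_filter]
  refine Finset.sum_congr rfl fun i _ => ?_
  by_cases h : i.1 < p <;> simp [h, sq]

lemma card_lt (p : ℕ) (h : p ≤ n) : ((Finset.univ.filter fun i : Fin n => i.1 < p).card : ℝ) = p := by
  rw [Fin.card_filter_val_lt]; simp [h]

end TruncAux

open TruncAux in
/-- If `O` is Haar distributed on `O(n)` with `n ≥ 2` and `1 ≤ p, q ≤ n`, then
`E[T_{p,q}] = pq/n` and `Var(T_{p,q}) = 2pq(n² - n(p+q) + pq)/(n²(n+2)(n-1))`. -/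
theorem mean_variance_truncTraceO (n : ℕ) (hn : 2 ≤ n)
    (μ : Measure (Matrix.orthogonalGroup (Fin n) ℝ))
    [μ.IsHaarMeasure] [IsProbabilityMeasure μ]
    (p q : ℕ) (hp1 : 1 ≤ p) (hpn : p ≤ n) (hq1 : 1 ≤ q) (hqn : q ≤ n) :
    (∫ O, truncTraceO n p q O ∂μ = (p : ℝ) * q / n) ∧
    variance (truncTraceO n p q) μ =
      2 * ((p : ℝ) * q) * ((n : ℝ) ^ 2 - (n : ℝ) * ((p : ℝ) + q) + (p : ℝ) * q) /
        ((n : ℝ) ^ 2 * ((n : ℝ) + 2) * ((n : ℝ) - 1)) := by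
  have hn' : (2 : ℝ) ≤ n := by exact_mod_cast hn
  have n1 : (n : ℝ) ≠ 0 := by linarith
  have n2 : (n : ℝ) - 1 ≠ 0 := by linarith
  have n3 : (n : ℝ) + 2 ≠ 0 := by linarith
  have mean : ∫ O, truncTraceO n p q O ∂μ = (p : ℝ) * q / n := by
    simp_rw [trunc_eq]
    rw [integral_finsetSum _ (fun i _ => integrable_finsetSum _ fun j _ => integrable2 μ _ _ _ _)]
    have : ∀ i, ∫ O, ∑ j : Fin n with j.1 < q, O.1 i j * O.1 i j ∂μ = q / n := fun i => by
      rw [integral_finsetSum _ (fun j _ => integrable2 μ _ _ _ _)]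
      have := M2_val μ hn i
      unfold M2 at this
      simp_rw [this]
      rw [Finset.sum_const, nsmul_eq_mul, card_lt q hqn]; ring
    simp_rw [this]
    rw [Finset.sum_const, nsmul_eq_mul, card_lt p hpn]; ring
  refine ⟨mean, ?_⟩
  have sqeq : ∀ O, truncTraceO n p q O ^ 2 = ∑ i : Fin n with i.1 < p, ∑ k : Fin n with k.1 < p,
      ∑ j : Fin n with j.1 < q, ∑ l : Fin n with l.1 < q,
        O.1 i j * O.1 i j * (O.1 k l * O.1 k l) := fun O => by
    rw [trunc_eq, sq, Finset.sum_mul_sum]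
    simp_rw [Finset.sum_mul_sum]
  have hm : AEStronglyMeasurable (truncTraceO n p q) μ := by
    have : truncTraceO n p q = fun O => _ := funext (trunc_eq p q)
    rw [this]
    exact (integrable_finsetSum _ fun i _ => integrable_finsetSum _ fun j _ =>
      integrable2 μ _ _ _ _).aestronglyMeasurable
  have I2 : Integrable (fun O => truncTraceO n p q O ^ 2) μ := by
    simp_rw [sqeq]
    exact integrable_finsetSum _ fun i _ => integrable_finsetSum _ fun j _ =>
      integrable_finsetSum _ fun i _ => integrable_finsetSum _ fun j _ =>
      integrable4 μ _ _ _ _ _ _ _ _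
  rw [variance_eq_sub ((memLp_two_iff_integrable_sq hm).2 I2), mean]
  have second : ∫ O, (truncTraceO n p q ^ 2) O ∂μ =
      ∑ i : Fin n with i.1 < p, ∑ k : Fin n with k.1 < p,
      ∑ j : Fin n with j.1 < q, ∑ l : Fin n with l.1 < q, MB μ j l i k := by
    simp_rw [Pi.pow_apply, sqeq]
    have I := integrable4 μ
    rw [integral_finsetSum _ fun i _ => integrable_finsetSum _ fun j _ =>
      integrable_finsetSum _ fun i _ => integrable_finsetSum _ fun j _ => I _ _ _ _ _ _ _ _]
    refine Finset.sum_congr rfl fun i _ => ?_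
    rw [integral_finsetSum _ fun j _ =>
      integrable_finsetSum _ fun i _ => integrable_finsetSum _ fun j _ => I _ _ _ _ _ _ _ _]
    refine Finset.sum_congr rfl fun k _ => ?_
    rw [integral_finsetSum _ fun i _ => integrable_finsetSum _ fun j _ => I _ _ _ _ _ _ _ _]
    refine Finset.sum_congr rfl fun j _ => ?_
    rw [integral_finsetSum _ fun j _ => I _ _ _ _ _ _ _ _]
    rfl
  rw [second]
  simp_rw [MB_val μ hn]
  have gen : ∀ a b c d : ℝ, ∑ i : Fin n with i.1 < p, ∑ k : Fin n with k.1 < p,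
      ∑ j : Fin n with j.1 < q, ∑ l : Fin n with l.1 < q,
        (a + (if i = k then b else 0) + (if j = l then c else 0)
          + (if i = k then if j = l then d else 0 else 0)) =
      a * p ^ 2 * q ^ 2 + b * p * q ^ 2 + c * p ^ 2 * q + d * p * q := by
    intro a b c d
    have s1 : ∀ x y : ℝ, ∑ j : Fin n with j.1 < q, ∑ l : Fin n with l.1 < q,
        (x + if j = l then y else 0) = x * q ^ 2 + y * q := by
      intro x y
      have : ∀ j ∈ (Finset.univ.filter fun j : Fin n => j.1 < q),
          ∑ l : Fin n with l.1 < q, (x + if j = l then y else 0) = x * q + y := by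
        intro j hj
        rw [Finset.sum_add_distrib, Finset.sum_const, nsmul_eq_mul, card_lt q hqn,
          Finset.sum_ite_eq, if_pos hj]; ring
      rw [Finset.sum_congr rfl this, Finset.sum_const, nsmul_eq_mul, card_lt q hqn]; ring
    have s2 : ∀ i k : Fin n, ∑ j : Fin n with j.1 < q, ∑ l : Fin n with l.1 < q,
        (a + (if i = k then b else 0) + (if j = l then c else 0)
          + (if i = k then if j = l then d else 0 else 0)) =
        (a * q ^ 2 + c * q) + if i = k then b * q ^ 2 + d * q else 0 := by
      intro i k
      by_cases h : i = k
      · simp only [h, if_true]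
        have := s1 (a + b) (c + d)
        rw [show a * (q : ℝ) ^ 2 + c * q + (b * q ^ 2 + d * q) = (a + b) * q ^ 2 + (c + d) * q by ring,
          ← this]
        refine Finset.sum_congr rfl fun j _ => Finset.sum_congr rfl fun l _ => ?_
        split_ifs <;> ring
      · simp only [h, if_false, add_zero]
        exact s1 a c
    simp_rw [s2]
    have : ∀ i ∈ (Finset.univ.filter fun j : Fin n => j.1 < p),
          ∑ k : Fin n with k.1 < p, ((a * (q : ℝ) ^ 2 + c * q) + if i = k then b * (q : ℝ) ^ 2 + d * q else 0)
          = (a * (q : ℝ) ^ 2 + c * q) * p + (b * (q : ℝ) ^ 2 + d * q) := by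
        intro j hj
        rw [Finset.sum_add_distrib, Finset.sum_const, nsmul_eq_mul, card_lt p hpn,
          Finset.sum_ite_eq, if_pos hj]; ring
    rw [Finset.sum_congr rfl this, Finset.sum_const, nsmul_eq_mul, card_lt p hpn]; ring
  rw [gen]
  field_simp
  ring
end
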